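/- Let a < b and f, g ∈ C¹(ℝ) with f(a) = g(a) and f(b) = g(b), and assume the flux is genuinely nonlinear: neither ξ ↦ f'(ξ) nor ξ ↦ g'(ξ) is constant on any nondegenerate subinterval of (a, b). Let u₀ ∈ C_c^∞(ℝ) with a ≤ u₀ ≤ b. Then there exists a weak solution u ∈ L^∞((0,∞) × ℝ) of ∂_t u + ∂_x(H(x)f(u) + H(−x)g(u)) = 0 with initial datum u₀ that is entropy admissible, i.e., a ≤ u ≤ b a.e. and there exists p : (0,∞) → [a,b] such that the interface entropy inequality holds for every ξ ∈ ℝ. -/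

import Mathlib

open MeasureTheory Filter Set

/-- Heaviside function. -/
noncomputable def heav (x : ℝ) : ℝ := if 0 < x then 1 else 0

/-- Smooth test function compactly supported in `(0,∞) × ℝ`. -/
def IsTestFun (φ : ℝ × ℝ → ℝ) : Prop :=
  ContDiff ℝ (⊤ : ℕ∞) φ ∧ HasCompactSupport φ ∧ tsupport φ ⊆ Set.Ioi 0 ×ˢ Set.univ

/-- `u` is a weak solution of `∂ₜ u + ∂ₓ (H(x) f(u) + H(-x) g(u)) = 0` on
`(0,∞) × ℝ` with initial datum `u₀` (attained in the `L¹_loc` essential-limit sense). -/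
def IsWeakSolution (f g : ℝ → ℝ) (u : ℝ → ℝ → ℝ) (u₀ : ℝ → ℝ) : Prop :=
  (∀ φ : ℝ × ℝ → ℝ, IsTestFun φ →
    (∫ q : ℝ × ℝ, (u q.1 q.2 * fderiv ℝ φ q (1, 0)
      + (heav q.2 * f (u q.1 q.2) + heav (-q.2) * g (u q.1 q.2)) * fderiv ℝ φ q (0, 1))) = 0)
  ∧ (∀ K : Set ℝ, IsCompact K →
      Tendsto (fun t => ∫ x in K, |u t x - u₀ x|)
        ((nhdsWithin 0 (Set.Ioi 0)) ⊓ MeasureTheory.ae (volume : Measure ℝ)) (nhds 0))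

/-- Entropy admissibility (Definition `def-adm`): `a ≤ u ≤ b` a.e. and there is an
interface connection function `p : (0,∞) → [a,b]` such that the Kruzhkov-type
entropy inequality with interface term `sgn(p(t) - ξ)(f(ξ) - g(ξ)) δ(x)` holds. -/
def EntropyAdmissible (f g : ℝ → ℝ) (a b : ℝ) (u : ℝ → ℝ → ℝ) : Prop :=
  (∀ᵐ q : ℝ × ℝ, 0 < q.1 → u q.1 q.2 ∈ Set.Icc a b) ∧
  ∃ p : ℝ → ℝ, Measurable p ∧ (∀ t, p t ∈ Set.Icc a b) ∧
    ∀ ξ : ℝ, ∀ φ : ℝ × ℝ → ℝ, IsTestFun φ → (∀ q, 0 ≤ φ q) →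
      (∫ q : ℝ × ℝ, (|u q.1 q.2 - ξ| * fderiv ℝ φ q (1, 0)
        + Real.sign (u q.1 q.2 - ξ) * (heav q.2 * (f (u q.1 q.2) - f ξ)
            + heav (-q.2) * (g (u q.1 q.2) - g ξ)) * fderiv ℝ φ q (0, 1)))
      - (∫ t in Set.Ioi (0:ℝ), Real.sign (p t - ξ) * (f ξ - g ξ) * φ (t, 0)) ≥ 0

/-- `u` admits strong left and right traces at the interface `x = 0`. -/
def HasStrongTraces (u : ℝ → ℝ → ℝ) : Prop :=
  ∃ um up : ℝ → ℝ,
    ∀ φ : ℝ → ℝ, Continuous φ → HasCompactSupport φ → tsupport φ ⊆ Set.Ioi 0 →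
      Tendsto (fun x => ∫ t in Set.Ioi (0:ℝ), |u t x - up t| * φ t)
        (nhdsWithin 0 (Set.Ioi 0)) (nhds 0)
      ∧ Tendsto (fun x => ∫ t in Set.Ioi (0:ℝ), |u t x - um t| * φ t)
        (nhdsWithin 0 (Set.Iio 0)) (nhds 0)

/-- The Godunov numerical flux associated with `f`. -/
noncomputable def godunov (f : ℝ → ℝ) (u v : ℝ) : ℝ :=
  if u ≤ v then sInf (f '' Icc u v) else sSup (f '' Icc v u)

/-- Monotone numerical fluxes with Lipschitz constant `L` in each variable. -/
structure IsNumFlux (L : ℝ) (F : ℝ → ℝ → ℝ) : Prop where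
  mono : ∀ u u' v, u ≤ u' → F u v ≤ F u' v
  anti : ∀ u v v', v ≤ v' → F u v' ≤ F u v
  lip_left : ∀ u u' v, u ≤ u' → F u' v ≤ F u v + L * (u' - u)
  lip_right : ∀ u v v', v ≤ v' → F u v ≤ F u v' + L * (v' - v)

lemma godunov_of_le {f : ℝ → ℝ} (hf : Continuous f) {u v : ℝ} (h : u ≤ v) :
    (∃ x ∈ Icc u v, godunov f u v = f x) ∧ ∀ y ∈ Icc u v, godunov f u v ≤ f y := by
  have hc : IsCompact (f '' Icc u v) := isCompact_Icc.image hf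
  have hne : (f '' Icc u v).Nonempty := (nonempty_Icc.2 h).image f
  unfold godunov
  rw [if_pos h]
  refine ⟨?_, fun y hy => csInf_le hc.bddBelow (mem_image_of_mem f hy)⟩
  obtain ⟨x, hx, hx'⟩ := hc.sInf_mem hne
  exact ⟨x, hx, hx'.symm⟩

lemma godunov_of_ge {f : ℝ → ℝ} (hf : Continuous f) {u v : ℝ} (h : v ≤ u) :
    (∃ x ∈ Icc v u, godunov f u v = f x) ∧ ∀ y ∈ Icc v u, f y ≤ godunov f u v := by
  rcases h.eq_or_lt with h' | h'
  · subst h'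
    simp [godunov]
  have hc : IsCompact (f '' Icc v u) := isCompact_Icc.image hf
  have hne : (f '' Icc v u).Nonempty := (nonempty_Icc.2 h).image f
  unfold godunov
  rw [if_neg (not_le.2 h')]
  refine ⟨?_, fun y hy => le_csSup hc.bddAbove (mem_image_of_mem f hy)⟩
  obtain ⟨x, hx, hx'⟩ := hc.sSup_mem hne
  exact ⟨x, hx, hx'.symm⟩

lemma godunov_self (f : ℝ → ℝ) (u : ℝ) : godunov f u u = f u := by
  simp [godunov]

lemma godunov_neg {f : ℝ → ℝ} (hf : Continuous f) (u v : ℝ) :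
    godunov (fun x => -f x) u v = -godunov f v u := by
  change godunov (-f) u v = _
  rcases le_total u v with h | h
  · obtain ⟨⟨x, hx, hx'⟩, h1⟩ := godunov_of_le hf.neg h
    obtain ⟨⟨y, hy, hy'⟩, h2⟩ := godunov_of_ge hf h
    have := h1 y hy
    have := h2 x hx
    simp only [Pi.neg_apply] at *
    linarith
  · obtain ⟨⟨x, hx, hx'⟩, h1⟩ := godunov_of_ge hf.neg h
    obtain ⟨⟨y, hy, hy'⟩, h2⟩ := godunov_of_le hf h
    have := h1 y hy
    have := h2 x hx
    simp only [Pi.neg_apply] at *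
    linarith

lemma godunov_eq_of_le {f : ℝ → ℝ} (hf : Continuous f) {k p h : ℝ} (hkp : k ≤ p)
    (hge : ∀ x ∈ Icc k p, h ≤ f x) (hh : f k = h ∨ f p = h) : godunov f k p = h := by
  obtain ⟨⟨x, hx, hx'⟩, h1⟩ := godunov_of_le hf hkp
  apply le_antisymm
  · rcases hh with hh | hh
    · rw [← hh]; exact h1 k (left_mem_Icc.2 hkp)
    · rw [← hh]; exact h1 p (right_mem_Icc.2 hkp)
  · rw [hx']; exact hge x hx

lemma continuous_of_abs_le {f : ℝ → ℝ} {L : ℝ} (hf : ∀ x y, |f x - f y| ≤ L * |x - y|) :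
    Continuous f := by
  have : LipschitzWith (Real.toNNReal L) f := by
    apply LipschitzWith.of_dist_le_mul
    intro x y
    rw [Real.dist_eq, Real.dist_eq]
    exact (hf x y).trans (mul_le_mul_of_nonneg_right (Real.le_coe_toNNReal L) (abs_nonneg _))
  exact this.continuous

lemma godunov_left {f : ℝ → ℝ} {L : ℝ} (hL : 0 ≤ L)
    (hf : ∀ x y, |f x - f y| ≤ L * |x - y|) (u u' v : ℝ) (huu : u ≤ u') :
    godunov f u v ≤ godunov f u' v ∧ godunov f u' v ≤ godunov f u v + L * (u' - u) := by
  have hc := continuous_of_abs_le hf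
  have hfl : ∀ x y, x ≤ y → f y ≤ f x + L * (y - x) ∧ f x ≤ f y + L * (y - x) := by
    intro x y hxy
    have := abs_le.1 (hf x y)
    rw [abs_of_nonpos (by linarith)] at this
    constructor <;> nlinarith [this.1, this.2]
  have key1 : ∀ u u', u ≤ u' → u' ≤ v →
      godunov f u v ≤ godunov f u' v ∧ godunov f u' v ≤ godunov f u v + L * (u' - u) := by
    intro u u' huu huv
    obtain ⟨⟨x, hx, hx'⟩, h1⟩ := godunov_of_le hc (huu.trans huv)
    obtain ⟨⟨y, hy, hy'⟩, h2⟩ := godunov_of_le hc huv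
    refine ⟨by rw [hy']; exact h1 y ⟨huu.trans hy.1, hy.2⟩, ?_⟩
    rcases le_total u' x with h | h
    · have := h2 x ⟨h, hx.2⟩
      have : 0 ≤ L * (u' - u) := mul_nonneg hL (by linarith)
      linarith
    · have := h2 u' ⟨le_rfl, huv⟩
      have h3 := (hfl x u' h).1
      have : L * (u' - x) ≤ L * (u' - u) := mul_le_mul_of_nonneg_left (by linarith [hx.1]) hL
      linarith
  have key2 : ∀ u u', u ≤ u' → v ≤ u →
      godunov f u v ≤ godunov f u' v ∧ godunov f u' v ≤ godunov f u v + L * (u' - u) := by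
    intro u u' huu huv
    obtain ⟨⟨x, hx, hx'⟩, h1⟩ := godunov_of_ge hc huv
    obtain ⟨⟨y, hy, hy'⟩, h2⟩ := godunov_of_ge hc (huv.trans huu)
    refine ⟨by rw [hx']; exact h2 x ⟨hx.1, hx.2.trans huu⟩, ?_⟩
    rcases le_total y u with h | h
    · have := h1 y ⟨hy.1, h⟩
      have : 0 ≤ L * (u' - u) := mul_nonneg hL (by linarith)
      linarith
    · have := h1 u ⟨huv, le_rfl⟩
      have h3 := (hfl u y h).1
      have : L * (y - u) ≤ L * (u' - u) := mul_le_mul_of_nonneg_left (by linarith [hy.2]) hL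
      linarith
  rcases le_total u' v with h | h
  · exact key1 u u' huu h
  rcases le_total v u with h' | h'
  · exact key2 u u' huu h'
  have a1 := key1 u v h' le_rfl
  have a2 := key2 v u' h le_rfl
  exact ⟨a1.1.trans a2.1, by linarith [a1.2, a2.2]⟩

lemma isNumFlux_godunov {f : ℝ → ℝ} {L : ℝ} (hL : 0 ≤ L)
    (hf : ∀ x y, |f x - f y| ≤ L * |x - y|) : IsNumFlux L (godunov f) := by
  have hc := continuous_of_abs_le hf
  have hneg : ∀ x y, |(-f x) - (-f y)| ≤ L * |x - y| := by
    intro x y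
    have := hf x y
    rwa [show -f x - -f y = -(f x - f y) by ring, abs_neg]
  refine ⟨fun u u' v h => (godunov_left hL hf u u' v h).1, fun u v v' h => ?_,
    fun u u' v h => (godunov_left hL hf u u' v h).2, fun u v v' h => ?_⟩
  · have := (godunov_left hL hneg v v' u h).1
    rw [godunov_neg hc, godunov_neg hc] at this
    linarith
  · have := (godunov_left hL hneg v v' u h).2
    rw [godunov_neg hc, godunov_neg hc] at this
    linarith

namespace IsNumFlux
variable {L : ℝ} {F : ℝ → ℝ → ℝ}

lemma abs_sub_le (hF : IsNumFlux L F) (u v u' v' : ℝ) :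
    |F u v - F u' v'| ≤ L * (|u - u'| + |v - v'|) := by
  have h1 : |F u v - F u' v| ≤ L * |u - u'| := by
    rcases le_total u u' with h | h
    · rw [abs_of_nonpos (by linarith [hF.mono u u' v h]), abs_of_nonpos (by linarith)]
      linarith [hF.lip_left u u' v h]
    · rw [abs_of_nonneg (by linarith [hF.mono u' u v h]), abs_of_nonneg (by linarith)]
      linarith [hF.lip_left u' u v h]
  have h2 : |F u' v - F u' v'| ≤ L * |v - v'| := by
    rcases le_total v v' with h | h
    · rw [abs_of_nonneg (by linarith [hF.anti u' v v' h]), abs_of_nonpos (by linarith)]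
      linarith [hF.lip_right u' v v' h]
    · rw [abs_of_nonpos (by linarith [hF.anti u' v' v h]), abs_of_nonneg (by linarith)]
      linarith [hF.lip_right u' v' v h]
  calc |F u v - F u' v'| ≤ |F u v - F u' v| + |F u' v - F u' v'| := _root_.abs_sub_le _ _ _
    _ ≤ _ := by linarith

end IsNumFlux

/-- One step of the conservative scheme with edge fluxes `Fl`; edge `j` joins `j` and `j + 1`. -/
def upd (lam : ℝ) (Fl : ℤ → ℝ → ℝ → ℝ) (u : ℤ → ℝ) (j : ℤ) : ℝ :=
  u j - lam * (Fl j (u j) (u (j + 1)) - Fl (j - 1) (u (j - 1)) (u j))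

/-- The numerical Kruzhkov entropy flux through edge `j`. -/
def kruz (Fl : ℤ → ℝ → ℝ → ℝ) (u v : ℤ → ℝ) (j : ℤ) : ℝ :=
  Fl j (u j ⊔ v j) (u (j + 1) ⊔ v (j + 1)) - Fl j (u j ⊓ v j) (u (j + 1) ⊓ v (j + 1))

section Scheme
variable {L lam : ℝ} {Fl : ℤ → ℝ → ℝ → ℝ}

lemma upd_mono (hFl : ∀ j, IsNumFlux L (Fl j)) (hl : 0 ≤ lam) (hlL : 2 * lam * L ≤ 1)
    {u v : ℤ → ℝ} (huv : ∀ j, u j ≤ v j) (j : ℤ) : upd lam Fl u j ≤ upd lam Fl v j := by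
  have h1 : Fl j (v j) (v (j + 1)) ≤ Fl j (u j) (u (j + 1)) + L * (v j - u j) :=
    ((hFl j).anti _ _ _ (huv _)).trans ((hFl j).lip_left _ _ _ (huv _))
  have h2 : Fl (j - 1) (u (j - 1)) (u j) ≤ Fl (j - 1) (v (j - 1)) (v j) + L * (v j - u j) :=
    ((hFl _).mono _ _ _ (huv _)).trans ((hFl _).lip_right _ _ _ (huv _))
  unfold upd
  have h3 := mul_le_mul_of_nonneg_left h1 hl
  have h4 := mul_le_mul_of_nonneg_left h2 hl
  have h5 := mul_le_mul_of_nonneg_right hlL (sub_nonneg.2 (huv j))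
  nlinarith

lemma kato (hFl : ∀ j, IsNumFlux L (Fl j)) (hl : 0 ≤ lam) (hlL : 2 * lam * L ≤ 1)
    (u v : ℤ → ℝ) (j : ℤ) :
    |upd lam Fl u j - upd lam Fl v j| ≤
      |u j - v j| - lam * (kruz Fl u v j - kruz Fl u v (j - 1)) := by
  have a1 := upd_mono hFl hl hlL (u := u) (v := fun j => u j ⊔ v j) (fun _ => le_sup_left) j
  have a2 := upd_mono hFl hl hlL (u := v) (v := fun j => u j ⊔ v j) (fun _ => le_sup_right) j
  have a3 := upd_mono hFl hl hlL (v := u) (u := fun j => u j ⊓ v j) (fun _ => inf_le_left) j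
  have a4 := upd_mono hFl hl hlL (v := v) (u := fun j => u j ⊓ v j) (fun _ => inf_le_right) j
  have e : upd lam Fl (fun j => u j ⊔ v j) j - upd lam Fl (fun j => u j ⊓ v j) j =
      |u j - v j| - lam * (kruz Fl u v j - kruz Fl u v (j - 1)) := by
    have : u j ⊔ v j - u j ⊓ v j = |u j - v j| := max_sub_min_eq_abs' _ _
    simp only [upd, kruz, ← this, sub_add_cancel]
    ring
  rw [← e, abs_le]
  constructor <;> linarith

lemma abs_kruz_le (hFl : ∀ j, IsNumFlux L (Fl j)) (u v : ℤ → ℝ) (j : ℤ) :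
    |kruz Fl u v j| ≤ L * (|u j - v j| + |u (j + 1) - v (j + 1)|) := by
  have := (hFl j).abs_sub_le (u j ⊔ v j) (u (j + 1) ⊔ v (j + 1)) (u j ⊓ v j) (u (j + 1) ⊓ v (j + 1))
  rwa [max_sub_min_eq_abs', max_sub_min_eq_abs', abs_abs, abs_abs] at this

lemma contraction (hFl : ∀ j, IsNumFlux L (Fl j)) (hl : 0 ≤ lam)
    (hlL : 2 * lam * L ≤ 1) (u v : ℤ → ℝ) (J : ℤ) (n : ℕ) :
    ∑ i ∈ Finset.range n, |upd lam Fl u (J + i) - upd lam Fl v (J + i)| ≤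
      ∑ i ∈ Finset.range (n + 2), |u (J - 1 + i) - v (J - 1 + i)| := by
  have h1 : ∑ i ∈ Finset.range n, |upd lam Fl u (J + i) - upd lam Fl v (J + i)| ≤
      ∑ i ∈ Finset.range n, |u (J + i) - v (J + i)| -
        lam * (kruz Fl u v (J + n - 1) - kruz Fl u v (J - 1)) := by
    induction n with
    | zero => simp
    | succ n ih =>
      rw [Finset.sum_range_succ, Finset.sum_range_succ]
      have := kato hFl hl hlL u v (J + n)
      have e : (J + ((n + 1 : ℕ) : ℤ) - 1) = J + n := by push_cast; ring
      rw [e]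
      linarith
  have h2 : ∀ j, -kruz Fl u v j ≤ L * |u (j + 1) - v (j + 1)| := by
    intro j
    have a := (hFl j).mono (u j ⊓ v j) (u j ⊔ v j) (u (j + 1) ⊔ v (j + 1)) inf_le_sup
    have b := (hFl j).lip_right (u j ⊓ v j) (u (j + 1) ⊓ v (j + 1)) (u (j + 1) ⊔ v (j + 1))
      inf_le_sup
    rw [max_sub_min_eq_abs'] at b
    unfold kruz
    linarith
  have h3 : ∀ j, kruz Fl u v j ≤ L * |u j - v j| := by
    intro j
    have a := (hFl j).anti (u j ⊔ v j) (u (j + 1) ⊓ v (j + 1)) (u (j + 1) ⊔ v (j + 1)) inf_le_sup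
    have b := (hFl j).lip_left (u j ⊓ v j) (u j ⊔ v j) (u (j + 1) ⊓ v (j + 1)) inf_le_sup
    rw [max_sub_min_eq_abs'] at b
    unfold kruz
    linarith
  have h4 := h2 (J + n - 1)
  have h5 := h3 (J - 1)
  rw [sub_add_cancel] at h4
  rw [Finset.sum_range_succ, Finset.sum_range_succ']
  have e1 : ∀ i : ℕ, J - 1 + ((i + 1 : ℕ) : ℤ) = J + i := by intro i; push_cast; ring
  simp only [e1, Nat.cast_zero, add_zero]
  have h6 := mul_le_mul_of_nonneg_left h4 hl
  have h7 := mul_le_mul_of_nonneg_left h5 hl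
  have hlL' : lam * L ≤ 1 := by linarith
  have h8 := mul_le_mul_of_nonneg_right hlL' (abs_nonneg (u (J + n) - v (J + n)))
  have h9 := mul_le_mul_of_nonneg_right hlL' (abs_nonneg (u (J - 1) - v (J - 1)))
  nlinarith

lemma abs_split {F : ℝ → ℝ → ℝ} (hF : IsNumFlux L F) (hl : 0 ≤ lam)
    (hlL : 2 * lam * L ≤ 1) (u v : ℝ) :
    |lam * (F u u - F u v)| + |lam * (F v v - F u v)| +
      |v - u - lam * (F u u - F u v) - lam * (F v v - F u v)| = |v - u| ∧
    |v - u - lam * (F v v - F u v)| = |v - u| - |lam * (F v v - F u v)| := by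
  rcases le_total u v with h | h
  · have a1 := mul_le_mul_of_nonneg_left (hF.anti u u v h) hl
    have a2 := mul_le_mul_of_nonneg_left (hF.mono u v v h) hl
    have a3 := mul_le_mul_of_nonneg_left (hF.lip_right u u v h) hl
    have a4 := mul_le_mul_of_nonneg_left (hF.lip_left u v v h) hl
    have a5 := mul_le_mul_of_nonneg_right hlL (sub_nonneg.2 h)
    rw [abs_of_nonneg (a := lam * (F u u - F u v)) (by linarith),
      abs_of_nonneg (a := lam * (F v v - F u v)) (by linarith),
      abs_of_nonneg (a := v - u) (by linarith), abs_of_nonneg (by nlinarith),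
      abs_of_nonneg (by nlinarith)]
    constructor <;> ring
  · have a1 := mul_le_mul_of_nonneg_left (hF.anti u v u h) hl
    have a2 := mul_le_mul_of_nonneg_left (hF.mono v u v h) hl
    have a3 := mul_le_mul_of_nonneg_left (hF.lip_right u v u h) hl
    have a4 := mul_le_mul_of_nonneg_left (hF.lip_left v u v h) hl
    have a5 := mul_le_mul_of_nonneg_right hlL (sub_nonneg.2 h)
    rw [abs_of_nonpos (a := lam * (F u u - F u v)) (by linarith),
      abs_of_nonpos (a := lam * (F v v - F u v)) (by linarith),
      abs_of_nonpos (a := v - u) (by linarith), abs_of_nonpos (by nlinarith),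
      abs_of_nonpos (by nlinarith)]
    constructor <;> ring

lemma half_line_tv {F : ℝ → ℝ → ℝ} (hF : IsNumFlux L F) (hl : 0 ≤ lam)
    (hlL : 2 * lam * L ≤ 1) {J : ℤ} (hJ : ∀ j, J ≤ j → Fl j = F) (u : ℤ → ℝ) (N : ℕ) :
    ∑ i ∈ Finset.range N, |upd lam Fl u (J + i + 1) - upd lam Fl u (J + i)| ≤
      ∑ i ∈ Finset.range (N + 1), |u (J + i + 1) - u (J + i)| + |upd lam Fl u J - u J| := by
  cases N with
  | zero => simp; positivity
  | succ N =>
  set w : ℕ → ℝ := fun i => u (J + i) with hw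
  set s : ℕ → ℝ := fun i => upd lam Fl u (J + i) with hs
  set A : ℕ → ℝ := fun i => lam * (F (w i) (w i) - F (w i) (w (i + 1))) with hA
  set B : ℕ → ℝ := fun i => lam * (F (w (i + 1)) (w (i + 1)) - F (w i) (w (i + 1))) with hB
  have e1 : ∀ i : ℕ, u (J + i + 1) = w (i + 1) := by
    intro i; simp only [hw]; congr 1; push_cast; ring
  have e2 : ∀ i : ℕ, upd lam Fl u (J + i + 1) = s (i + 1) := by
    intro i; simp only [hs]; congr 1; push_cast; ring
  have e3 : ∀ i : ℕ, s (i + 1) = w (i + 1) + A (i + 1) - B i := by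
    intro i
    simp only [hs, hA, hB, hw, upd]
    rw [hJ _ (by omega), hJ _ (by push_cast; omega)]
    have c1 : J + ((i + 1 : ℕ) : ℤ) - 1 = J + i := by push_cast; ring
    have c2 : J + ((i + 1 : ℕ) : ℤ) + 1 = J + ((i + 1 + 1 : ℕ) : ℤ) := by push_cast; ring
    rw [c1, c2]
    ring
  have e4 : |upd lam Fl u J - u J| = |s 0 - w 0| := by simp [hs, hw]
  simp only [e1, e2]
  rw [e4]
  change ∑ i ∈ Finset.range (N + 1), |s (i + 1) - s i| ≤
    ∑ i ∈ Finset.range (N + 1 + 1), |w (i + 1) - w i| + |s 0 - w 0|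
  have hab : ∀ i, |A i| + |B i| + |w (i + 1) - w i - A i - B i| = |w (i + 1) - w i| ∧
      |w (i + 1) - w i - B i| = |w (i + 1) - w i| - |B i| := fun i => abs_split hF hl hlL _ _
  have key : ∀ N, ∑ i ∈ Finset.range (N + 1), |s (i + 1) - s i| ≤
      ∑ i ∈ Finset.range (N + 1), |w (i + 1) - w i| + |A (N + 1)| - |B N| + |s 0 - w 0| := by
    intro N
    induction N with
    | zero =>
      simp only [zero_add, Finset.sum_range_one]
      have h0 : s 1 - s 0 = (w 1 - w 0 - B 0) + A 1 - (s 0 - w 0) := by rw [e3 0]; ring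
      have h1 := abs_sub (w 1 - w 0 - B 0 + A 1) (s 0 - w 0)
      have h2 := abs_add_le (w 1 - w 0 - B 0) (A 1)
      have h3 := (hab 0).2
      simp only [zero_add] at h3
      rw [h0]
      linarith
    | succ N ih =>
      rw [Finset.sum_range_succ, Finset.sum_range_succ _ (N + 1)]
      have h0 : s (N + 1 + 1) - s (N + 1) =
          (w (N + 1 + 1) - w (N + 1) - A (N + 1) - B (N + 1)) + A (N + 1 + 1) + B N := by
        rw [e3 N, e3 (N + 1)]; ring
      have h1 := abs_add_three (w (N + 1 + 1) - w (N + 1) - A (N + 1) - B (N + 1))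
        (A (N + 1 + 1)) (B N)
      have h3 := (hab (N + 1)).1
      rw [h0]
      linarith
  have k := key N
  rw [Finset.sum_range_succ _ (N + 1)]
  have h3 := (hab (N + 1)).1
  have := abs_nonneg (B N)
  have := abs_nonneg (B (N + 1))
  have := abs_nonneg (w (N + 1 + 1) - w (N + 1) - A (N + 1) - B (N + 1))
  linarith

end Scheme

/-- A pair of Lipschitz fluxes agreeing at the endpoints of `[a, b]` and constant on no
nondegenerate subinterval. -/
structure FluxPair (a b L : ℝ) (f g : ℝ → ℝ) : Prop where
  lt : a < b
  pos : 0 < L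
  lip_f : ∀ x y, |f x - f y| ≤ L * |x - y|
  lip_g : ∀ x y, |g x - g y| ≤ L * |x - y|
  eq_a : f a = g a
  eq_b : f b = g b
  nonconst_f : ∀ c d, a ≤ c → c < d → d ≤ b → ∃ x ∈ Icc c d, f x ≠ f c
  nonconst_g : ∀ c d, a ≤ c → c < d → d ≤ b → ∃ x ∈ Icc c d, g x ≠ g c

/-- Godunov fluxes for the discontinuous flux: `g` on the left of the interface, `f` on the
right. -/
noncomputable def edgeFlux (f g : ℝ → ℝ) (j : ℤ) : ℝ → ℝ → ℝ :=
  if 0 ≤ j then godunov f else godunov g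

namespace FluxPair
variable {a b L : ℝ} {f g : ℝ → ℝ}

lemma reflect (H : FluxPair a b L f g) : FluxPair a b L (fun x => -g x) (fun x => -f x) where
  lt := H.lt
  pos := H.pos
  lip_f x y := by
    have := H.lip_g x y
    rwa [show -g x - -g y = -(g x - g y) by ring, abs_neg]
  lip_g x y := by
    have := H.lip_f x y
    rwa [show -f x - -f y = -(f x - f y) by ring, abs_neg]
  eq_a := by rw [H.eq_a]
  eq_b := by rw [H.eq_b]
  nonconst_f c d h1 h2 h3 := by simpa using H.nonconst_g c d h1 h2 h3
  nonconst_g c d h1 h2 h3 := by simpa using H.nonconst_f c d h1 h2 h3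

lemma cont_f (H : FluxPair a b L f g) : Continuous f := continuous_of_abs_le H.lip_f

lemma cont_g (H : FluxPair a b L f g) : Continuous g := continuous_of_abs_le H.lip_g

lemma isNumFlux (H : FluxPair a b L f g) (j : ℤ) : IsNumFlux L (edgeFlux f g j) := by
  unfold edgeFlux
  split_ifs
  · exact isNumFlux_godunov H.pos.le H.lip_f
  · exact isNumFlux_godunov H.pos.le H.lip_g

lemma lam_nonneg (H : FluxPair a b L f g) : 0 ≤ 1 / (2 * L) := by
  have := H.pos
  positivity

lemma two_lam (H : FluxPair a b L f g) : 2 * (1 / (2 * L)) * L = 1 := by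
  have := H.pos.ne'
  field_simp

lemma edgeFlux_reflect (H : FluxPair a b L f g) (j : ℤ) (x y : ℝ) :
    edgeFlux (fun x => -g x) (fun x => -f x) j x y = -edgeFlux f g (-j - 1) y x := by
  unfold edgeFlux
  by_cases h : 0 ≤ j
  · rw [if_pos h, if_neg (by omega), godunov_neg H.cont_g]
  · rw [if_neg h, if_pos (by omega), godunov_neg H.cont_f]

end FluxPair

/-- Solutions of the Godunov scheme with values in `[a, b]`, with total variation of the
data and of the time increments controlled by `M`. -/
structure SchemeSol (a b L M : ℝ) (f g : ℝ → ℝ) (U : ℕ → ℤ → ℝ) : Prop where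
  mem : ∀ n j, U n j ∈ Icc a b
  step : ∀ n j, U (n + 1) j = upd (1 / (2 * L)) (edgeFlux f g) (U n) j
  time : ∀ n (J : ℤ) (N : ℕ), ∑ i ∈ Finset.range N, |U (n + 1) (J + i) - U n (J + i)| ≤ M
  tv : ∀ (J : ℤ) (N : ℕ), ∑ i ∈ Finset.range N, |U 0 (J + i + 1) - U 0 (J + i)| ≤ M

lemma upd_const (lam : ℝ) (Fl : ℤ → ℝ → ℝ → ℝ) (c : ℝ) (j : ℤ)
    (h : Fl j c c = Fl (j - 1) c c) : upd lam Fl (fun _ => c) j = c := by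
  simp [upd, h]

lemma edgeFlux_self_eq {f g : ℝ → ℝ} {c : ℝ} (h : f c = g c) (i j : ℤ) :
    edgeFlux f g i c c = edgeFlux f g j c c := by
  unfold edgeFlux
  split_ifs <;> simp [godunov_self, h]

namespace SchemeSol
variable {a b L M : ℝ} {f g : ℝ → ℝ} {U : ℕ → ℤ → ℝ}

lemma exists_of_data (H : FluxPair a b L f g) (v : ℤ → ℝ) (hv : ∀ j, v j ∈ Icc a b) {V : ℝ}
    (hV : ∀ (J : ℤ) (N : ℕ), ∑ i ∈ Finset.range N, |v (J + i + 1) - v (J + i)| ≤ V) :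
    ∃ U, U 0 = v ∧ SchemeSol a b L (V + (b - a)) f g U := by
  set lam := 1 / (2 * L) with hlam
  have hl : 0 ≤ lam := H.lam_nonneg
  have hlL : 2 * lam * L = 1 := H.two_lam
  refine ⟨fun n => (upd lam (edgeFlux f g))^[n] v, rfl, ?_⟩
  have step : ∀ n, (upd lam (edgeFlux f g))^[n + 1] v =
      upd lam (edgeFlux f g) ((upd lam (edgeFlux f g))^[n] v) := fun n =>
    Function.iterate_succ_apply' _ _ _
  refine ⟨fun n => ?_, fun n j => by rw [step], fun n => ?_, fun J N => ?_⟩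
  · induction n with
    | zero => simpa using hv
    | succ n ih =>
      intro j
      simp only [step]
      constructor
      · have := upd_mono H.isNumFlux hl hlL.le (fun j => (ih j).1) j
        rwa [upd_const _ _ _ _ (edgeFlux_self_eq H.eq_a _ _)] at this
      · have := upd_mono H.isNumFlux hl hlL.le (fun j => (ih j).2) j
        rwa [upd_const _ _ _ _ (edgeFlux_self_eq H.eq_b _ _)] at this
  · induction n with
    | zero =>
      intro J N
      simp only [zero_add, Function.iterate_one, Function.iterate_zero, id]
      have hb : ∀ j, |upd lam (edgeFlux f g) v j - v j| ≤
          1 / 2 * |v (j + 1) - v j| + 1 / 2 * |v j - v (j - 1)| +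
            if j = 0 then (b - a) else 0 := by
        intro j
        have e : upd lam (edgeFlux f g) v j - v j =
          -(lam * ((edgeFlux f g j (v j) (v (j + 1)) - edgeFlux f g j (v j) (v j)) +
            (edgeFlux f g (j - 1) (v j) (v j) - edgeFlux f g (j - 1) (v (j - 1)) (v j)) +
            (edgeFlux f g j (v j) (v j) - edgeFlux f g (j - 1) (v j) (v j)))) := by
          unfold upd; ring
        rw [e, abs_neg, abs_mul, abs_of_nonneg hl]
        have t1 := (H.isNumFlux j).abs_sub_le (v j) (v (j + 1)) (v j) (v j)
        have t2 := (H.isNumFlux (j - 1)).abs_sub_le (v j) (v j) (v (j - 1)) (v j)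
        have t3 : |edgeFlux f g j (v j) (v j) - edgeFlux f g (j - 1) (v j) (v j)| ≤
            2 * L * if j = 0 then (b - a) else 0 := by
          unfold edgeFlux
          by_cases h0 : j = 0
          · subst h0
            simp only [le_refl, if_true, zero_sub, Int.reduceNeg, Left.nonneg_neg_iff,
              Int.reduceLE, if_false, godunov_self]
            have s1 := H.lip_f (v 0) a
            have s2 := H.lip_g (v 0) a
            have s3 := (hv 0).1
            have s4 := (hv 0).2
            rw [abs_of_nonneg (a := v 0 - a) (by linarith)] at s1 s2
            have s5 : L * (v 0 - a) ≤ L * (b - a) :=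
              mul_le_mul_of_nonneg_left (by linarith) H.pos.le
            have s6 := H.eq_a
            rw [abs_le] at s1 s2 ⊢
            constructor <;> linarith [s1.1, s1.2, s2.1, s2.2]
          · by_cases h1 : 0 ≤ j
            · rw [if_pos h1, if_pos (by omega), if_neg h0]; simp
            · rw [if_neg h1, if_neg (by omega), if_neg h0]; simp
        have t4 := (abs_add_three _ _ _).trans (add_le_add (add_le_add t1 t2) t3)
        refine (mul_le_mul_of_nonneg_left t4 hl).trans (le_of_eq ?_)
        simp only [sub_self, abs_zero]
        have : lam * L = 1 / 2 := by linarith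
        calc _ = (lam * L) * (0 + |v (j + 1) - v j|) + (lam * L) * (|v j - v (j - 1)| + 0) +
              2 * (lam * L) * (if j = 0 then b - a else 0) := by ring
          _ = _ := by rw [this]; ring
      refine (Finset.sum_le_sum (s := Finset.range N) fun i _ => hb (J + (i : ℤ))).trans ?_
      rw [Finset.sum_add_distrib, Finset.sum_add_distrib, ← Finset.mul_sum, ← Finset.mul_sum]
      have k1 := hV J N
      have k2 := hV (J - 1) N
      have e3 : ∀ i : ℕ, J - 1 + (i : ℤ) = J + i - 1 := fun i => by ring
      simp only [e3, sub_add_cancel] at k2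
      have k3 : ∑ i ∈ Finset.range N, (if J + (i : ℤ) = 0 then b - a else 0) ≤ b - a := by
        have hba : 0 ≤ b - a := by linarith [H.lt]
        rw [← Finset.sum_filter, Finset.sum_const, nsmul_eq_mul]
        have hc : (Finset.filter (fun i : ℕ => J + (i : ℤ) = 0) (Finset.range N)).card ≤ 1 := by
          rw [Finset.card_le_one]
          intro x hx y hy
          simp only [Finset.mem_filter] at hx hy
          omega
        have hc' : ((Finset.filter (fun i : ℕ => J + (i : ℤ) = 0) (Finset.range N)).card : ℝ) ≤ 1 :=
          by exact_mod_cast hc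
        nlinarith
      linarith
    | succ n ih =>
      intro J N
      simp only [step] at ih ⊢
      exact (contraction H.isNumFlux hl hlL.le _ _ J N).trans (ih _ _)
  · have := hV J N
    simp only [Function.iterate_zero, id]
    linarith [H.lt]

lemma reflect (H : FluxPair a b L f g) (S : SchemeSol a b L M f g U) :
    SchemeSol a b L M (fun x => -g x) (fun x => -f x) (fun n j => U n (-j)) where
  mem n j := S.mem n _
  step n j := by
    rw [S.step]
    unfold upd
    rw [H.edgeFlux_reflect, H.edgeFlux_reflect]
    have e1 : -(j - 1) - 1 = -j := by ring
    have e2 : -(j - 1) = -j + 1 := by ring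
    have e3 : -(j + 1) = -j - 1 := by ring
    rw [e1]
    beta_reduce
    rw [e2, e3]
    ring
  time n J N := by
    have := S.time n (-J - N + 1) N
    rw [← Finset.sum_range_reflect] at this
    refine le_trans (le_of_eq (Finset.sum_congr rfl fun i hi => ?_)) this
    have hi := Finset.mem_range.1 hi
    have e : -J - (N : ℤ) + 1 + ((N - 1 - i : ℕ) : ℤ) = -(J + i) := by omega
    rw [e]
  tv J N := by
    have := S.tv (-J - N) N
    rw [← Finset.sum_range_reflect] at this
    refine le_trans (le_of_eq (Finset.sum_congr rfl fun i hi => ?_)) this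
    have hi := Finset.mem_range.1 hi
    have e : -J - (N : ℤ) + ((N - 1 - i : ℕ) : ℤ) + 1 = -(J + i) := by omega
    have e' : -J - (N : ℤ) + ((N - 1 - i : ℕ) : ℤ) = -(J + i + 1) := by omega
    rw [e, e', abs_sub_comm]

/-- Away from the interface the spatial variation at step `n` is controlled. -/
lemma space_tv (H : FluxPair a b L f g) (S : SchemeSol a b L M f g U) (n N J : ℕ) :
    (J : ℝ) * ∑ i ∈ Finset.range N, |U n (2 * J + i + 1) - U n (2 * J + i)| ≤
      J * M + n * M := by
  have h1 : ∀ (K : ℤ), 0 ≤ K → ∀ n N : ℕ,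
      ∑ i ∈ Finset.range N, |U n (K + i + 1) - U n (K + i)| ≤
      M + ∑ m ∈ Finset.range n, |U (m + 1) K - U m K| := by
    intro K hK n
    induction n with
    | zero => intro N; simpa using S.tv K N
    | succ n ih =>
      intro N
      have := half_line_tv (isNumFlux_godunov H.pos.le H.lip_f) H.lam_nonneg H.two_lam.le
        (Fl := edgeFlux f g) (J := K) (fun j hj => by unfold edgeFlux; rw [if_pos (by omega)])
        (U n) N
      simp only [← S.step] at this
      rw [Finset.sum_range_succ]
      linarith [ih (N + 1)]
  have h2 : ∀ j ∈ Finset.range J, ∑ i ∈ Finset.range N, |U n (2 * J + i + 1) - U n (2 * J + i)| ≤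
      M + ∑ m ∈ Finset.range n, |U (m + 1) (J + j) - U m (J + j)| := by
    intro j hj
    have hj := Finset.mem_range.1 hj
    refine le_trans ?_ (h1 (J + j) (by positivity) n ((J - j) + N))
    rw [Finset.sum_range_add]
    refine le_trans (le_of_eq (Finset.sum_congr rfl fun i _ => ?_))
      (le_add_of_nonneg_left (Finset.sum_nonneg fun i _ => abs_nonneg _))
    have e : (J : ℤ) + j + ((J - j + i : ℕ) : ℤ) = 2 * J + i := by omega
    rw [e]
  have h3 := Finset.sum_le_sum h2
  rw [Finset.sum_const, Finset.card_range, nsmul_eq_mul, Finset.sum_add_distrib,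
    Finset.sum_const, Finset.card_range, nsmul_eq_mul, Finset.sum_comm] at h3
  refine h3.trans (add_le_add le_rfl ?_)
  refine (Finset.sum_le_sum fun m _ => S.time m J J).trans ?_
  rw [Finset.sum_const, Finset.card_range, nsmul_eq_mul]

lemma kruz_const (S : SchemeSol a b L M f g U) {k : ℤ → ℝ} 
    (H : FluxPair a b L f g) (n : ℕ) (j : ℤ)
    (hk : upd (1 / (2 * L)) (edgeFlux f g) k j = k j) :
    |U (n + 1) j - k j| ≤ |U n j - k j| - 1 / (2 * L) *
      (kruz (edgeFlux f g) (U n) k j - kruz (edgeFlux f g) (U n) k (j - 1)) := by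
  have := kato H.isNumFlux H.lam_nonneg H.two_lam.le (U n) k j
  rwa [hk, ← S.step] at this

lemma abs_kruz_le' (S : SchemeSol a b L M f g U) (H : FluxPair a b L f g) {k : ℤ → ℝ}
    (hk : ∀ j, k j ∈ Icc a b) (n : ℕ) (j : ℤ) :
    |kruz (edgeFlux f g) (U n) k j| ≤ 2 * L * (b - a) := by
  refine (abs_kruz_le H.isNumFlux _ _ _).trans ?_
  have hd : ∀ j, |U n j - k j| ≤ b - a := by
    intro j
    have h1 := S.mem n j
    have h2 := hk j
    rw [abs_le]
    constructor <;> linarith [h1.1, h1.2, h2.1, h2.2]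
  have := mul_le_mul_of_nonneg_left (add_le_add (hd j) (hd (j + 1))) H.pos.le
  linarith

/-- On the right of the interface the numerical entropy fluxes have bounded variation,
uniformly in time. -/
lemma kruz_tv (S : SchemeSol a b L M f g U) (H : FluxPair a b L f g) {ξ : ℝ}
    (hξ : ξ ∈ Icc a b) (n J : ℕ) :
    ∑ i ∈ Finset.range J, |kruz (edgeFlux f g) (U n) (fun _ => ξ) ((i : ℤ) + 1) -
      kruz (edgeFlux f g) (U n) (fun _ => ξ) i| ≤ 2 * L * (2 * M + 2 * (b - a)) := by
  set q := kruz (edgeFlux f g) (U n) (fun _ => ξ) with hq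
  set lam := 1 / (2 * L) with hlam
  have hl : 0 ≤ lam := H.lam_nonneg
  have hlL : 2 * lam * L = 1 := H.two_lam
  have h1 : ∀ i : ℕ, lam * |q (i + 1) - q i| ≤
      2 * |U (n + 1) (1 + i) - U n (1 + i)| - lam * (q ((i + 1 : ℕ) : ℤ) - q i) := by
    intro i
    have e := S.kruz_const (k := fun _ => ξ) H n (1 + i) (upd_const _ _ _ _ (by
      unfold edgeFlux; rw [if_pos (by omega), if_pos (by omega)]))
    have e1 : (1 + i : ℤ) - 1 = i := by ring
    simp only [e1] at e
    rw [← hq] at e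
    have t := abs_sub_abs_le_abs_sub (U n (1 + i) - ξ) (U (n + 1) (1 + i) - ξ)
    rw [sub_sub_sub_cancel_right, abs_sub_comm (U n (1 + i)) (U (n + 1) (1 + i))] at t
    have e2 : ((i + 1 : ℕ) : ℤ) = 1 + i := by push_cast; ring
    have e3 : (i + 1 : ℤ) = 1 + i := by ring
    rw [e2, e3]
    have := abs_nonneg (U (n + 1) (1 + i) - U n (1 + i))
    rcases abs_cases (q (1 + i) - q i) with ⟨h, _⟩ | ⟨h, _⟩ <;> rw [h] <;> linarith
  have h2 := Finset.sum_le_sum (s := Finset.range J) fun i _ => h1 i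
  rw [← Finset.mul_sum, Finset.sum_sub_distrib, ← Finset.mul_sum, ← Finset.mul_sum,
    Finset.sum_range_sub (fun i : ℕ => q (i : ℤ))] at h2
  have h3 := S.time n 1 J
  have h4 := S.abs_kruz_le' H (k := fun _ => ξ) (fun _ => hξ) n J
  have h5 := S.abs_kruz_le' H (k := fun _ => ξ) (fun _ => hξ) n ((0 : ℕ) : ℤ)
  rw [← hq] at h4 h5
  have h6 : -(2 * (2 * L * (b - a))) ≤ q J - q ((0 : ℕ) : ℤ) := by
    linarith [(abs_le.1 h4).1, (abs_le.1 h5).2]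
  have h7 := mul_le_mul_of_nonneg_left h6 hl
  have h8 : lam * ∑ i ∈ Finset.range J, |q (i + 1) - q i| ≤ 2 * M + 2 * (b - a) := by
    have : lam * (-(2 * (2 * L * (b - a)))) = -((2 * lam * L) * (2 * (b - a))) := by ring
    rw [this, hlL] at h7
    linarith
  have h9 := mul_le_mul_of_nonneg_left h8 (show 0 ≤ 2 * L by linarith [H.pos])
  calc _ = (2 * lam * L) * ∑ i ∈ Finset.range J, |q (i + 1) - q i| := by rw [hlL, one_mul]
    _ = 2 * L * (lam * ∑ i ∈ Finset.range J, |q (i + 1) - q i|) := by ring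
    _ ≤ _ := h9

end SchemeSol

/-- The index of the cell of width `h` centred at a multiple of `h` containing `x`. -/
noncomputable def cell (h x : ℝ) : ℤ := ⌊x / h + 1 / 2⌋

/-- The piecewise constant function associated with grid values. -/
noncomputable def emb (τ h : ℝ) (A : ℕ → ℤ → ℝ) (t x : ℝ) : ℝ := A ⌊t / τ⌋₊ (cell h x)

lemma measurable_cell (h : ℝ) : Measurable (cell h) :=
  Int.measurable_floor.comp ((measurable_id.div_const h).add_const _)

lemma measurable_emb (τ h : ℝ) (A : ℕ → ℤ → ℝ) :
    Measurable (fun q : ℝ × ℝ => emb τ h A q.1 q.2) := by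
  have h1 : Measurable (fun q : ℝ × ℝ => (⌊q.1 / τ⌋₊, cell h q.2)) :=
    (Nat.measurable_floor.comp (measurable_fst.div_const τ)).prodMk
      ((measurable_cell h).comp measurable_snd)
  exact (Measurable.of_discrete (f := fun p : ℕ × ℤ => A p.1 p.2)).comp h1

lemma measurable_emb_right (τ h : ℝ) (A : ℕ → ℤ → ℝ) (t : ℝ) : Measurable (emb τ h A t) :=
  (measurable_emb τ h A).comp measurable_prodMk_left

lemma cell_mono {h : ℝ} (hh : 0 < h) : Monotone (cell h) := by
  intro x y hxy
  unfold cell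
  gcongr

lemma cell_add {h : ℝ} (hh : 0 < h) (x : ℝ) : cell h (x + h) = cell h x + 1 := by
  unfold cell
  rw [add_div, div_self hh.ne', add_right_comm, Int.floor_add_one]

lemma cell_sub {h : ℝ} (hh : 0 < h) (x : ℝ) : cell h (x - h) = cell h x - 1 := by
  have := cell_add hh (x - h)
  rw [sub_add_cancel] at this
  omega

lemma cell_preimage {h : ℝ} (hh : 0 < h) (j : ℤ) :
    cell h ⁻¹' {j} = Ico ((j - 1 / 2) * h) ((j + 1 / 2) * h) := by
  ext x
  simp only [cell, mem_preimage, mem_singleton_iff, Int.floor_eq_iff, mem_Ico]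
  rw [← le_div_iff₀ hh, ← div_lt_iff₀ hh]
  constructor <;> rintro ⟨h1, h2⟩ <;> constructor <;> linarith

lemma volume_cell {h : ℝ} (hh : 0 < h) (j : ℤ) :
    volume (cell h ⁻¹' {j}) = ENNReal.ofReal h := by
  rw [cell_preimage hh, Real.volume_Ico]
  congr 1
  ring

lemma integral_cell_le {h : ℝ} (hh : 0 < h) {G : ℤ → ℝ} (hG : ∀ j, 0 ≤ G j) {J : ℤ} {r B : ℝ}
    (hJ : J ≤ cell h r) (hB : ∀ N : ℕ, ∑ i ∈ Finset.range N, G (J + i) ≤ B) :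
    IntegrableOn (fun x => G (cell h x)) (Ici r) ∧ ∫ x in Ici r, G (cell h x) ≤ h * B := by
  have hm : Measurable fun x => G (cell h x) := Measurable.of_discrete.comp (measurable_cell h)
  have hB0 : 0 ≤ B := by simpa using hB 0
  have key : ∫⁻ x in Ici r, ENNReal.ofReal (G (cell h x)) ≤ ENNReal.ofReal (h * B) := by
    have hsub : Ici r ⊆ ⋃ i : ℕ, cell h ⁻¹' {J + i} := by
      intro x hx
      have := hJ.trans (cell_mono hh hx)
      refine mem_iUnion.2 ⟨(cell h x - J).toNat, ?_⟩
      simp only [mem_preimage, mem_singleton_iff]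
      omega
    calc _ ≤ ∫⁻ x in ⋃ i : ℕ, cell h ⁻¹' {J + i}, ENNReal.ofReal (G (cell h x)) :=
          lintegral_mono_set hsub
      _ ≤ ∑' i : ℕ, ∫⁻ x in cell h ⁻¹' {J + i}, ENNReal.ofReal (G (cell h x)) :=
          lintegral_iUnion_le _ _
      _ = ∑' i : ℕ, ENNReal.ofReal (h * G (J + i)) := by
          congr 1
          ext i
          rw [setLIntegral_congr_fun (g := fun _ => ENNReal.ofReal (G (J + i)))
            (measurable_cell h (measurableSet_singleton _))
            (fun x hx => by rw [show cell h x = J + i from hx])]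
          rw [setLIntegral_const, volume_cell hh, ← ENNReal.ofReal_mul (hG _), mul_comm]
      _ ≤ _ := by
          refine ENNReal.tsum_le_of_sum_range_le fun N => ?_
          rw [← ENNReal.ofReal_sum_of_nonneg fun i _ => mul_nonneg hh.le (hG _), ← Finset.mul_sum]
          exact ENNReal.ofReal_le_ofReal (mul_le_mul_of_nonneg_left (hB N) hh.le)
  have hi : IntegrableOn (fun x => G (cell h x)) (Ici r) := by
    refine ⟨hm.aestronglyMeasurable, ?_⟩
    rw [hasFiniteIntegral_iff_ofReal (ae_of_all _ fun x => hG _)]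
    exact key.trans_lt ENNReal.ofReal_lt_top
  refine ⟨hi, ?_⟩
  rw [integral_eq_lintegral_of_nonneg_ae (ae_of_all _ fun x => hG _) hm.aestronglyMeasurable]
  exact ENNReal.toReal_le_of_le_ofReal (by positivity) key

namespace SchemeSol
variable {a b L M : ℝ} {f g : ℝ → ℝ} {U : ℕ → ℤ → ℝ}

lemma nonneg (S : SchemeSol a b L M f g U) : 0 ≤ M := by simpa using S.tv 0 0

/-- Approximate Lipschitz continuity in time. -/
lemma time_estimate (H : FluxPair a b L f g) (S : SchemeSol a b L M f g U) {h : ℝ} (hh : 0 < h)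
    {s t : ℝ} (hs : 0 ≤ s) (hst : s ≤ t) (r : ℝ) :
    IntegrableOn (fun x => |emb (h / (2 * L)) h U t x - emb (h / (2 * L)) h U s x|) (Ici r) ∧
    ∫ x in Ici r, |emb (h / (2 * L)) h U t x - emb (h / (2 * L)) h U s x| ≤
      M * (2 * L * (t - s) + h) := by
  have hL := H.pos
  have hτ : 0 < h / (2 * L) := by positivity
  set m := ⌊s / (h / (2 * L))⌋₊ with hm
  set n := ⌊t / (h / (2 * L))⌋₊ with hn
  have hmn : m ≤ n := Nat.floor_mono (by gcongr)
  obtain ⟨d, hd⟩ := Nat.exists_eq_add_of_le hmn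
  have h1 : ∀ (J : ℤ) (N : ℕ), ∑ i ∈ Finset.range N, |U n (J + i) - U m (J + i)| ≤ d * M := by
    intro J N
    rw [hd]
    clear hd
    induction d with
    | zero => simp
    | succ d ih =>
      have : ∀ i ∈ Finset.range N, |U (m + (d + 1)) (J + i) - U m (J + i)| ≤
          |U (m + d + 1) (J + i) - U (m + d) (J + i)| + |U (m + d) (J + i) - U m (J + i)| :=
        fun i _ => abs_sub_le _ _ _
      refine (Finset.sum_le_sum this).trans ?_
      rw [Finset.sum_add_distrib]
      push_cast
      linarith [S.time (m + d) J N]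
  obtain ⟨h2, h3⟩ := integral_cell_le hh (G := fun j => |U n j - U m j|)
    (fun _ => abs_nonneg _) (le_refl (cell h r)) (h1 _)
  refine ⟨h2, h3.trans ?_⟩
  have h4 : (n : ℝ) ≤ t / (h / (2 * L)) := Nat.floor_le (by have := hs.trans hst; positivity)
  have h5 : s / (h / (2 * L)) < m + 1 := Nat.lt_floor_add_one _
  have h6 : (d : ℝ) = n - m := by rw [hd]; push_cast; ring
  have h7 : (d : ℝ) ≤ (t - s) / (h / (2 * L)) + 1 := by rw [h6, sub_div]; linarith
  have h8 : h * ((t - s) / (h / (2 * L)) + 1) = 2 * L * (t - s) + h := by field_simp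
  calc h * (d * M) = M * (h * d) := by ring
    _ ≤ M * (h * ((t - s) / (h / (2 * L)) + 1)) := by
        have := S.nonneg
        gcongr
    _ = _ := by rw [h8]

/-- Approximate `L¹` modulus of continuity in space away from the interface. -/
lemma space_estimate (H : FluxPair a b L f g) (S : SchemeSol a b L M f g U) {h : ℝ} (hh : 0 < h)
    {T t r y : ℝ} (ht : 0 ≤ t) (htT : t ≤ T) (hr : 8 * h ≤ r) (hy : 0 ≤ y) :
    IntegrableOn (fun x => |emb (h / (2 * L)) h U t (x + y) - emb (h / (2 * L)) h U t x|) (Ici r) ∧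
    ∫ x in Ici r, |emb (h / (2 * L)) h U t (x + y) - emb (h / (2 * L)) h U t x| ≤
      M * (1 + 16 * L * T / r) * (y + h) := by
  have hL := H.pos
  have hM := S.nonneg
  have hr0 : 0 < r := by linarith
  set n := ⌊t / (h / (2 * L))⌋₊ with hn
  set J := ⌊r / (4 * h)⌋₊ with hJ
  have hJ1 : (J : ℝ) ≤ r / (4 * h) := Nat.floor_le (by positivity)
  have hJ2 : r / (4 * h) < J + 1 := Nat.lt_floor_add_one _
  have hJ3 : r / (8 * h) ≤ J := by
    have e : r / (4 * h) = 2 * (r / (8 * h)) := by field_simp; norm_num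
    have : 1 ≤ r / (8 * h) := by rw [le_div_iff₀ (by positivity)]; linarith
    linarith
  have hJ0 : (0 : ℝ) < J := lt_of_lt_of_le (by positivity) hJ3
  set C := M * (1 + 16 * L * T / r) with hC
  have hn1 : (n : ℝ) ≤ 2 * L * T / h := by
    have h1 : (n : ℝ) ≤ t / (h / (2 * L)) := Nat.floor_le (by positivity)
    have h2 : t / (h / (2 * L)) = 2 * L * t / h := by field_simp
    rw [h2] at h1
    exact h1.trans (by gcongr)
  have htv : ∀ N : ℕ, ∑ i ∈ Finset.range N, |U n (2 * J + i + 1) - U n (2 * J + i)| ≤ C := by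
    intro N
    have h1 := S.space_tv H n N J
    have h2 : (n : ℝ) ≤ J * (16 * L * T / r) := by
      refine hn1.trans ?_
      have hT : 0 ≤ T := ht.trans htT
      calc 2 * L * T / h = r / (8 * h) * (16 * L * T / r) := by field_simp; ring
        _ ≤ _ := by gcongr
    have h3 : (J : ℝ) * M + n * M ≤ J * C := by
      rw [hC]
      nlinarith [mul_le_mul_of_nonneg_right h2 hM]
    exact le_of_mul_le_mul_left (h1.trans h3) hJ0
  have hC0 : 0 ≤ C := by simpa using htv 0
  set D := ⌊y / h⌋₊ + 1 with hD
  have hcell : (2 * J : ℤ) ≤ cell h r := by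
    unfold cell
    rw [Int.le_floor]
    push_cast
    have e : r / (4 * h) = r / h / 4 := by field_simp
    have : 0 < r / h := by positivity
    rw [e] at hJ1
    linarith
  have hG : ∀ N : ℕ, ∑ i ∈ Finset.range N, (∑ d ∈ Finset.range D,
      |U n (2 * J + i + d + 1) - U n (2 * J + i + d)|) ≤ D * C := by
    intro N
    rw [Finset.sum_comm]
    have : ∀ d ∈ Finset.range D, ∑ i ∈ Finset.range N,
        |U n (2 * J + i + d + 1) - U n (2 * J + i + d)| ≤ C := by
      intro d _
      refine le_trans ?_ (htv (d + N))
      rw [Finset.sum_range_add]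
      refine le_trans (le_of_eq (Finset.sum_congr rfl fun i _ => ?_))
        (le_add_of_nonneg_left (Finset.sum_nonneg fun i _ => abs_nonneg _))
      have e : (2 * J : ℤ) + ((d + i : ℕ) : ℤ) = 2 * J + i + d := by push_cast; ring
      rw [e]
    refine (Finset.sum_le_sum this).trans ?_
    simp
  obtain ⟨h2, h3⟩ := integral_cell_le hh (G := fun j => ∑ d ∈ Finset.range D,
      |U n (j + d + 1) - U n (j + d)|) (fun _ => Finset.sum_nonneg fun _ _ => abs_nonneg _)
      hcell hG
  have hshift : ∀ x, |emb (h / (2 * L)) h U t (x + y) - emb (h / (2 * L)) h U t x| ≤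
      ∑ d ∈ Finset.range D, |U n (cell h x + d + 1) - U n (cell h x + d)| := by
    intro x
    change |U n (cell h (x + y)) - U n (cell h x)| ≤ _
    have l1 : cell h x ≤ cell h (x + y) := cell_mono hh (by linarith)
    obtain ⟨e, he⟩ := Int.le.dest l1
    have l2 : e ≤ D := by
      have a1 : ((cell h (x + y) : ℤ) : ℝ) ≤ (x + y) / h + 1 / 2 := Int.floor_le _
      have a2 : x / h + 1 / 2 < cell h x + 1 := Int.lt_floor_add_one _
      have a3 : y / h < ⌊y / h⌋₊ + 1 := Nat.lt_floor_add_one _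
      rw [← he, add_div] at a1
      push_cast at a1
      have : (e : ℝ) < (D + 1 : ℕ) := by rw [hD]; push_cast; linarith
      exact Nat.lt_succ_iff.1 (by exact_mod_cast this)
    rw [← he]
    have l3 : U n (cell h x + e) - U n (cell h x) =
        ∑ d ∈ Finset.range e, (U n (cell h x + d + 1) - U n (cell h x + d)) := by
      have := Finset.sum_range_sub (fun d : ℕ => U n (cell h x + d)) e
      simp only [Nat.cast_zero, add_zero] at this
      rw [← this]
      refine Finset.sum_congr rfl fun d _ => ?_
      push_cast
      rw [add_assoc]
    rw [l3]
    refine (Finset.abs_sum_le_sum_abs _ _).trans ?_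
    exact Finset.sum_le_sum_of_subset_of_nonneg (Finset.range_mono l2) fun _ _ _ => abs_nonneg _
  have hi : IntegrableOn
      (fun x => |emb (h / (2 * L)) h U t (x + y) - emb (h / (2 * L)) h U t x|) (Ici r) := by
    refine Integrable.mono' h2 ?_ (ae_of_all _ fun x => ?_)
    · have m1 := measurable_emb_right (h / (2 * L)) h U t
      exact ((m1.comp (measurable_id.add_const y)).sub m1).abs.aestronglyMeasurable
    · rw [Real.norm_eq_abs, abs_abs]; exact hshift x
  refine ⟨hi, (setIntegral_mono hi h2 hshift).trans (h3.trans ?_)⟩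
  have hDy : h * D ≤ y + h := by
    have : (⌊y / h⌋₊ : ℝ) ≤ y / h := Nat.floor_le (by positivity)
    rw [hD]
    push_cast
    calc h * ((⌊y / h⌋₊ : ℝ) + 1) ≤ h * (y / h + 1) := by gcongr
      _ = y + h := by field_simp
  calc h * (D * C) = C * (h * D) := by ring
    _ ≤ _ := by gcongr

end SchemeSol

/-- A family tending to zero on a dense set, with approximate moduli of continuity, tends to zero
everywhere. -/
lemma tendsto_zero_of_approx {ι X : Type*} {l : Filter ι} {G : ι → X → ℝ} {x : X}
    (h : ∀ ε > 0, ∃ y, Tendsto (fun p => G p y) l (nhds 0) ∧ ∀ᶠ p in l, |G p x| ≤ |G p y| + ε) :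
    Tendsto (fun p => G p x) l (nhds 0) := by
  rw [Metric.tendsto_nhds]
  intro ε hε
  obtain ⟨y, h1, h2⟩ := h (ε / 2) (by positivity)
  rw [Metric.tendsto_nhds] at h1
  filter_upwards [h1 (ε / 2) (by positivity), h2] with p h3 h4
  rw [Real.dist_eq, sub_zero] at h3 ⊢
  linarith

lemma tendsto_sub_zero_of_tendsto {F : ℕ → ℝ} {l : ℝ} (h : Tendsto F atTop (nhds l)) :
    Tendsto (fun p : ℕ × ℕ => F p.1 - F p.2) (atTop ×ˢ atTop) (nhds 0) := by
  have := (h.comp tendsto_fst).sub (h.comp (tendsto_snd (f := (atTop : Filter ℕ)) (g := (atTop : Filter ℕ))))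
  simpa using this

lemma measurable_bounded_integrableOn {α : Type*} [MeasurableSpace α] {μ : Measure α} {v : α → ℝ}
    (hv : Measurable v) {B : ℝ} (hB : ∀ x, |v x| ≤ B) {s : Set α} (hs : μ s ≠ ⊤) :
    IntegrableOn v s μ :=
  Measure.integrableOn_of_bounded hs hv.aestronglyMeasurable (ae_of_all _ hB)

section Slices
variable {v : ℝ → ℝ} {B C h r R δ : ℝ}

/-- Distance of a function to its sliding averages. -/
lemma integral_sub_average_le (hv : Measurable v) (hB : ∀ x, |v x| ≤ B) (hC : 0 ≤ C) (hδ : 0 < δ)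
    (hsp : ∀ y, 0 ≤ y → IntegrableOn (fun x => |v (x + y) - v x|) (Ici r) ∧
      ∫ x in Ici r, |v (x + y) - v x| ≤ C * (y + h)) :
    ∫ x in Icc r R, |v x - δ⁻¹ * ∫ y in x..(x + δ), v y| ≤ C * (δ + h) := by
  have hB0 : 0 ≤ B := (abs_nonneg _).trans (hB 0)
  have hm : Measurable (fun p : ℝ × ℝ => |v (p.1 + p.2) - v p.1|) :=
    ((hv.comp (measurable_fst.add measurable_snd)).sub (hv.comp measurable_fst)).abs
  have hb : ∀ p : ℝ × ℝ, |(|v (p.1 + p.2) - v p.1|)| ≤ 2 * B := fun p => by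
    rw [abs_abs]
    exact (abs_sub _ _).trans (by linarith [hB (p.1 + p.2), hB p.1])
  have hii : ∀ c d, IntervalIntegrable v volume c d := fun c d =>
    ⟨measurable_bounded_integrableOn hv hB (by simp), measurable_bounded_integrableOn hv hB (by simp)⟩
  have h_integrable : Integrable (fun p : ℝ × ℝ => |v (p.1 + p.2) - v p.1|)
      ((volume.restrict (Icc r R)).prod (volume.restrict (Ioc 0 δ))) := by
    rw [← integrableOn_univ]
    exact measurable_bounded_integrableOn hm hb (measure_ne_top _ _)
  have h1 : ∀ x, |v x - δ⁻¹ * ∫ y in x..(x + δ), v y| ≤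
      δ⁻¹ * ∫ y in Ioc 0 δ, |v (x + y) - v x| := by
    intro x
    have e : v x - δ⁻¹ * ∫ y in x..(x + δ), v y = -(δ⁻¹ * ∫ y in (0 : ℝ)..δ, (v (x + y) - v x)) := by
      rw [intervalIntegral.integral_sub _ (by simp)]
      · have e1 : ∫ y in (0 : ℝ)..δ, v (x + y) = ∫ y in x..(x + δ), v y := by
          rw [intervalIntegral.integral_comp_add_left (fun y => v y)]
          simp
        rw [e1]
        simp only [intervalIntegral.integral_const, sub_zero, smul_eq_mul]
        field_simp
        ring
      · exact ⟨measurable_bounded_integrableOn (hv.comp (measurable_const.add measurable_id))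
          (fun _ => hB _) (by simp), measurable_bounded_integrableOn
          (hv.comp (measurable_const.add measurable_id)) (fun _ => hB _) (by simp)⟩
    rw [e, abs_neg, abs_mul, abs_of_pos (inv_pos.2 hδ), intervalIntegral.integral_of_le hδ.le]
    gcongr
    exact abs_integral_le_integral_abs
  have h2 : ∫ x in Icc r R, |v x - δ⁻¹ * ∫ y in x..(x + δ), v y| ≤
      ∫ x in Icc r R, δ⁻¹ * ∫ y in Ioc 0 δ, |v (x + y) - v x| :=
    integral_mono_of_nonneg (ae_of_all _ fun x => abs_nonneg _)
      (h_integrable.integral_prod_left.const_mul _) (ae_of_all _ h1)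
  refine h2.trans ?_
  rw [integral_const_mul, integral_integral_swap h_integrable]
  have h3 : ∫ y in Ioc 0 δ, ∫ x in Icc r R, |v (x + y) - v x| ≤ ∫ y in Ioc 0 δ, C * (δ + h) := by
    refine setIntegral_mono_on h_integrable.integral_prod_right
      (integrableOn_const (by simp)) measurableSet_Ioc fun y hy => ?_
    obtain ⟨s1, s2⟩ := hsp y hy.1.le
    refine (setIntegral_mono_set s1 (ae_of_all _ fun x => abs_nonneg _)
      (Filter.Eventually.of_forall fun _ hx => Icc_subset_Ici_self hx)).trans (s2.trans ?_)
    have := hy.2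
    gcongr
  calc _ ≤ δ⁻¹ * ∫ y in Ioc 0 δ, C * (δ + h) := by gcongr
    _ = _ := by
      rw [setIntegral_const]
      simp [Measure.real, hδ.le]
      field_simp

end Slices

lemma slice_cauchy {v : ℕ → ℝ → ℝ} {h : ℕ → ℝ} {B : ℝ} (hv : ∀ k, Measurable (v k))
    (hB : ∀ k x, |v k x| ≤ B) (hh : Tendsto h atTop (nhds 0)) {r R : ℝ}
    (hsp : ∃ C, 0 ≤ C ∧ ∀ᶠ k in atTop, ∀ y, 0 ≤ y →
      IntegrableOn (fun x => |v k (x + y) - v k x|) (Ici r) ∧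
      ∫ x in Ici r, |v k (x + y) - v k x| ≤ C * (y + h k))
    (hΦ : ∀ x : ℚ, ∃ l, Tendsto (fun k => ∫ z in (0 : ℝ)..x, v k z) atTop (nhds l)) :
    Tendsto (fun p : ℕ × ℕ => ∫ x in Icc r R, |v p.1 x - v p.2 x|) (atTop ×ˢ atTop) (nhds 0) := by
  obtain ⟨C, hC, hsp⟩ := hsp
  have hB0 : 0 ≤ B := (abs_nonneg _).trans (hB 0 0)
  have hii : ∀ k c d, IntervalIntegrable (v k) volume c d := fun k c d =>
    ⟨measurable_bounded_integrableOn (hv k) (hB k) (by simp),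
      measurable_bounded_integrableOn (hv k) (hB k) (by simp)⟩
  have hbd : ∀ k c d, |∫ z in c..d, v k z| ≤ B * |d - c| := fun k c d => by
    rw [← Real.norm_eq_abs]
    exact intervalIntegral.norm_integral_le_of_norm_le_const fun x _ => by
      rw [Real.norm_eq_abs]; exact hB k x
  have hΦ' : ∀ x : ℝ, Tendsto (fun p : ℕ × ℕ => (∫ z in (0 : ℝ)..x, v p.1 z) -
      ∫ z in (0 : ℝ)..x, v p.2 z) (atTop ×ˢ atTop) (nhds 0) := by
    intro x
    refine tendsto_zero_of_approx (G := fun (p : ℕ × ℕ) (x : ℝ) => (∫ z in (0 : ℝ)..x, v p.1 z) -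
      ∫ z in (0 : ℝ)..x, v p.2 z) fun ε hε => ?_
    obtain ⟨q, hq1, hq2⟩ := exists_rat_btwn (show x < x + ε / (2 * B + 1) by
      have : 0 < ε / (2 * B + 1) := by positivity
      linarith)
    obtain ⟨l, hl⟩ := hΦ q
    refine ⟨q, tendsto_sub_zero_of_tendsto hl, Eventually.of_forall fun p => ?_⟩
    have e : ∀ k, ∫ z in (0 : ℝ)..x, v k z = (∫ z in (0 : ℝ)..q, v k z) - ∫ z in x..q, v k z := by
      intro k
      rw [← intervalIntegral.integral_add_adjacent_intervals (hii k 0 x) (hii k x q)]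
      ring
    have hq3 : B * |(q : ℝ) - x| ≤ ε / 2 := by
      rw [abs_of_pos (by linarith)]
      calc B * ((q : ℝ) - x) ≤ B * (ε / (2 * B + 1)) := by gcongr; linarith
        _ ≤ ε / 2 := by
          rw [mul_div_assoc', div_le_iff₀ (by positivity)]
          nlinarith
    have h1 := (hbd p.1 x q).trans hq3
    have h2 := (hbd p.2 x q).trans hq3
    simp only [e p.1, e p.2]
    rw [abs_le] at h1 h2
    rw [abs_le]
    have := neg_abs_le ((∫ z in (0 : ℝ)..q, v p.1 z) - ∫ z in (0 : ℝ)..q, v p.2 z)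
    have := le_abs_self ((∫ z in (0 : ℝ)..q, v p.1 z) - ∫ z in (0 : ℝ)..q, v p.2 z)
    constructor <;> linarith [h1.1, h1.2, h2.1, h2.2]
  have hcont : ∀ k δ, Continuous fun x => δ⁻¹ * ∫ y in x..(x + δ), v k y := by
    intro k δ
    have : ∀ x, ∫ y in x..(x + δ), v k y =
        (∫ y in (0 : ℝ)..(x + δ), v k y) - ∫ y in (0 : ℝ)..x, v k y := fun x => by
      rw [intervalIntegral.integral_interval_sub_left (hii k _ _) (hii k _ _)]
    simp only [this]
    have hc := intervalIntegral.continuous_primitive (hii k) 0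
    exact continuous_const.mul ((hc.comp (continuous_id.add continuous_const)).sub hc)
  have hav : ∀ δ > 0, Tendsto (fun p : ℕ × ℕ => ∫ x in Icc r R,
      |(δ⁻¹ * ∫ y in x..(x + δ), v p.1 y) - δ⁻¹ * ∫ y in x..(x + δ), v p.2 y|)
      (atTop ×ˢ atTop) (nhds 0) := by
    intro δ hδ
    have := tendsto_integral_filter_of_dominated_convergence (l := (atTop ×ˢ atTop : Filter (ℕ × ℕ)))
      (μ := volume.restrict (Icc r R)) (F := fun (p : ℕ × ℕ) x =>
      |(δ⁻¹ * ∫ y in x..(x + δ), v p.1 y) - δ⁻¹ * ∫ y in x..(x + δ), v p.2 y|) (f := fun _ => 0)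
      (fun _ => 2 * B)
      (Eventually.of_forall fun p => ((hcont p.1 δ).sub (hcont p.2 δ)).abs.aestronglyMeasurable)
      (Eventually.of_forall fun p => ae_of_all _ fun x => ?_) (integrable_const _)
      (ae_of_all _ fun x => ?_)
    · simpa using this
    · have hk : ∀ k, |δ⁻¹ * ∫ y in x..(x + δ), v k y| ≤ B := by
        intro k
        have := hbd k x (x + δ)
        rw [add_sub_cancel_left, abs_of_pos hδ] at this
        rw [abs_mul, abs_of_pos (inv_pos.2 hδ), inv_mul_le_iff₀ hδ]
        linarith
      rw [Real.norm_eq_abs, abs_abs]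
      exact (abs_sub _ _).trans (by linarith [hk p.1, hk p.2])
    · have h1 := (((hΦ' (x + δ)).sub (hΦ' x)).const_mul δ⁻¹).abs
      simp only [sub_zero, mul_zero, abs_zero] at h1
      refine h1.congr fun p => ?_
      have e : ∀ k, ∫ y in x..(x + δ), v k y =
        (∫ y in (0 : ℝ)..(x + δ), v k y) - ∫ y in (0 : ℝ)..x, v k y := fun k => by
        rw [intervalIntegral.integral_interval_sub_left (hii k _ _) (hii k _ _)]
      rw [e, e]
      ring_nf
  rw [Metric.tendsto_nhds]
  intro ε hε
  set δ := ε / (8 * (C + 1)) with hδdef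
  have hδ : 0 < δ := by positivity
  have e1 : ∀ᶠ k in atTop, ∫ x in Icc r R, |v k x - δ⁻¹ * ∫ y in x..(x + δ), v k y| < ε / 4 := by
    have hh' : ∀ᶠ k in atTop, h k < δ := hh.eventually (gt_mem_nhds hδ)
    filter_upwards [hsp, hh'] with k h1 h2
    refine (integral_sub_average_le (hv k) (hB k) hC hδ h1).trans_lt ?_
    calc C * (δ + h k) ≤ C * (δ + δ) := by gcongr
      _ < (C + 1) * (2 * δ) := by nlinarith
      _ = ε / 4 := by rw [hδdef]; field_simp; norm_num
  have e1' := (tendsto_fst (f := (atTop : Filter ℕ)) (g := (atTop : Filter ℕ))).eventually e1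
  have e2' := (tendsto_snd (f := (atTop : Filter ℕ)) (g := (atTop : Filter ℕ))).eventually e1
  have e3 := (Metric.tendsto_nhds.1 (hav δ hδ)) (ε / 2) (by positivity)
  filter_upwards [e1', e2', e3] with p h1 h2 h3
  rw [Real.dist_eq, sub_zero, abs_of_nonneg (integral_nonneg fun x => abs_nonneg _)] at h3 ⊢
  have i1 : ∀ k, Integrable (fun x => |v k x - δ⁻¹ * ∫ y in x..(x + δ), v k y|)
      (volume.restrict (Icc r R)) := fun k =>
    ((measurable_bounded_integrableOn (hv k) (hB k) (by simp) : IntegrableOn _ _).sub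
      ((hcont k δ).integrableOn_Icc)).abs
  have i3 : Integrable (fun x => |(δ⁻¹ * ∫ y in x..(x + δ), v p.1 y) -
      δ⁻¹ * ∫ y in x..(x + δ), v p.2 y|) (volume.restrict (Icc r R)) :=
    (((hcont p.1 δ).integrableOn_Icc).sub ((hcont p.2 δ).integrableOn_Icc)).abs
  have i4 := ((i1 p.1).add i3).add (i1 p.2)
  refine lt_of_le_of_lt (integral_mono_of_nonneg (ae_of_all _ fun x => abs_nonneg _) i4
    (ae_of_all _ fun x => ?_)) ?_
  · have t1 := abs_sub_le (v p.1 x) (δ⁻¹ * ∫ y in x..(x + δ), v p.1 y) (v p.2 x)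
    have t2 := abs_sub_le (δ⁻¹ * ∫ y in x..(x + δ), v p.1 y) (δ⁻¹ * ∫ y in x..(x + δ), v p.2 y)
      (v p.2 x)
    rw [abs_sub_comm (δ⁻¹ * ∫ y in x..(x + δ), v p.2 y) (v p.2 x)] at t2
    simp only [Pi.add_apply]
    linarith
  · rw [integral_add' ((i1 p.1).add i3) (i1 p.2), integral_add' (i1 p.1) i3]
    linarith

/-- A sequence of solutions of the scheme with mesh sizes tending to zero. -/
structure SchemeSeq (a b L M : ℝ) (f g : ℝ → ℝ) (U : ℕ → ℕ → ℤ → ℝ) (h : ℕ → ℝ) : Prop where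
  pos : ∀ k, 0 < h k
  lim : Tendsto h atTop (nhds 0)
  sol : ∀ k, SchemeSol a b L M f g (U k)

/-- The value at distance `i` cells from the cell containing `(t, x)`. -/
noncomputable def gval (L : ℝ) (U : ℕ → ℕ → ℤ → ℝ) (h : ℕ → ℝ) (k : ℕ) (i : ℤ) (t x : ℝ) : ℝ :=
  U k ⌊t / (h k / (2 * L))⌋₊ (cell (h k) x + i)

lemma gval_zero (L : ℝ) (U : ℕ → ℕ → ℤ → ℝ) (h : ℕ → ℝ) (k : ℕ) (t x : ℝ) :
    gval L U h k 0 t x = emb (h k / (2 * L)) (h k) (U k) t x := by simp [gval, emb]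

lemma measurable_gval (L : ℝ) (U : ℕ → ℕ → ℤ → ℝ) (h : ℕ → ℝ) (k : ℕ) (i : ℤ) :
    Measurable (fun q : ℝ × ℝ => gval L U h k i q.1 q.2) :=
  measurable_emb (h k / (2 * L)) (h k) (fun n j => U k n (j + i))

/-- Integrals over boxes are controlled by bounds on the slices. -/
lemma integral_box_le {F : ℝ × ℝ → ℝ} (hF : Measurable F) {B : ℝ} (hB : ∀ q, |F q| ≤ B)
    {T r R c : ℝ} (hT : 0 ≤ T) (hc : ∀ t ∈ Icc 0 T, ∫ x in Icc r R, F (t, x) ≤ c) :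
    ∫ q in Icc 0 T ×ˢ Icc r R, F q ≤ T * c := by
  have hi : IntegrableOn F (Icc 0 T ×ˢ Icc r R) (volume.prod volume) :=
    measurable_bounded_integrableOn hF hB (by
      rw [Measure.prod_prod]; exact ENNReal.mul_ne_top (by simp) (by simp))
  rw [Measure.volume_eq_prod, setIntegral_prod _ hi]
  have : ∫ t in Icc 0 T, ∫ x in Icc r R, F (t, x) ≤ ∫ t in Icc 0 T, c := by
    refine setIntegral_mono_on ?_ (integrableOn_const (by simp)) measurableSet_Icc hc
    rw [IntegrableOn, ← Measure.prod_restrict] at hi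
    exact hi.integral_prod_left
  refine this.trans (le_of_eq ?_)
  rw [setIntegral_const]
  simp [Measure.real, hT]

/-- Summability almost everywhere from summability of the integrals. -/
lemma ae_summable_of_lintegral_le {α : Type*} [MeasurableSpace α] {μ : Measure α}
    {w : ℕ → α → ℝ} (hw : ∀ n, Measurable (w n)) {B : ℕ → Set α} (hB : Monotone B)
    (hBm : ∀ n, MeasurableSet (B n))
    (h_integrable : ∀ n, ∫⁻ q in B n, ‖w n q‖ₑ ∂μ ≤ (2⁻¹ : ENNReal) ^ n) :
    ∀ᵐ q ∂μ, (∃ n, q ∈ B n) → Summable fun n => |w n q| := by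
  have key : ∀ N, ∀ᵐ q ∂μ, q ∈ B N → Summable fun n => |w n q| := by
    intro N
    rw [← ae_restrict_iff' (hBm N)]
    have h1 : ∫⁻ q in B N, ∑' n, ‖w (n + N) q‖ₑ ∂μ ≠ ⊤ := by
      rw [lintegral_tsum fun n => (hw _).enorm.aemeasurable]
      have h2 : ∀ n, ∫⁻ q in B N, ‖w (n + N) q‖ₑ ∂μ ≤ (2⁻¹ : ENNReal) ^ n := by
        intro n
        refine (lintegral_mono_set (hB (Nat.le_add_left N n))).trans ((h_integrable _).trans ?_)
        exact pow_le_pow_right_of_le_one' (by simp) (Nat.le_add_right _ _)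
      refine ne_top_of_le_ne_top ?_ (ENNReal.tsum_le_tsum h2)
      rw [ENNReal.tsum_geometric]
      simp
    have h3 := ae_lt_top' (Measurable.aemeasurable (by fun_prop)) h1
    filter_upwards [h3] with q hq
    have : Summable fun n => ‖w (n + N) q‖₊ := ENNReal.tsum_coe_ne_top_iff_summable.1 hq.ne
    have h4 : Summable fun n => |w (n + N) q| := by
      have := NNReal.summable_coe.2 this
      simpa using this
    exact (summable_nat_add_iff (f := fun n => |w n q|) N).1 h4
  have := ae_all_iff.2 key
  filter_upwards [this] with q hq ⟨n, hn⟩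
  exact hq n hn

namespace SchemeSeq
variable {a b L M : ℝ} {f g : ℝ → ℝ} {U : ℕ → ℕ → ℤ → ℝ} {h : ℕ → ℝ}

lemma comp (S : SchemeSeq a b L M f g U h) {ψ : ℕ → ℕ} (hψ : StrictMono ψ) :
    SchemeSeq a b L M f g (U ∘ ψ) (h ∘ ψ) :=
  ⟨fun _ => S.pos _, S.lim.comp hψ.tendsto_atTop, fun _ => S.sol _⟩

lemma reflect (H : FluxPair a b L f g) (S : SchemeSeq a b L M f g U h) :
    SchemeSeq a b L M (fun x => -g x) (fun x => -f x) (fun k n j => U k n (-j)) h :=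
  ⟨S.pos, S.lim, fun k => (S.sol k).reflect H⟩

lemma gval_mem (S : SchemeSeq a b L M f g U h) (k : ℕ) (i : ℤ) (t x : ℝ) :
    gval L U h k i t x ∈ Icc a b := (S.sol k).mem _ _

lemma abs_gval_le (S : SchemeSeq a b L M f g U h) (k : ℕ) (i : ℤ) (t x : ℝ) :
    |gval L U h k i t x| ≤ max |a| |b| := by
  have := S.gval_mem k i t x
  exact abs_le_max_abs_abs this.1 this.2

lemma exists_slices (H : FluxPair a b L f g) (S : SchemeSeq a b L M f g U h) :
    ∃ ψ : ℕ → ℕ, StrictMono ψ ∧ ∀ t, 0 ≤ t → ∀ r > 0, ∀ R,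
      Tendsto (fun p : ℕ × ℕ => ∫ x in Icc r R, |gval L U h (ψ p.1) 0 t x -
        gval L U h (ψ p.2) 0 t x|) (atTop ×ˢ atTop) (nhds 0) := by
  have hL := H.pos
  set B := max |a| |b| with hB
  have hm : ∀ k t, Measurable (gval L U h k 0 t) := fun k t =>
    (measurable_gval L U h k 0).comp measurable_prodMk_left
  have hcomp : IsCompact (Set.univ.pi fun q : ℚ × ℚ => Icc (-(B * |(q.2 : ℝ)|)) (B * |(q.2 : ℝ)|)) :=
    isCompact_univ_pi fun _ => isCompact_Icc
  obtain ⟨Φ, -, ψ, hψ, hΦ⟩ := hcomp.tendsto_subseq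
    (x := fun k (q : ℚ × ℚ) => ∫ z in (0 : ℝ)..q.2, gval L U h k 0 q.1 z) (fun k => by
      rw [mem_univ_pi]
      intro q
      rw [mem_Icc, ← abs_le]
      have := intervalIntegral.norm_integral_le_of_norm_le_const (a := 0) (b := (q.2 : ℝ))
        (f := gval L U h k 0 q.1) (C := B) fun x _ => by
          rw [Real.norm_eq_abs]; exact S.abs_gval_le k 0 q.1 x
      rwa [sub_zero, Real.norm_eq_abs] at this)
  rw [tendsto_pi_nhds] at hΦ
  refine ⟨ψ, hψ, ?_⟩
  have hh0 : Tendsto (h ∘ ψ) atTop (nhds 0) := S.lim.comp hψ.tendsto_atTop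
  have hrat : ∀ q : ℚ, 0 ≤ (q : ℝ) → ∀ r > 0, ∀ R,
      Tendsto (fun p : ℕ × ℕ => ∫ x in Icc r R, |gval L U h (ψ p.1) 0 q x -
        gval L U h (ψ p.2) 0 q x|) (atTop ×ˢ atTop) (nhds 0) := by
    intro q hq r hr R
    refine slice_cauchy (v := fun k => gval L U h (ψ k) 0 q) (h := h ∘ ψ) (B := B)
      (fun k => hm _ _) (fun k x => S.abs_gval_le _ _ _ _) hh0
      ⟨M * (1 + 16 * L * q / r), ?_, ?_⟩ fun x => ⟨_, hΦ (q, x)⟩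
    · have := (S.sol 0).nonneg
      positivity
    · have : ∀ᶠ k in atTop, (h ∘ ψ) k < r / 8 := hh0.eventually (gt_mem_nhds (by positivity))
      filter_upwards [this] with k hk y hy
      simp only [gval_zero]
      exact (S.sol (ψ k)).space_estimate H (S.pos _) hq le_rfl
        (by simp only [Function.comp] at hk; linarith) hy
  intro t ht r hr R
  refine tendsto_zero_of_approx (G := fun (p : ℕ × ℕ) (t : ℝ) => ∫ x in Icc r R,
    |gval L U h (ψ p.1) 0 t x - gval L U h (ψ p.2) 0 t x|) fun ε hε => ?_
  have hM := (S.sol 0).nonneg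
  set η := ε / (4 * (M + 1) * (2 * L)) with hη
  have hη0 : 0 < η := by positivity
  obtain ⟨q, hq1, hq2⟩ := exists_rat_btwn (show t < t + η by linarith)
  refine ⟨q, hrat q (ht.trans hq1.le) r hr R, ?_⟩
  have e1 : ∀ᶠ k in atTop, ∫ x in Icc r R, |gval L U h (ψ k) 0 q x - gval L U h (ψ k) 0 t x| ≤
      ε / 2 := by
    have : ∀ᶠ k in atTop, (h ∘ ψ) k < ε / (4 * (M + 1)) :=
      hh0.eventually (gt_mem_nhds (by positivity))
    filter_upwards [this] with k hk
    obtain ⟨i1, i2⟩ := (S.sol (ψ k)).time_estimate H (S.pos _) ht hq1.le r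
    simp only [gval_zero]
    refine (setIntegral_mono_set i1 (ae_of_all _ fun x => abs_nonneg _)
      (Filter.Eventually.of_forall fun _ hx => Icc_subset_Ici_self hx)).trans (i2.trans ?_)
    have a1 : 2 * L * (q - t) ≤ ε / (4 * (M + 1)) := by
      calc 2 * L * (q - t) ≤ 2 * L * η := by gcongr; linarith
        _ = _ := by rw [hη]; field_simp
    calc M * (2 * L * (q - t) + h (ψ k)) ≤ (M + 1) * (ε / (4 * (M + 1)) + ε / (4 * (M + 1))) := by
          simp only [Function.comp] at hk
          have := S.pos (ψ k)
          have : 0 ≤ 2 * L * (q - t) := mul_nonneg (by positivity) (by linarith)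
          gcongr
          linarith
      _ = ε / 2 := by field_simp; norm_num
  have e1' := (tendsto_fst (f := (atTop : Filter ℕ)) (g := (atTop : Filter ℕ))).eventually e1
  have e2' := (tendsto_snd (f := (atTop : Filter ℕ)) (g := (atTop : Filter ℕ))).eventually e1
  filter_upwards [e1', e2'] with p h1 h2
  have hI : ∀ k t, Integrable (gval L U h k 0 t) (volume.restrict (Icc r R)) := fun k t =>
    measurable_bounded_integrableOn (hm k t) (S.abs_gval_le k 0 t) (by simp)
  have i1 := fun k => ((hI (ψ k) q).sub (hI (ψ k) t)).abs
  have i3 := ((hI (ψ p.1) q).sub (hI (ψ p.2) q)).abs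
  rw [abs_of_nonneg (integral_nonneg fun x => abs_nonneg _),
    abs_of_nonneg (integral_nonneg fun x => abs_nonneg _)]
  refine (integral_mono_of_nonneg (ae_of_all _ fun x => abs_nonneg _)
    (((i1 p.1).add i3).add (i1 p.2)) (ae_of_all _ fun x => ?_)).trans ?_
  · simp only [Pi.add_apply, Pi.sub_apply]
    have t1 := abs_sub_le (gval L U h (ψ p.1) 0 t x) (gval L U h (ψ p.1) 0 q x)
      (gval L U h (ψ p.2) 0 t x)
    have t2 := abs_sub_le (gval L U h (ψ p.1) 0 q x) (gval L U h (ψ p.2) 0 q x)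
      (gval L U h (ψ p.2) 0 t x)
    rw [abs_sub_comm (gval L U h (ψ p.1) 0 t x) (gval L U h (ψ p.1) 0 q x)] at t1
    linarith
  · rw [integral_add' ((i1 p.1).add i3) (i1 p.2), integral_add' (i1 p.1) i3]
    simp only [Pi.sub_apply]
    linarith

end SchemeSeq

namespace SchemeSeq
variable {a b L M : ℝ} {f g : ℝ → ℝ} {U : ℕ → ℕ → ℤ → ℝ} {h : ℕ → ℝ}

lemma neighbour_estimate (H : FluxPair a b L f g) (S : SchemeSeq a b L M f g U h) {k : ℕ}
    {T t r R : ℝ} (ht : 0 ≤ t) (htT : t ≤ T) (hr : 16 * h k ≤ r) {i : ℤ} (hi : |i| ≤ 1) :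
    ∫ x in Icc r R, |gval L U h k i t x - gval L U h k 0 t x| ≤
      M * (1 + 16 * L * T / (r / 2)) * (2 * h k) := by
  have hk := S.pos k
  obtain ⟨s1, s2⟩ := (S.sol k).space_estimate H hk ht htT (r := r / 2) (by linarith) hk.le
  rw [← two_mul] at s2
  have e1 : ∀ x, emb (h k / (2 * L)) (h k) (U k) t (x + h k) = gval L U h k 1 t x := by
    intro x
    unfold emb gval
    rw [cell_add hk]
  have e0 : ∀ x, emb (h k / (2 * L)) (h k) (U k) t x = gval L U h k 0 t x := fun x =>
    (gval_zero _ _ _ _ _ _).symm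
  have hT : 0 ≤ T := ht.trans htT
  have hL := H.pos
  have hM := (S.sol k).nonneg
  have hcases : i = 0 ∨ i = 1 ∨ i = -1 := by
    rw [abs_le] at hi
    omega
  rcases hcases with rfl | rfl | rfl
  · simp only [sub_self, abs_zero, integral_zero]
    have : 0 < r := by linarith
    positivity
  · simp only [e1, e0] at s1 s2
    refine (setIntegral_mono_set s1 (ae_of_all _ fun x => abs_nonneg _)
      (Filter.Eventually.of_forall fun x hx => ?_)).trans s2
    have h1 : r ≤ x := hx.1
    have : 0 < r := by linarith
    have h2 : r / 2 ≤ x := by linarith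
    exact h2
  · simp only [e0] at s1 s2
    refine le_trans ?_ s2
    rw [← integral_indicator measurableSet_Icc, ← integral_indicator measurableSet_Ici]
    have s3 := ((integrable_indicator_iff measurableSet_Ici).2 s1).comp_sub_right (h k)
    rw [← integral_sub_right_eq_self ((Ici (r / 2)).indicator _) (h k)]
    refine integral_mono_of_nonneg (ae_of_all _ fun x => indicator_nonneg
      (fun _ _ => abs_nonneg _) _) s3 (ae_of_all _ fun x => ?_)
    by_cases hx : x ∈ Icc r R
    · have h1 : r ≤ x := hx.1
      have hx' : x - h k ∈ Ici (r / 2) := mem_Ici.2 (by linarith)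
      have e2 : gval L U h k 0 t (x - h k) = gval L U h k (-1) t x := by
        unfold gval
        rw [cell_sub hk, add_zero]
        rfl
      simp only [indicator_of_mem hx, indicator_of_mem hx']
      rw [e2, sub_add_cancel, abs_sub_comm]
    · simp only [indicator_of_notMem hx]
      exact indicator_nonneg (fun _ _ => abs_nonneg _) _

/-- Almost everywhere convergence of a subsequence on the right half plane, together with the
neighbouring cells. -/
lemma exists_right_limit (H : FluxPair a b L f g) (S : SchemeSeq a b L M f g U h) :
    ∃ ψ : ℕ → ℕ, StrictMono ψ ∧ ∀ᵐ q : ℝ × ℝ, 0 < q.1 → 0 < q.2 → ∃ l, ∀ i : ℤ, |i| ≤ 1 →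
      Tendsto (fun k => gval L U h (ψ k) i q.1 q.2) atTop (nhds l) := by
  have hL := H.pos
  obtain ⟨ψ₁, hψ₁, hc⟩ := S.exists_slices H
  set B := max |a| |b| with hB
  set Bx : ℕ → Set (ℝ × ℝ) := fun n => Icc 0 (n : ℝ) ×ˢ Icc (1 / ((n : ℝ) + 1)) n with hBx
  have hBm : ∀ n, MeasurableSet (Bx n) := fun n => measurableSet_Icc.prod measurableSet_Icc
  have hfin : ∀ n, volume (Bx n) ≠ ⊤ := fun n => by
    rw [hBx, Measure.volume_eq_prod, Measure.prod_prod]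
    exact ENNReal.mul_ne_top (by simp) (by simp)
  have hmono : Monotone Bx := by
    intro m n hmn
    have h1 : (m : ℝ) ≤ n := by exact_mod_cast hmn
    exact prod_mono (Icc_subset_Icc_right h1)
      (Icc_subset_Icc (by gcongr) h1)
  have S₁ := S.comp hψ₁
  have hdm : ∀ k i k' i', Measurable fun q : ℝ × ℝ =>
      gval L U h k i q.1 q.2 - gval L U h k' i' q.1 q.2 := fun k i k' i' =>
    (measurable_gval L U h k i).sub (measurable_gval L U h k' i')
  have hdb : ∀ k i k' i' (q : ℝ × ℝ),
      |gval L U h k i q.1 q.2 - gval L U h k' i' q.1 q.2| ≤ 2 * B := fun k i k' i' q =>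
    (abs_sub _ _).trans (by linarith [S.abs_gval_le k i q.1 q.2, S.abs_gval_le k' i' q.1 q.2])
  have hdi : ∀ k i k' i' n, IntegrableOn (fun q : ℝ × ℝ =>
      gval L U h k i q.1 q.2 - gval L U h k' i' q.1 q.2) (Bx n) := fun k i k' i' n =>
    measurable_bounded_integrableOn (hdm _ _ _ _) (hdb _ _ _ _) (hfin n)
  have hbox : ∀ n : ℕ, Tendsto (fun p : ℕ × ℕ => ∫ q in Bx n,
      |gval L U h (ψ₁ p.1) 0 q.1 q.2 - gval L U h (ψ₁ p.2) 0 q.1 q.2|)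
      (atTop ×ˢ atTop) (nhds 0) := by
    intro n
    have e : ∀ p : ℕ × ℕ, ∫ q in Bx n,
        |gval L U h (ψ₁ p.1) 0 q.1 q.2 - gval L U h (ψ₁ p.2) 0 q.1 q.2| =
        ∫ t in Icc 0 (n : ℝ), ∫ x in Icc (1 / ((n : ℝ) + 1)) n,
          |gval L U h (ψ₁ p.1) 0 t x - gval L U h (ψ₁ p.2) 0 t x| := by
      intro p
      have := setIntegral_prod (μ := volume) (ν := volume) _ (hdi (ψ₁ p.1) 0 (ψ₁ p.2) 0 n).abs
      exact this
    simp only [e]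
    have := tendsto_integral_filter_of_dominated_convergence (l := (atTop ×ˢ atTop : Filter (ℕ × ℕ)))
      (μ := volume.restrict (Icc 0 (n : ℝ))) (F := fun (p : ℕ × ℕ) t =>
        ∫ x in Icc (1 / ((n : ℝ) + 1)) n,
          |gval L U h (ψ₁ p.1) 0 t x - gval L U h (ψ₁ p.2) 0 t x|) (f := fun _ => 0)
      (fun _ => 2 * B * (volume.restrict (Icc (1 / ((n : ℝ) + 1)) (n : ℝ))).real univ)
      (Eventually.of_forall fun p => ?_)
      (Eventually.of_forall fun p => ae_of_all _ fun t => ?_) (integrable_const _)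
      ((ae_restrict_iff' measurableSet_Icc).2 (ae_of_all _ fun t ht => hc t ht.1 _ (by positivity) _))
    · simpa using this
    · exact ((hdm (ψ₁ p.1) 0 (ψ₁ p.2) 0).abs.stronglyMeasurable.integral_prod_right
        (ν := volume.restrict (Icc (1 / ((n : ℝ) + 1)) (n : ℝ)))).aestronglyMeasurable
    · refine norm_integral_le_of_norm_le_const (ae_of_all _ fun x => ?_)
      rw [Real.norm_eq_abs, abs_abs]
      exact hdb _ _ _ _ (t, x)
  have hev : ∀ n : ℕ, ∀ᶠ k in atTop, (∀ l ≥ k, ∫ q in Bx n,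
      |gval L U h (ψ₁ l) 0 q.1 q.2 - gval L U h (ψ₁ k) 0 q.1 q.2| ≤ (2⁻¹) ^ n) ∧
      ∀ i : ℤ, |i| ≤ 1 → ∫ q in Bx n,
        |gval L U h (ψ₁ k) i q.1 q.2 - gval L U h (ψ₁ k) 0 q.1 q.2| ≤ (2⁻¹) ^ n := by
    intro n
    have hpos : (0 : ℝ) < (2⁻¹) ^ n := by positivity
    refine Eventually.and ?_ ?_
    · have h1 := (hbox n).eventually (gt_mem_nhds hpos)
      rw [prod_atTop_atTop_eq, eventually_atTop_prod_self'] at h1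
      obtain ⟨N, hN⟩ := h1
      filter_upwards [eventually_ge_atTop N] with k hk l hl
      exact (hN l (hk.trans hl) k hk).le
    · set r : ℝ := 1 / ((n : ℝ) + 1) with hr
      have hr0 : 0 < r := by positivity
      set C := M * (1 + 16 * L * n / (r / 2)) with hC
      have h0 : ∀ᶠ k in atTop, (h ∘ ψ₁) k < r / 16 := S₁.lim.eventually (gt_mem_nhds (by positivity))
      have h1 : ∀ᶠ k in atTop, n * (C * (2 * (h ∘ ψ₁) k)) < (2⁻¹) ^ n := by
        have := ((S₁.lim.const_mul 2).const_mul C).const_mul (n : ℝ)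
        simp only [mul_zero] at this
        exact this.eventually (gt_mem_nhds hpos)
      filter_upwards [h0, h1] with k hk0 hk1 i hi
      refine le_trans ?_ hk1.le
      simp only [Function.comp] at hk0
      refine integral_box_le (hdm (ψ₁ k) i (ψ₁ k) 0).abs (B := 2 * B) (fun q => ?_)
        (Nat.cast_nonneg n) fun t ht => ?_
      · rw [abs_abs]; exact hdb _ _ _ _ q
      · exact S.neighbour_estimate H ht.1 ht.2 (by linarith) hi
  obtain ⟨ψ₂, hψ₂, hP⟩ := extraction_forall_of_eventually hev
  refine ⟨ψ₁ ∘ ψ₂, hψ₁.comp hψ₂, ?_⟩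
  have conv : ∀ k i k' i' n, ∫ q in Bx n,
      |gval L U h k i q.1 q.2 - gval L U h k' i' q.1 q.2| ≤ (2⁻¹) ^ n →
      ∫⁻ q in Bx n, ‖gval L U h k i q.1 q.2 - gval L U h k' i' q.1 q.2‖ₑ ≤ (2⁻¹ : ENNReal) ^ n := by
    intro k i k' i' n hle
    rw [← ofReal_integral_norm_eq_lintegral_enorm (hdi k i k' i' n)]
    simp only [Real.norm_eq_abs]
    refine (ENNReal.ofReal_le_ofReal hle).trans (le_of_eq ?_)
    rw [ENNReal.ofReal_pow (by positivity), ENNReal.ofReal_inv_of_pos (by norm_num)]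
    simp
  have A0 := ae_summable_of_lintegral_le (μ := (volume : Measure (ℝ × ℝ)))
    (w := fun n q => gval L U h (ψ₁ (ψ₂ (n + 1))) 0 q.1 q.2 - gval L U h (ψ₁ (ψ₂ n)) 0 q.1 q.2)
    (fun n => hdm _ _ _ _) hmono hBm
    (fun n => conv _ _ _ _ _ ((hP n).1 _ (hψ₂.monotone (Nat.le_succ n))))
  have A1 : ∀ i : ℤ, ∀ᵐ q : ℝ × ℝ, |i| ≤ 1 → (∃ n, q ∈ Bx n) → Summable fun n =>
      |gval L U h (ψ₁ (ψ₂ n)) i q.1 q.2 - gval L U h (ψ₁ (ψ₂ n)) 0 q.1 q.2| := by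
    intro i
    by_cases hi : |i| ≤ 1
    · have := ae_summable_of_lintegral_le (μ := (volume : Measure (ℝ × ℝ)))
        (w := fun n q => gval L U h (ψ₁ (ψ₂ n)) i q.1 q.2 - gval L U h (ψ₁ (ψ₂ n)) 0 q.1 q.2)
        (fun n => hdm _ _ _ _) hmono hBm (fun n => conv _ _ _ _ _ ((hP n).2 i hi))
      filter_upwards [this] with q hq _
      exact hq
    · exact ae_of_all _ fun q hq => absurd hq hi
  filter_upwards [A0, ae_all_iff.2 A1] with q h0 h1 hq1 hq2
  have hmem : ∃ n, q ∈ Bx n := by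
    obtain ⟨n1, hn1⟩ := exists_nat_ge q.1
    obtain ⟨n2, hn2⟩ := exists_nat_ge q.2
    obtain ⟨n3, hn3⟩ := exists_nat_one_div_lt hq2
    refine ⟨n1 + n2 + n3, ⟨hq1.le, ?_⟩, ?_, ?_⟩
    · push_cast; linarith [Nat.cast_nonneg (α := ℝ) n2, Nat.cast_nonneg (α := ℝ) n3]
    · refine le_trans ?_ hn3.le
      gcongr
      linarith [Nat.cast_nonneg (α := ℝ) n2, Nat.cast_nonneg (α := ℝ) n1]
    · push_cast; linarith [Nat.cast_nonneg (α := ℝ) n1, Nat.cast_nonneg (α := ℝ) n3]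
  have hcs : CauchySeq fun n => gval L U h (ψ₁ (ψ₂ n)) 0 q.1 q.2 := by
    refine cauchySeq_of_summable_dist ((h0 hmem).congr fun n => ?_)
    rw [dist_comm, Real.dist_eq]
  obtain ⟨l, hl⟩ := cauchySeq_tendsto_of_complete hcs
  refine ⟨l, fun i hi => ?_⟩
  have := (tendsto_zero_iff_abs_tendsto_zero _).2 ((h1 i hi hmem).tendsto_atTop_zero)
  have h2 := this.add hl
  simpa using h2

end SchemeSeq

lemma ae_cell_neg {h : ℕ → ℝ} (hh : ∀ k, 0 < h k) :
    ∀ᵐ x : ℝ, ∀ k, cell (h k) (-x) = -cell (h k) x := by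
  rw [ae_all_iff]
  intro k
  have hc : (range fun n : ℤ => h k * (n - 1 / 2)).Countable := countable_range _
  filter_upwards [hc.ae_notMem volume] with x hx
  have hne : ∀ n : ℤ, (n : ℝ) ≠ x / h k + 1 / 2 := by
    intro n hn
    refine hx ⟨n, ?_⟩
    have := (hh k).ne'
    simp only
    rw [hn]
    field_simp
    ring
  unfold cell
  rw [Int.floor_eq_iff]
  have h1 := Int.floor_le (x / h k + 1 / 2)
  have h2 := Int.lt_floor_add_one (x / h k + 1 / 2)
  have h3 := lt_of_le_of_ne h1 (hne _)
  push_cast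
  rw [neg_div]
  constructor <;> linarith

lemma measurePreserving_reflect :
    MeasurePreserving (fun q : ℝ × ℝ => (q.1, -q.2)) volume volume :=
  (MeasurePreserving.id (volume : Measure ℝ)).prod (Measure.measurePreserving_neg volume)

lemma ae_reflect {P : ℝ × ℝ → Prop} (hP : ∀ᵐ q, P q) : ∀ᵐ q : ℝ × ℝ, P (q.1, -q.2) :=
  measurePreserving_reflect.quasiMeasurePreserving.ae hP

lemma ae_snd {P : ℝ → Prop} (hP : ∀ᵐ x, P x) : ∀ᵐ q : ℝ × ℝ, P q.2 :=
  Measure.quasiMeasurePreserving_snd.ae hP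

/-- Convergence almost everywhere of the scheme, including the neighbouring cells. -/
structure IsLim (a b L M : ℝ) (f g : ℝ → ℝ) (U : ℕ → ℕ → ℤ → ℝ) (h : ℕ → ℝ)
    (u : ℝ → ℝ → ℝ) : Prop where
  seq : SchemeSeq a b L M f g U h
  meas : Measurable (fun q : ℝ × ℝ => u q.1 q.2)
  mem : ∀ t x, u t x ∈ Icc a b
  conv : ∀ᵐ q : ℝ × ℝ, 0 < q.1 → ∀ i : ℤ, |i| ≤ 1 →
    Tendsto (fun k => gval L U h k i q.1 q.2) atTop (nhds (u q.1 q.2))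

lemma ae_gval_reflect {a b L M : ℝ} {f g : ℝ → ℝ} {U : ℕ → ℕ → ℤ → ℝ} {h : ℕ → ℝ}
    (S : SchemeSeq a b L M f g U h) : ∀ᵐ q : ℝ × ℝ, ∀ k i,
      gval L (fun k n j => U k n (-j)) h k i q.1 q.2 = gval L U h k (-i) q.1 (-q.2) := by
  filter_upwards [ae_snd (ae_cell_neg S.pos)] with q hq k i
  unfold gval
  simp only [hq k, neg_add]

lemma SchemeSeq.exists_lim {a b L M : ℝ} {f g : ℝ → ℝ} {U : ℕ → ℕ → ℤ → ℝ} {h : ℕ → ℝ}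
    (H : FluxPair a b L f g) (S : SchemeSeq a b L M f g U h) :
    ∃ ψ : ℕ → ℕ, StrictMono ψ ∧ ∃ u, IsLim a b L M f g (U ∘ ψ) (h ∘ ψ) u := by
  have hab := H.lt.le
  obtain ⟨ψ₁, hψ₁, c1⟩ := S.exists_right_limit H
  have S₁ := S.comp hψ₁
  obtain ⟨ψ₂, hψ₂, c2⟩ := (S₁.reflect H).exists_right_limit H.reflect
  have S₂ := S₁.comp hψ₂
  refine ⟨ψ₁ ∘ ψ₂, hψ₁.comp hψ₂, ?_⟩
  have c : ∀ᵐ q : ℝ × ℝ, 0 < q.1 → ∃ l, ∀ i : ℤ, |i| ≤ 1 →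
      Tendsto (fun k => gval L (U ∘ ψ₁ ∘ ψ₂) (h ∘ ψ₁ ∘ ψ₂) k i q.1 q.2) atTop (nhds l) := by
    have hne : ∀ᵐ x : ℝ, x ≠ 0 := by
      simp [ae_iff]
    filter_upwards [c1, ae_reflect c2, ae_reflect (ae_gval_reflect S₁), ae_snd hne]
      with q h1 h2 h3 h4 hq
    rcases lt_or_gt_of_ne h4 with h5 | h5
    · obtain ⟨l, hl⟩ := h2 hq (by simpa using h5)
      refine ⟨l, fun i hi => ?_⟩
      have := hl (-i) (by rwa [abs_neg])
      simp only [h3, neg_neg] at this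
      exact this
    · obtain ⟨l, hl⟩ := h1 hq h5
      exact ⟨l, fun i hi => (hl i hi).comp hψ₂.tendsto_atTop⟩
  set G : ℕ → ℝ × ℝ → ℝ := fun k => {q : ℝ × ℝ | 0 < q.1}.indicator
    (fun q => gval L (U ∘ ψ₁ ∘ ψ₂) (h ∘ ψ₁ ∘ ψ₂) k 0 q.1 q.2) with hG
  have hms : MeasurableSet {q : ℝ × ℝ | 0 < q.1} := measurableSet_lt measurable_const measurable_fst
  have hGm : ∀ k, Measurable (G k) := fun k => (measurable_gval _ _ _ _ _).indicator hms
  obtain ⟨w, hw, hwl⟩ := measurable_limit_of_tendsto_metrizable_ae (μ := (volume : Measure (ℝ × ℝ)))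
    (L := atTop) (f := G) (fun k => (hGm k).aemeasurable) (by
      filter_upwards [c] with q hq
      by_cases h0 : 0 < q.1
      · obtain ⟨l, hl⟩ := hq h0
        refine ⟨l, (hl 0 (by simp)).congr fun k => ?_⟩
        simp only [hG]
        rw [indicator_of_mem (by exact h0)]
      · refine ⟨0, tendsto_const_nhds.congr fun k => ?_⟩
        simp only [hG]
        rw [indicator_of_notMem (by exact h0)])
  refine ⟨fun t x => max a (min b (w (t, x))), S₂, ?_, fun t x => ⟨le_max_left _ _,
    max_le hab (min_le_left _ _)⟩, ?_⟩
  · exact measurable_const.max (measurable_const.min hw)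
  · filter_upwards [c, hwl] with q hq hq2 h0 i hi
    obtain ⟨l, hl⟩ := hq h0
    have e : w q = l := by
      refine tendsto_nhds_unique hq2 ((hl 0 (by simp)).congr fun k => ?_)
      simp only [hG]
      rw [indicator_of_mem (by exact h0)]
    have hlm : l ∈ Icc a b := isClosed_Icc.mem_of_tendsto (hl 0 (by simp))
      (Eventually.of_forall fun k => S₂.gval_mem k 0 q.1 q.2)
    have : max a (min b (w (q.1, q.2))) = l := by
      rw [Prod.mk.eta, e, min_eq_right hlm.2, max_eq_right hlm.1]
    rw [this]
    exact hl i hi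

lemma IsLim.reflect {a b L M : ℝ} {f g : ℝ → ℝ} {U : ℕ → ℕ → ℤ → ℝ} {h : ℕ → ℝ}
    {u : ℝ → ℝ → ℝ} (H : FluxPair a b L f g) (S : IsLim a b L M f g U h u) :
    IsLim a b L M (fun x => -g x) (fun x => -f x) (fun k n j => U k n (-j)) h
      (fun t x => u t (-x)) where
  seq := S.seq.reflect H
  meas := S.meas.comp (measurable_fst.prodMk measurable_snd.neg)
  mem := fun _ _ => S.mem _ _
  conv := by
    filter_upwards [ae_reflect S.conv, ae_gval_reflect S.seq] with q h1 h2 h0 i hi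
    refine Tendsto.congr (fun k => (h2 k i).symm) ?_
    exact h1 h0 (-i) (by rwa [abs_neg])

/-- Compactly supported `C¹` functions on the open half plane `t > 0`. -/
structure IsTestC1 (φ : ℝ × ℝ → ℝ) : Prop where
  diff : ContDiff ℝ 1 φ
  comp : HasCompactSupport φ
  supp : tsupport φ ⊆ Ioi 0 ×ˢ univ

namespace IsTestC1
variable {φ : ℝ × ℝ → ℝ}

lemma eq_zero (hφ : IsTestC1 φ) {p : ℝ × ℝ} (hp : p.1 ≤ 0) : φ p = 0 := by
  by_contra h
  have := hφ.supp (subset_tsupport φ h)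
  exact absurd this.1 (not_lt.2 hp)

lemma differentiableAt (hφ : IsTestC1 φ) (p : ℝ × ℝ) : DifferentiableAt ℝ φ p :=
  hφ.diff.differentiable (by simp) p

lemma integrable_mul (hφ : IsTestC1 φ) {F : ℝ × ℝ → ℝ} (hF : Measurable F) {B : ℝ}
    (hB : ∀ p, |F p| ≤ B) : Integrable fun p => F p * φ p :=
  (hφ.diff.continuous.integrable_of_hasCompactSupport hφ.comp).bdd_mul
    hF.aestronglyMeasurable (ae_of_all _ fun p => by rw [Real.norm_eq_abs]; exact hB p)

lemma continuous_fderiv_apply (hφ : IsTestC1 φ) (v : ℝ × ℝ) :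
    Continuous fun p => fderiv ℝ φ p v :=
  (hφ.diff.continuous_fderiv (by simp)).clm_apply continuous_const

lemma integrable_fderiv (hφ : IsTestC1 φ) (v : ℝ × ℝ) :
    Integrable fun p => fderiv ℝ φ p v :=
  (hφ.continuous_fderiv_apply v).integrable_of_hasCompactSupport
    (hφ.comp.fderiv_apply ℝ v)

lemma integrable_mul_fderiv (hφ : IsTestC1 φ) (v : ℝ × ℝ) {F : ℝ × ℝ → ℝ} (hF : Measurable F)
    {B : ℝ} (hB : ∀ p, |F p| ≤ B) : Integrable fun p => F p * fderiv ℝ φ p v :=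
  (hφ.integrable_fderiv v).bdd_mul
    hF.aestronglyMeasurable (ae_of_all _ fun p => by rw [Real.norm_eq_abs]; exact hB p)

lemma fderiv_eq_zero (hφ : IsTestC1 φ) {p : ℝ × ℝ} (hp : p.1 ≤ 0) : fderiv ℝ φ p = 0 := by
  by_contra h
  have h1 := hφ.supp (support_fderiv_subset ℝ (f := φ) h)
  exact absurd h1.1 (not_lt.2 hp)

/-- Integration of difference quotients against a converging sequence. -/
lemma tendsto_integral_quotient (hφ : IsTestC1 φ) {v : ℝ × ℝ} {s : ℕ → ℝ} (hs : ∀ k, s k ≠ 0)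
    (hs0 : Tendsto s atTop (nhds 0)) (hsv : ∀ k, s k * v.1 ≤ 0) {F : ℕ → ℝ × ℝ → ℝ}
    {F₀ : ℝ × ℝ → ℝ} (hF : ∀ k, Measurable (F k)) {B : ℝ} (hB : ∀ k p, |F k p| ≤ B)
    (hconv : ∀ᵐ p : ℝ × ℝ, 0 < p.1 → Tendsto (fun k => F k p) atTop (nhds (F₀ p))) :
    Tendsto (fun k => ∫ p, F k p * ((φ (p + s k • v) - φ p) / s k)) atTop
      (nhds (∫ p, F₀ p * fderiv ℝ φ p v)) := by
  obtain ⟨C, hC⟩ := hφ.diff.lipschitzWith_of_hasCompactSupport hφ.comp one_ne_zero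
  set K := Metric.cthickening ‖v‖ (tsupport φ) with hK
  have hKc : IsCompact K := IsCompact.cthickening hφ.comp
  have hB0 : 0 ≤ B := (abs_nonneg _).trans (hB 0 0)
  have hsmall : ∀ᶠ k in atTop, |s k| < 1 := by
    have := hs0.abs
    rw [abs_zero] at this
    exact this.eventually (gt_mem_nhds one_pos)
  refine tendsto_integral_filter_of_dominated_convergence
    (K.indicator fun _ => B * (C * ‖v‖)) ?_ ?_ ?_ ?_
  · refine Eventually.of_forall fun k => ((hF k).mul ?_).aestronglyMeasurable
    have := hφ.diff.continuous
    exact (by fun_prop : Continuous fun p => (φ (p + s k • v) - φ p) / s k).measurable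
  · filter_upwards [hsmall] with k hk
    refine ae_of_all _ fun p => ?_
    by_cases hp : p ∈ K
    · rw [indicator_of_mem hp, norm_mul, Real.norm_eq_abs, norm_div]
      refine mul_le_mul (hB k p) ?_ (by positivity) hB0
      have := hC.norm_sub_le (p + s k • v) p
      rw [add_sub_cancel_left, norm_smul] at this
      rw [div_le_iff₀ (norm_pos_iff.2 (hs k))]
      linarith
    · rw [indicator_of_notMem hp]
      have h1 : φ p = 0 := by
        by_contra h
        exact hp (Metric.self_subset_cthickening _ (subset_tsupport φ h))
      have h2 : φ (p + s k • v) = 0 := by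
        by_contra h
        refine hp (Metric.mem_cthickening_of_dist_le p _ _ _ (subset_tsupport φ h) ?_)
        rw [dist_eq_norm, sub_add_cancel_left, norm_neg, norm_smul, Real.norm_eq_abs]
        exact mul_le_of_le_one_left (norm_nonneg _) hk.le
      simp [h1, h2]
  · exact (integrable_indicator_iff hKc.measurableSet).2 (integrableOn_const hKc.measure_lt_top.ne)
  · filter_upwards [hconv] with p hp
    by_cases h0 : 0 < p.1
    · refine (hp h0).mul ?_
      have h1 : HasDerivAt (fun r : ℝ => φ (p + r • v)) (fderiv ℝ φ p v) 0 := by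
        have h2 : HasDerivAt (fun r : ℝ => p + r • v) v 0 := by
          simpa using ((hasDerivAt_id (0 : ℝ)).smul_const v).const_add p
        have h3 : HasFDerivAt φ (fderiv ℝ φ p) (p + (0 : ℝ) • v) := by
          simpa using (hφ.differentiableAt p).hasFDerivAt
        exact h3.comp_hasDerivAt 0 h2
      have h2 := h1.tendsto_slope_zero
      have h3 : Tendsto s atTop (nhdsWithin 0 {0}ᶜ) :=
        tendsto_nhdsWithin_iff.2 ⟨hs0, Eventually.of_forall fun k => hs k⟩
      refine (h2.comp h3).congr fun k => ?_
      simp [div_eq_inv_mul]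
    · rw [hφ.fderiv_eq_zero (not_lt.1 h0)]
      refine tendsto_const_nhds.congr fun k => ?_
      rw [hφ.eq_zero (not_lt.1 h0), hφ.eq_zero (p := p + s k • v)]
      · simp
      · have := hsv k
        simp only [Prod.fst_add, Prod.smul_fst, smul_eq_mul]
        linarith

lemma integral_shift (hφ : IsTestC1 φ) {F : ℝ × ℝ → ℝ} (hF : Measurable F) {B : ℝ}
    (hB : ∀ p, |F p| ≤ B) (w : ℝ × ℝ) :
    Integrable (fun p => φ p * (F (p + w) - F p)) ∧
      ∫ p, φ p * (F (p + w) - F p) = ∫ p, F p * (φ (p - w) - φ p) := by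
  have i1 := hφ.integrable_mul hF hB
  have i2 := hφ.integrable_mul (F := fun p => F (p + w)) (hF.comp (measurable_add_const w))
    (fun p => hB _)
  have i3 := i2.comp_sub_right w
  have e := integral_sub_right_eq_self (μ := (volume : Measure (ℝ × ℝ)))
    (fun p => F (p + w) * φ p) w
  simp only [sub_add_cancel] at e i3
  refine ⟨(i2.sub i1).congr (ae_of_all _ fun p => ?_), ?_⟩
  · simp only [Pi.sub_apply]; ring
  · calc ∫ p, φ p * (F (p + w) - F p) = ∫ p, (F (p + w) * φ p - F p * φ p) := by
          congr 1; ext p; ring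
      _ = ∫ p, (F p * φ (p - w) - F p * φ p) := by
          rw [integral_sub i2 i1, integral_sub i3 i1, e]
      _ = _ := by congr 1; ext p; ring

/-- Passage to the limit in a discrete conservation inequality. -/
lemma limit_nonneg (hφ : IsTestC1 φ) (hφ0 : ∀ p, 0 ≤ φ p) {h : ℕ → ℝ} {L : ℝ} (hL : 0 < L)
    (hh : ∀ k, 0 < h k) (hh0 : Tendsto h atTop (nhds 0)) {η q : ℕ → ℝ × ℝ → ℝ}
    {η₀ q₀ : ℝ × ℝ → ℝ} (hη : ∀ k, Measurable (η k)) (hq : ∀ k, Measurable (q k))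
    (hη₀ : Measurable η₀) (hq₀ : Measurable q₀) {B : ℝ}
    (hηB : ∀ k p, |η k p| ≤ B) (hqB : ∀ k p, |q k p| ≤ B) (hη₀B : ∀ p, |η₀ p| ≤ B)
    (hq₀B : ∀ p, |q₀ p| ≤ B)
    (hηc : ∀ᵐ p : ℝ × ℝ, 0 < p.1 → Tendsto (fun k => η k p) atTop (nhds (η₀ p)))
    (hqc : ∀ᵐ p : ℝ × ℝ, 0 < p.1 → Tendsto (fun k => q k p) atTop (nhds (q₀ p)))
    (hineq : ∀ᶠ k in atTop, ∀ᵐ p : ℝ × ℝ, φ p ≠ 0 → η k (p + (h k / (2 * L), 0)) ≤ η k p -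
      1 / (2 * L) * (q k p - q k (p + (0, -h k)))) :
    0 ≤ ∫ p, (η₀ p * fderiv ℝ φ p (1, 0) + q₀ p * fderiv ℝ φ p (0, 1)) := by
  have hτ0 : Tendsto (fun k => -(h k / (2 * L))) atTop (nhds 0) := by
    have := (hh0.div_const (2 * L)).neg
    simpa using this
  have c1 := hφ.tendsto_integral_quotient (v := (1, 0)) (s := fun k => -(h k / (2 * L)))
    (fun k => (neg_neg_of_pos (by have := hh k; positivity)).ne) hτ0
    (fun k => by have := hh k; simp only [mul_one, Left.neg_nonpos_iff]; positivity) hη hηB hηc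
  have c2 := hφ.tendsto_integral_quotient (v := (0, 1)) (s := h)
    (fun k => (hh k).ne') hh0 (fun k => by simp) hq hqB hqc
  rw [integral_add (hφ.integrable_mul_fderiv _ hη₀ hη₀B) (hφ.integrable_mul_fderiv _ hq₀ hq₀B)]
  refine ge_of_tendsto (c1.add c2) ?_
  filter_upwards [hineq] with k hk
  have hhk := hh k
  obtain ⟨i1, e1⟩ := hφ.integral_shift (hη k) (hηB k) (h k / (2 * L), 0)
  obtain ⟨i2, e2⟩ := hφ.integral_shift (hq k) (hqB k) (0, -h k)
  have key : ∫ p, (φ p * (η k (p + (h k / (2 * L), 0)) - η k p) -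
      1 / (2 * L) * (φ p * (q k (p + (0, -h k)) - q k p))) ≤ 0 := by
    refine integral_nonpos_of_ae ?_
    filter_upwards [hk] with p hp
    by_cases h0 : φ p = 0
    · simp [h0]
    · have := hp h0
      have h2 := mul_le_mul_of_nonneg_left this (hφ0 p)
      simp only [Pi.zero_apply]
      nlinarith
  rw [integral_sub i1 (i2.const_mul _), integral_const_mul, e1, e2] at key
  have e3 : ∫ p, η k p * ((φ (p + -(h k / (2 * L)) • (1, 0)) - φ p) / -(h k / (2 * L))) =
      -(2 * L / h k) * ∫ p, η k p * (φ (p - (h k / (2 * L), 0)) - φ p) := by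
    rw [← integral_const_mul]
    congr 1
    ext p
    have : p + -(h k / (2 * L)) • ((1, 0) : ℝ × ℝ) = p - (h k / (2 * L), 0) := by
      ext <;> simp [sub_eq_add_neg]
    rw [this]
    field_simp
  have e4 : ∫ p, q k p * ((φ (p + h k • (0, 1)) - φ p) / h k) =
      (1 / h k) * ∫ p, q k p * (φ (p - (0, -h k)) - φ p) := by
    rw [← integral_const_mul]
    congr 1
    ext p
    have : p + h k • ((0, 1) : ℝ × ℝ) = p - (0, -h k) := by
      ext <;> simp
    rw [this]
    field_simp
  rw [e3, e4]
  set A := ∫ p, η k p * (φ (p - (h k / (2 * L), 0)) - φ p)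
  set D := ∫ p, q k p * (φ (p - (0, -h k)) - φ p)
  have : -(2 * L / h k) * A + 1 / h k * D = -(2 * L / h k) * (A - 1 / (2 * L) * D) := by
    field_simp
    ring
  rw [this]
  exact mul_nonneg_of_nonpos_of_nonpos (by simp; positivity) key

end IsTestC1

/-- The Kruzhkov entropy flux. -/
def entFlux (f : ℝ → ℝ) (u k : ℝ) : ℝ := f (u ⊔ k) - f (u ⊓ k)

/-- A stationary discrete profile connecting `km` and `kp`. -/
structure IsGerm (a b : ℝ) (f g : ℝ → ℝ) (km kp p c : ℝ) : Prop where
  km_mem : km ∈ Icc a b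
  kp_mem : kp ∈ Icc a b
  p_mem : p ∈ Icc a b
  left : g km = c
  right : f kp = c
  god_left : godunov g km p = c
  god_right : godunov f p kp = c

lemma abs_entFlux_le {f : ℝ → ℝ} {L : ℝ} (hf : ∀ x y, |f x - f y| ≤ L * |x - y|) (u k : ℝ) :
    |entFlux f u k| ≤ L * |u - k| := by
  have := hf (u ⊔ k) (u ⊓ k)
  rwa [max_sub_min_eq_abs', abs_abs] at this

lemma continuous_entFlux {f : ℝ → ℝ} (hf : Continuous f) :
    Continuous fun q : ℝ × ℝ => entFlux f q.1 q.2 := by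
  unfold entFlux
  fun_prop

lemma eventually_le_cell {h : ℕ → ℝ} (hh : ∀ k, 0 < h k) (hh0 : Tendsto h atTop (nhds 0))
    {x : ℝ} (hx : 0 < x) (N : ℤ) : ∀ᶠ k in atTop, N ≤ cell (h k) x := by
  have hN : (0 : ℝ) < |(N : ℝ)| + 1 := by positivity
  have : ∀ᶠ k in atTop, h k < x / (|(N : ℝ)| + 1) := hh0.eventually (gt_mem_nhds (by positivity))
  filter_upwards [this] with k hk
  unfold cell
  rw [Int.le_floor]
  have h1 := hh k
  rw [lt_div_iff₀ hN] at hk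
  have h2 : |(N : ℝ)| + 1 ≤ x / h k := by
    rw [le_div_iff₀ h1]
    linarith
  linarith [le_abs_self (N : ℝ)]

lemma eventually_cell_le {h : ℕ → ℝ} (hh : ∀ k, 0 < h k) (hh0 : Tendsto h atTop (nhds 0))
    {x : ℝ} (hx : x < 0) (N : ℤ) : ∀ᶠ k in atTop, cell (h k) x ≤ N := by
  have hN : (0 : ℝ) < |(N : ℝ)| + 1 := by positivity
  have : ∀ᶠ k in atTop, h k < -x / (|(N : ℝ)| + 1) :=
    hh0.eventually (gt_mem_nhds (div_pos (by linarith) hN))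
  filter_upwards [this] with k hk
  unfold cell
  have h1 := hh k
  rw [lt_div_iff₀ hN] at hk
  have h2 : |(N : ℝ)| + 1 ≤ -(x / h k) := by
    rw [← neg_div, le_div_iff₀ h1]
    linarith
  have h3 : ⌊x / h k + 1 / 2⌋ < N + 1 := by
    rw [Int.floor_lt]
    push_cast
    linarith [neg_abs_le (N : ℝ)]
  omega

lemma tendsto_godunov {f : ℝ → ℝ} {L : ℝ} (hL : 0 ≤ L) (hf : ∀ x y, |f x - f y| ≤ L * |x - y|)
    {x y : ℕ → ℝ} {z : ℝ} (hx : Tendsto x atTop (nhds z)) (hy : Tendsto y atTop (nhds z)) :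
    Tendsto (fun k => godunov f (x k) (y k)) atTop (nhds (f z)) := by
  rw [tendsto_iff_dist_tendsto_zero]
  have h1 := (((hx.sub_const z).abs).add ((hy.sub_const z).abs)).const_mul L
  simp only [sub_self, abs_zero, add_zero, mul_zero] at h1
  refine squeeze_zero (fun _ => dist_nonneg) (fun k => ?_) h1
  have := (isNumFlux_godunov hL hf).abs_sub_le (x k) (y k) z z
  rwa [godunov_self] at this

lemma godunov_entFlux_tendsto {f : ℝ → ℝ} {L : ℝ} (hL : 0 ≤ L)
    (hf : ∀ x y, |f x - f y| ≤ L * |x - y|)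
    {x y : ℕ → ℝ} {z : ℝ} (hx : Tendsto x atTop (nhds z)) (hy : Tendsto y atTop (nhds z)) (k : ℝ) :
    Tendsto (fun n => godunov f (x n ⊔ k) (y n ⊔ k) - godunov f (x n ⊓ k) (y n ⊓ k)) atTop
      (nhds (entFlux f z k)) :=
  (tendsto_godunov hL hf (hx.max tendsto_const_nhds) (hy.max tendsto_const_nhds)).sub
    (tendsto_godunov hL hf (hx.min tendsto_const_nhds) (hy.min tendsto_const_nhds))

namespace IsLim
variable {a b L M : ℝ} {f g : ℝ → ℝ} {U : ℕ → ℕ → ℤ → ℝ} {h : ℕ → ℝ} {u : ℝ → ℝ → ℝ}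

/-- Comparison of the limit with a discrete stationary state. -/
lemma comparison (H : FluxPair a b L f g) (S : IsLim a b L M f g U h u) {φ : ℝ × ℝ → ℝ}
    (hφ : IsTestC1 φ) (hφ0 : ∀ p, 0 ≤ φ p) {K : ℤ → ℝ} {km kp : ℝ} (hK : ∀ j, K j ∈ Icc a b)
    (hKm : ∀ j < 0, K j = km) (hKp : ∀ j > 0, K j = kp)
    (hst : ∀ᶠ n in atTop, ∀ p, φ p ≠ 0 →
      upd (1 / (2 * L)) (edgeFlux f g) K (cell (h n) p.2) = K (cell (h n) p.2)) :
    0 ≤ ∫ p : ℝ × ℝ, (|u p.1 p.2 - if 0 < p.2 then kp else km| * fderiv ℝ φ p (1, 0) +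
      (if 0 < p.2 then entFlux f (u p.1 p.2) kp else entFlux g (u p.1 p.2) km) *
        fderiv ℝ φ p (0, 1)) := by
  have hL := H.pos
  have hab := H.lt
  have hkm : km ∈ Icc a b := by rw [← hKm (-1) (by norm_num)]; exact hK _
  have hkp : kp ∈ Icc a b := by rw [← hKp 1 (by norm_num)]; exact hK _
  have hd : ∀ x ∈ Icc a b, ∀ y ∈ Icc a b, |x - y| ≤ b - a := by
    intro x hx y hy
    rw [abs_le]
    constructor <;> linarith [hx.1, hx.2, hy.1, hy.2]
  have hs : MeasurableSet {p : ℝ × ℝ | 0 < p.2} := measurableSet_lt measurable_const measurable_snd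
  have hpos := S.seq.pos
  have hlim := S.seq.lim
  have hne : ∀ᵐ x : ℝ, x ≠ 0 := by simp [ae_iff]
  refine hφ.limit_nonneg hφ0 hL hpos hlim (B := (b - a) + 2 * L * (b - a))
    (η := fun n p => emb (h n / (2 * L)) (h n) (fun m j => |U n m j - K j|) p.1 p.2)
    (q := fun n p => emb (h n / (2 * L)) (h n)
      (fun m j => kruz (edgeFlux f g) (U n m) K j) p.1 p.2)
    (fun n => measurable_emb _ _ _) (fun n => measurable_emb _ _ _) ?_ ?_ ?_ ?_ ?_ ?_ ?_ ?_ ?_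
  · exact (S.meas.sub (measurable_const.ite hs measurable_const)).abs
  · exact (((continuous_entFlux H.cont_f).measurable.comp (S.meas.prodMk measurable_const))).ite hs
      ((continuous_entFlux H.cont_g).measurable.comp (S.meas.prodMk measurable_const))
  · intro n p
    unfold emb
    rw [abs_abs]
    have := hd _ ((S.seq.sol n).mem ⌊p.1 / (h n / (2 * L))⌋₊ (cell (h n) p.2)) _
      (hK (cell (h n) p.2))
    have : 0 ≤ 2 * L * (b - a) := mul_nonneg (by positivity) (by linarith)
    linarith
  · intro n p
    have := (S.seq.sol n).abs_kruz_le' H hK ⌊p.1 / (h n / (2 * L))⌋₊ (cell (h n) p.2)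
    unfold emb
    linarith
  · intro p
    rw [abs_abs]
    have h1 : |u p.1 p.2 - if 0 < p.2 then kp else km| ≤ b - a := by
      split_ifs
      · exact hd _ (S.mem _ _) _ hkp
      · exact hd _ (S.mem _ _) _ hkm
    have : 0 ≤ 2 * L * (b - a) := mul_nonneg (by positivity) (by linarith)
    linarith
  · intro p
    have h1 := hd _ (S.mem p.1 p.2) _ hkp
    have h2 := hd _ (S.mem p.1 p.2) _ hkm
    have h3 := abs_entFlux_le H.lip_f (u p.1 p.2) kp
    have h4 := abs_entFlux_le H.lip_g (u p.1 p.2) km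
    have h5 := mul_le_mul_of_nonneg_left h1 hL.le
    have h6 := mul_le_mul_of_nonneg_left h2 hL.le
    have : 0 ≤ L * (b - a) := mul_nonneg (by positivity) (by linarith)
    split_ifs <;> linarith
  · filter_upwards [S.conv, ae_snd hne] with p hp h2 h1
    have c0 := hp h1 0 (by simp)
    rcases lt_or_gt_of_ne h2 with h3 | h3
    · rw [if_neg (not_lt.2 h3.le)]
      refine (c0.sub_const km).abs.congr' ?_
      filter_upwards [eventually_cell_le hpos hlim h3 (-1)] with n hn
      unfold emb gval
      beta_reduce
      rw [hKm _ (by omega), add_zero]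
    · rw [if_pos h3]
      refine (c0.sub_const kp).abs.congr' ?_
      filter_upwards [eventually_le_cell hpos hlim h3 1] with n hn
      unfold emb gval
      beta_reduce
      rw [hKp _ (by omega), add_zero]
  · filter_upwards [S.conv, ae_snd hne] with p hp h2 h1
    have c0 := hp h1 0 (by simp)
    have c1 := hp h1 1 (by simp)
    rcases lt_or_gt_of_ne h2 with h3 | h3
    · rw [if_neg (not_lt.2 h3.le)]
      refine (godunov_entFlux_tendsto hL.le H.lip_g c0 c1 km).congr' ?_
      filter_upwards [eventually_cell_le hpos hlim h3 (-2)] with n hn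
      unfold emb gval kruz edgeFlux
      beta_reduce
      rw [hKm _ (by omega), hKm _ (by omega), add_zero, if_neg (by omega)]
    · rw [if_pos h3]
      refine (godunov_entFlux_tendsto hL.le H.lip_f c0 c1 kp).congr' ?_
      filter_upwards [eventually_le_cell hpos hlim h3 1] with n hn
      unfold emb gval kruz edgeFlux
      beta_reduce
      rw [hKp _ (by omega), hKp _ (by omega), add_zero, if_pos (by omega)]
  · filter_upwards [hst] with n hn
    refine ae_of_all _ fun p hp => ?_
    have hp1 : 0 < p.1 := by
      by_contra hc
      exact hp (hφ.eq_zero (not_lt.1 hc))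
    have hτ : 0 < h n / (2 * L) := by have := hpos n; positivity
    have key := (S.seq.sol n).kruz_const H ⌊p.1 / (h n / (2 * L))⌋₊ _ (hn p hp)
    have e1 : ⌊(p.1 + h n / (2 * L)) / (h n / (2 * L))⌋₊ = ⌊p.1 / (h n / (2 * L))⌋₊ + 1 := by
      rw [add_div, div_self hτ.ne', Nat.floor_add_one (by positivity)]
    have e2 : cell (h n) (p.2 + -h n) = cell (h n) p.2 - 1 := cell_sub (hpos n) p.2
    simp only [emb, Prod.fst_add, Prod.snd_add, add_zero, e1, e2]
    exact key

/-- The Kruzhkov inequality away from the interface, on the right. -/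
lemma kruzhkov_right (H : FluxPair a b L f g) (S : IsLim a b L M f g U h u) {φ : ℝ × ℝ → ℝ}
    (hφ : IsTestC1 φ) (hφ0 : ∀ p, 0 ≤ φ p) {r : ℝ} (hr : 0 < r) (hφr : ∀ p, p.2 < r → φ p = 0)
    {ξ : ℝ} (hξ : ξ ∈ Icc a b) :
    0 ≤ ∫ p : ℝ × ℝ, (|u p.1 p.2 - ξ| * fderiv ℝ φ p (1, 0) +
      entFlux f (u p.1 p.2) ξ * fderiv ℝ φ p (0, 1)) := by
  have key := S.comparison H hφ hφ0 (K := fun _ => ξ) (km := ξ) (kp := ξ) (fun _ => hξ)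
    (fun _ _ => rfl) (fun _ _ => rfl) (by
      filter_upwards [eventually_le_cell S.seq.pos S.seq.lim hr 1] with n hn p hp
      have h1 : r ≤ p.2 := by
        by_contra hc
        exact hp (hφr p (not_le.1 hc))
      have h2 := hn.trans (cell_mono (S.seq.pos n) h1)
      unfold upd edgeFlux
      rw [if_pos (by omega), if_pos (by omega)]
      ring)
  refine key.trans_eq (integral_congr_ae (ae_of_all _ fun p => ?_))
  by_cases h1 : 0 < p.2
  · simp [h1]
  · have h0 : fderiv ℝ φ p = 0 := by
      have : φ =ᶠ[nhds p] fun _ => 0 := by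
        have : ∀ᶠ q : ℝ × ℝ in nhds p, q.2 < r :=
          (continuous_snd.tendsto p).eventually (gt_mem_nhds (by linarith))
        filter_upwards [this] with q hq using hφr q hq
      rw [this.fderiv_eq]
      simp
    simp [h0]

lemma germ_comparison (H : FluxPair a b L f g) (S : IsLim a b L M f g U h u) {φ : ℝ × ℝ → ℝ}
    (hφ : IsTestC1 φ) (hφ0 : ∀ p, 0 ≤ φ p) {km kp p c : ℝ} (hG : IsGerm a b f g km kp p c) :
    0 ≤ ∫ p : ℝ × ℝ, (|u p.1 p.2 - if 0 < p.2 then kp else km| * fderiv ℝ φ p (1, 0) +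
      (if 0 < p.2 then entFlux f (u p.1 p.2) kp else entFlux g (u p.1 p.2) km) *
        fderiv ℝ φ p (0, 1)) := by
  refine S.comparison H hφ hφ0 (K := fun j => if j < 0 then km else if j = 0 then p else kp)
    (fun j => ?_) (fun j hj => by simp [hj]) (fun j hj => ?_)
    (Eventually.of_forall fun n q _ => ?_)
  · split_ifs
    exacts [hG.km_mem, hG.p_mem, hG.kp_mem]
  · rw [if_neg (by omega), if_neg (by omega)]
  · generalize cell (h n) q.2 = j
    have h1 := hG.god_left
    have h2 := hG.god_right
    have h3 := hG.left
    have h4 := hG.right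
    have e : ∀ j : ℤ, edgeFlux f g j (if j < 0 then km else if j = 0 then p else kp)
        (if j + 1 < 0 then km else if j + 1 = 0 then p else kp) = c := by
      intro j
      unfold edgeFlux
      rcases lt_trichotomy j (-1) with hj | hj | hj
      · simp (disch := omega) only [if_neg, if_pos, godunov_self, h3]
      · subst hj
        simpa using h1
      · rcases eq_or_ne j 0 with rfl | hj0
        · simpa using h2
        · simp (disch := omega) only [if_neg, godunov_self, h4, if_pos]
    have e1 := e j
    have e2 := e (j - 1)
    rw [sub_add_cancel] at e2
    unfold upd
    rw [e1, e2]
    ring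

end IsLim

lemma abs_cell_mul_sub_le {h : ℝ} (hh : 0 < h) (x : ℝ) : |(cell h x : ℝ) * h - x| ≤ h := by
  unfold cell
  have h1 := Int.floor_le (x / h + 1 / 2)
  have h2 := Int.lt_floor_add_one (x / h + 1 / 2)
  have h3 : x = x / h * h := by field_simp
  rw [abs_le]
  constructor <;> nlinarith

namespace IsLim
variable {a b L M : ℝ} {f g : ℝ → ℝ} {U : ℕ → ℕ → ℤ → ℝ} {h : ℕ → ℝ} {u : ℝ → ℝ → ℝ}

lemma ae_slice (S : IsLim a b L M f g U h u) : ∀ᵐ t : ℝ, 0 < t → ∀ᵐ x : ℝ, ∀ i : ℤ, |i| ≤ 1 →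
    Tendsto (fun k => gval L U h k i t x) atTop (nhds (u t x)) := by
  filter_upwards [Measure.ae_ae_of_ae_prod S.conv] with t ht h0
  filter_upwards [ht] with x hx
  exact hx h0

lemma measurable_slice (S : IsLim a b L M f g U h u) (t : ℝ) : Measurable (u t) :=
  S.meas.comp measurable_prodMk_left

lemma initial_estimate (H : FluxPair a b L f g) (S : IsLim a b L M f g U h u) {u₀ : ℝ → ℝ}
    (hu₀ : Continuous u₀) (hU : ∀ k j, U k 0 j = u₀ (j * h k)) :
    ∀ᵐ t : ℝ, 0 < t → ∀ r R, ∫ x in Icc r R, |u t x - u₀ x| ≤ M * (2 * L * t) := by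
  filter_upwards [S.ae_slice] with t ht h0 r R
  have hgm : ∀ k t, Measurable (gval L U h k 0 t) := fun k t =>
    (measurable_gval L U h k 0).comp measurable_prodMk_left
  have hlim : Tendsto (fun k => ∫ x in Icc r R, |gval L U h k 0 t x - gval L U h k 0 0 x|) atTop
      (nhds (∫ x in Icc r R, |u t x - u₀ x|)) := by
    refine tendsto_integral_of_dominated_convergence
      (fun _ => 2 * max |a| |b|) (fun k => ((hgm k t).sub (hgm k 0)).abs.aestronglyMeasurable)
      (integrableOn_const (by simp)) (fun k => ae_of_all _ fun x => ?_) ?_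
    · rw [Real.norm_eq_abs, abs_abs]
      refine (abs_sub _ _).trans ?_
      linarith [S.seq.abs_gval_le k 0 t x, S.seq.abs_gval_le k 0 0 x]
    · filter_upwards [ae_restrict_of_ae (ht h0)] with x hx
      refine ((hx 0 (by simp)).sub ?_).abs
      have : ∀ k, gval L U h k 0 0 x = u₀ (cell (h k) x * h k) := by
        intro k
        unfold gval
        simp [hU]
      simp only [this]
      refine (hu₀.tendsto x).comp ?_
      rw [tendsto_iff_dist_tendsto_zero]
      exact squeeze_zero (fun _ => dist_nonneg) (fun k => abs_cell_mul_sub_le (S.seq.pos k) x)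
        S.seq.lim
  have hlim2 : Tendsto (fun k => M * (2 * L * (t - 0) + h k)) atTop
      (nhds (M * (2 * L * (t - 0) + 0))) := (S.seq.lim.const_add _).const_mul M
  rw [sub_zero, add_zero] at hlim2
  refine le_of_tendsto_of_tendsto' hlim hlim2 fun k => ?_
  obtain ⟨i1, i2⟩ := (S.seq.sol k).time_estimate H (S.seq.pos k) le_rfl h0.le r
  simp only [gval_zero]
  rw [sub_zero] at i2
  exact (setIntegral_mono_set i1 (ae_of_all _ fun x => abs_nonneg _)
    (Filter.Eventually.of_forall fun _ hx => Icc_subset_Ici_self hx)).trans i2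

lemma initial_tendsto (H : FluxPair a b L f g) (S : IsLim a b L M f g U h u) {u₀ : ℝ → ℝ}
    (hu₀ : Continuous u₀) (hU : ∀ k j, U k 0 j = u₀ (j * h k)) {K : Set ℝ} (hK : IsCompact K) :
    Tendsto (fun t => ∫ x in K, |u t x - u₀ x|)
      ((nhdsWithin 0 (Set.Ioi 0)) ⊓ ae (volume : Measure ℝ)) (nhds 0) := by
  obtain ⟨r, hr⟩ := hK.bddBelow
  obtain ⟨R, hR⟩ := hK.bddAbove
  have hKs : K ⊆ Icc r R := fun x hx => ⟨hr hx, hR hx⟩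
  have hlim : Tendsto (fun t : ℝ => M * (2 * L * t))
      ((nhdsWithin 0 (Set.Ioi 0)) ⊓ ae (volume : Measure ℝ)) (nhds 0) := by
    have : Tendsto (fun t : ℝ => M * (2 * L * t)) (nhds 0) (nhds (M * (2 * L * 0))) :=
      (by fun_prop : Continuous fun t : ℝ => M * (2 * L * t)).tendsto 0
    rw [mul_zero, mul_zero] at this
    exact this.mono_left (inf_le_left.trans nhdsWithin_le_nhds)
  refine squeeze_zero' (Eventually.of_forall fun t => integral_nonneg fun _ => abs_nonneg _)
    ?_ hlim
  have h1 : ∀ᶠ t : ℝ in (nhdsWithin 0 (Set.Ioi 0)) ⊓ ae (volume : Measure ℝ), 0 < t :=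
    Filter.Eventually.filter_mono inf_le_left self_mem_nhdsWithin
  have h2 := Filter.Eventually.filter_mono
    (inf_le_right (a := nhdsWithin (0 : ℝ) (Set.Ioi 0))) (S.initial_estimate H hu₀ hU)
  filter_upwards [h1, h2] with t ht hE
  refine le_trans ?_ (hE ht r R)
  refine setIntegral_mono_set ?_ (ae_of_all _ fun x => abs_nonneg _) (Eventually.of_forall hKs)
  have hi : IntegrableOn (fun x => u t x - u₀ x) (Icc r R) :=
    (measurable_bounded_integrableOn (S.measurable_slice t) (B := max |a| |b|)
      (fun x => abs_le_max_abs_abs (S.mem t x).1 (S.mem t x).2) (by simp)).sub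
      (hu₀.integrableOn_Icc)
  exact hi.abs

end IsLim

lemma sum_abs_sub_le_integral {v : ℝ → ℝ} (hv : ContDiff ℝ 1 v) (hc : HasCompactSupport v)
    {h : ℝ} (hh : 0 < h) (J : ℤ) (N : ℕ) :
    ∑ i ∈ Finset.range N, |v (((J + i + 1 : ℤ) : ℝ) * h) - v (((J + i : ℤ) : ℝ) * h)| ≤
      ∫ x, |deriv v x| := by
  have hd : Continuous (deriv v) := hv.continuous_deriv le_rfl
  have hi : Integrable (fun x => |deriv v x|) :=
    (hd.integrable_of_hasCompactSupport hc.deriv).abs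
  set x : ℕ → ℝ := fun i => ((J + i : ℤ) : ℝ) * h with hx
  have hxm : ∀ i, x i ≤ x (i + 1) := by
    intro i
    simp only [hx]
    gcongr
    omega
  have h1 : ∀ i, |v (x (i + 1)) - v (x i)| ≤ ∫ y in (x i)..(x (i + 1)), |deriv v y| := by
    intro i
    rw [← intervalIntegral.integral_deriv_eq_sub (fun y _ => hv.differentiable one_ne_zero y)
      (hd.intervalIntegrable _ _)]
    exact intervalIntegral.abs_integral_le_integral_abs (hxm i)
  have h2 : ∀ i : ℕ, ((J + i + 1 : ℤ) : ℝ) * h = x (i + 1) := by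
    intro i
    simp only [hx]
    push_cast
    ring
  calc _ ≤ ∑ i ∈ Finset.range N, ∫ y in (x i)..(x (i + 1)), |deriv v y| := by
        refine Finset.sum_le_sum fun i _ => ?_
        rw [h2]
        exact h1 i
    _ = ∫ y in (x 0)..(x N), |deriv v y| :=
        intervalIntegral.sum_integral_adjacent_intervals fun i _ => hd.abs.intervalIntegrable _ _
    _ ≤ _ := by
        rw [intervalIntegral.integral_of_le (monotone_nat_of_le_succ hxm (Nat.zero_le N))]
        exact setIntegral_le_integral hi (ae_of_all _ fun y => abs_nonneg _)

/-- Existence of limits of the scheme for given initial data. -/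
lemma exists_isLim {a b L : ℝ} {f g u₀ : ℝ → ℝ} (H : FluxPair a b L f g) (hu₀ : ContDiff ℝ 1 u₀)
    (hc : HasCompactSupport u₀) (hab : ∀ x, u₀ x ∈ Icc a b) :
    ∃ M U h u, IsLim a b L M f g U h u ∧ ∀ k j, U k 0 j = u₀ (j * h k) := by
  have hh : ∀ k : ℕ, (0 : ℝ) < 1 / ((k : ℝ) + 1) := fun k => by positivity
  choose U hU0 hU using fun k : ℕ => SchemeSol.exists_of_data H
    (fun j : ℤ => u₀ (j * (1 / ((k : ℝ) + 1)))) (fun j => hab _) (V := ∫ x, |deriv u₀ x|)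
    (fun J N => by
      have := sum_abs_sub_le_integral hu₀ hc (hh k) J N
      exact this)
  have S : SchemeSeq a b L ((∫ x, |deriv u₀ x|) + (b - a)) f g U fun k : ℕ => 1 / ((k : ℝ) + 1) :=
    ⟨hh, tendsto_one_div_add_atTop_nhds_zero_nat, hU⟩
  obtain ⟨ψ, -, u, hu⟩ := S.exists_lim H
  exact ⟨_, _, _, u, hu, fun k j => by simp [hU0]⟩

lemma eVariationOn_nat_le {q : ℕ → ℝ} {C : ℝ}
    (hq : ∀ J, ∑ i ∈ Finset.range J, |q (i + 1) - q i| ≤ C) :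
    eVariationOn q univ ≤ ENNReal.ofReal C := by
  refine iSup_le ?_
  rintro ⟨n, v, hv, -⟩
  have h1 : ∀ n, ∑ i ∈ Finset.range n, edist (q (v (i + 1))) (q (v i)) ≤
      ∑ j ∈ Finset.Ico (v 0) (v n), edist (q j) (q (j + 1)) := by
    intro n
    induction n with
    | zero => simp
    | succ n ih =>
      rw [Finset.sum_range_succ, ← Finset.sum_Ico_consecutive _ (hv (Nat.zero_le n))
        (hv (Nat.le_succ n)), edist_comm]
      exact add_le_add ih (edist_le_Ico_sum_edist q (hv (Nat.le_succ n)))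
  refine (h1 n).trans ?_
  have h2 : ∑ j ∈ Finset.Ico (v 0) (v n), edist (q j) (q (j + 1)) ≤
      ∑ j ∈ Finset.range (v n), edist (q j) (q (j + 1)) :=
    Finset.sum_le_sum_of_subset fun j hj => by
      simp only [Finset.mem_Ico, Finset.mem_range] at hj ⊢
      exact hj.2
  refine h2.trans ?_
  calc ∑ j ∈ Finset.range (v n), edist (q j) (q (j + 1))
      = ENNReal.ofReal (∑ j ∈ Finset.range (v n), |q (j + 1) - q j|) := by
        rw [ENNReal.ofReal_sum_of_nonneg fun _ _ => abs_nonneg _]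
        refine Finset.sum_congr rfl fun j _ => ?_
        rw [edist_dist, Real.dist_eq, abs_sub_comm]
    _ ≤ _ := ENNReal.ofReal_le_ofReal (hq _)

/-- One sided limit at `0` from the right along a set of full measure. -/
def HasTrace (v : ℝ → ℝ) (l : ℝ) : Prop :=
  ∃ E : Set ℝ, (∀ᵐ x, 0 < x → x ∈ E) ∧ Tendsto v (nhdsWithin 0 (E ∩ Ioi 0)) (nhds l)

lemma ae_mul_left {P : ℝ → Prop} (hP : ∀ᵐ x, P x) {c : ℝ} (hc : c ≠ 0) : ∀ᵐ x, P (c * x) := by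
  have : Measure.QuasiMeasurePreserving (fun x : ℝ => c * x) volume volume :=
    ⟨measurable_const_mul c, by
      rw [Real.map_volume_mul_left hc]
      exact Measure.smul_absolutelyContinuous⟩
  exact this.ae hP

lemma HasTrace.ae_scale {v : ℝ → ℝ} {l : ℝ} (hv : HasTrace v l) {δ : ℕ → ℝ} (hδ : ∀ n, 0 < δ n)
    (hδ0 : Tendsto δ atTop (nhds 0)) :
    ∀ᵐ s, 0 < s → Tendsto (fun n => v (δ n * s)) atTop (nhds l) := by
  obtain ⟨E, hE, hlim⟩ := hv
  filter_upwards [ae_all_iff.2 fun n => ae_mul_left hE (hδ n).ne'] with s hs h0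
  refine hlim.comp (tendsto_nhdsWithin_iff.2 ⟨?_, Eventually.of_forall fun n => ?_⟩)
  · simpa using hδ0.mul_const s
  · have : 0 < δ n * s := mul_pos (hδ n) h0
    exact ⟨hs n this, this⟩

/-- Convergence of all the entropy fluxes implies convergence for nonlinear fluxes. -/
lemma exists_tendsto_of_entFlux {a b : ℝ} {f : ℝ → ℝ} (hf : Continuous f)
    (hne : ∀ c d, a ≤ c → c < d → d ≤ b → ∃ x ∈ Icc c d, f x ≠ f c) {l : Filter ℝ} [l.NeBot]
    {v : ℝ → ℝ} (hv : ∀ x, v x ∈ Icc a b)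
    (hq : ∀ ξ ∈ Icc a b, ∃ c, Tendsto (fun x => entFlux f (v x) ξ) l (nhds c)) :
    ∃ w, Tendsto v l (nhds w) := by
  have hclus : ∀ x, MapClusterPt x l v → ∀ ξ ∈ Icc a b, ∀ c,
      Tendsto (fun x => entFlux f (v x) ξ) l (nhds c) → entFlux f x ξ = c := by
    intro x hx ξ hξ c hc
    have hcont : ContinuousAt (fun y => entFlux f y ξ) x :=
      ((continuous_entFlux hf).comp (continuous_id.prodMk continuous_const)).continuousAt
    have h1 : MapClusterPt (entFlux f x ξ) l ((fun y => entFlux f y ξ) ∘ v) :=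
      hx.continuousAt_comp hcont
    have h2 : ClusterPt (entFlux f x ξ) (nhds c) := ClusterPt.mono h1 hc
    exact eq_of_nhds_neBot h2
  have key : ∀ x y, x ∈ Icc a b → y ∈ Icc a b → MapClusterPt x l v → MapClusterPt y l v →
      ¬ x < y := by
    intro x y hx hy hx' hy' hxy
    have h1 : ∀ ξ ∈ Icc x y, f x + f y = 2 * f ξ := by
      intro ξ hξ
      have hξ' : ξ ∈ Icc a b := ⟨hx.1.trans hξ.1, hξ.2.trans hy.2⟩
      obtain ⟨c, hc⟩ := hq ξ hξ'
      have e1 := hclus x hx' ξ hξ' c hc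
      have e2 := hclus y hy' ξ hξ' c hc
      unfold entFlux at e1 e2
      rw [max_eq_right hξ.1, min_eq_left hξ.1] at e1
      rw [max_eq_left hξ.2, min_eq_right hξ.2] at e2
      linarith
    obtain ⟨z, hz, hz'⟩ := hne x y hx.1 hxy hy.2
    have e1 := h1 z hz
    have e2 := h1 x (left_mem_Icc.2 hxy.le)
    exact hz' (by linarith)
  obtain ⟨w, hw, hw'⟩ := isCompact_Icc.exists_mapClusterPt (f := l) (u := v)
    (le_principal_iff.2 (mem_map.2 (univ_mem' hv)))
  refine ⟨w, isCompact_Icc.tendsto_nhds_of_unique_mapClusterPt (univ_mem' hv) fun x hx hx' => ?_⟩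
  exact le_antisymm (not_lt.1 (key w x hw hx hw' hx')) (not_lt.1 (key x w hx hw hx' hw'))

namespace IsLim
variable {a b L M : ℝ} {f g : ℝ → ℝ} {U : ℕ → ℕ → ℤ → ℝ} {h : ℕ → ℝ} {u : ℝ → ℝ → ℝ}

lemma exists_hasTrace (H : FluxPair a b L f g) (S : IsLim a b L M f g U h u) :
    ∀ᵐ t : ℝ, 0 < t → ∃ l, HasTrace (u t) l := by
  have hL := H.pos
  filter_upwards [S.ae_slice] with t ht h0
  set E := {x : ℝ | ∀ i : ℤ, |i| ≤ 1 →
    Tendsto (fun k => gval L U h k i t x) atTop (nhds (u t x))} with hE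
  have hEae : ∀ᵐ x, 0 < x → x ∈ E := by
    filter_upwards [ht h0] with x hx _ using hx
  have hbv : ∀ ξ ∈ Icc a b, BoundedVariationOn (fun x => entFlux f (u t x) ξ) (E ∩ Ioi 0) := by
    intro ξ hξ
    set q : ℕ → ℤ → ℝ := fun k =>
      kruz (edgeFlux f g) (U k ⌊t / (h k / (2 * L))⌋₊) (fun _ => ξ) with hq
    have hlim : ∀ x ∈ E ∩ Ioi 0, Tendsto (fun k => q k (cell (h k) x)) atTop
        (nhds (entFlux f (u t x) ξ)) := by
      intro x hx
      have c0 := hx.1 0 (by simp)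
      have c1 := hx.1 1 (by simp)
      refine (godunov_entFlux_tendsto hL.le H.lip_f c0 c1 ξ).congr' ?_
      filter_upwards [eventually_le_cell S.seq.pos S.seq.lim hx.2 0] with n hn
      simp only [hq]
      unfold gval kruz edgeFlux
      rw [add_zero, if_pos hn]
    have hvar : ∀ k, eVariationOn (fun x => q k (cell (h k) x)) (E ∩ Ioi 0) ≤
        ENNReal.ofReal (2 * L * (2 * M + 2 * (b - a))) := by
      intro k
      have h1 : eVariationOn (fun i : ℕ => q k i) univ ≤
          ENNReal.ofReal (2 * L * (2 * M + 2 * (b - a))) := by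
        refine eVariationOn_nat_le fun J => ?_
        have := (S.seq.sol k).kruz_tv H hξ ⌊t / (h k / (2 * L))⌋₊ J
        push_cast
        exact this
      refine le_trans (le_of_eq ?_) ((eVariationOn.comp_le_of_monotoneOn (fun i : ℕ => q k i)
        (t := E ∩ Ioi 0) (fun x => (cell (h k) x).toNat)
        (fun x _ y _ hxy => Int.toNat_le_toNat (cell_mono (S.seq.pos k) hxy))
        (fun _ _ => mem_univ _)).trans h1)
      refine eVariationOn.eq_of_eqOn fun x hx => ?_
      have h2 : 0 ≤ cell (h k) x := by
        have h3 := cell_mono (S.seq.pos k) (mem_Ioi.1 hx.2).le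
        have h4 : cell (h k) 0 = 0 := by
          unfold cell
          norm_num
        omega
      simp only [Function.comp]
      rw [Int.toNat_of_nonneg h2]
    have hle : eVariationOn (fun x => entFlux f (u t x) ξ) (E ∩ Ioi 0) ≤
        ENNReal.ofReal (2 * L * (2 * M + 2 * (b - a))) := by
      by_contra hcon
      obtain ⟨k, hk⟩ := (eVariationOn.lowerSemicontinuous_aux hlim (not_le.1 hcon)).exists
      exact absurd hk (not_lt.2 (hvar k))
    exact ne_top_of_le_ne_top ENNReal.ofReal_ne_top hle
  have hneBot : (nhdsWithin (0 : ℝ) (E ∩ Ioi 0)).NeBot := by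
    rw [← mem_closure_iff_nhdsWithin_neBot, Metric.mem_closure_iff]
    intro ε hε
    have hpos : volume (Ioo (0 : ℝ) ε) ≠ 0 := by simp [hε]
    obtain ⟨x, hx, hx'⟩ : ∃ x ∈ Ioo (0 : ℝ) ε, x ∈ E := by
      by_contra hcon
      push Not at hcon
      refine hpos (measure_mono_null (fun x hx => ?_) hEae)
      intro hc
      exact hcon x hx (hc hx.1)
    refine ⟨x, ⟨hx', hx.1⟩, ?_⟩
    rw [Real.dist_eq, zero_sub, abs_neg, abs_of_pos hx.1]
    exact hx.2
  obtain ⟨w, hw⟩ := exists_tendsto_of_entFlux H.cont_f H.nonconst_f (S.mem t)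
    (l := nhdsWithin (0 : ℝ) (E ∩ Ioi 0)) fun ξ hξ => by
      obtain ⟨c, hc⟩ := (hbv ξ hξ).exists_tendsto_right 0
      rw [inter_assoc, inter_self] at hc
      exact ⟨c, hc⟩
  exact ⟨w, E, hEae, hw⟩

lemma exists_measurable_trace (H : FluxPair a b L f g) (S : IsLim a b L M f g U h u) :
    ∃ w : ℝ → ℝ, Measurable w ∧ (∀ t, w t ∈ Icc a b) ∧
      ∀ᵐ t : ℝ, 0 < t → HasTrace (u t) (w t) := by
  have hab := H.lt.le
  set δ : ℕ → ℝ := fun n => 1 / ((n : ℝ) + 1) with hδ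
  have hδp : ∀ n, 0 < δ n := fun n => by simp only [hδ]; positivity
  have hδ0 : Tendsto δ atTop (nhds 0) := tendsto_one_div_add_atTop_nhds_zero_nat
  set G : ℕ → ℝ → ℝ := fun n => (Ioi 0).indicator fun t => ∫ s in Ioc (0 : ℝ) 1, u t (δ n * s)
    with hG
  have hGm : ∀ n, Measurable (G n) := fun n => by
    refine Measurable.indicator ?_ measurableSet_Ioi
    have : Measurable fun p : ℝ × ℝ => u p.1 (δ n * p.2) :=
      S.meas.comp (measurable_fst.prodMk (measurable_snd.const_mul (δ n)))
    exact (this.stronglyMeasurable.integral_prod_right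
      (ν := volume.restrict (Ioc (0 : ℝ) 1))).measurable
  have hconv : ∀ t l, 0 < t → HasTrace (u t) l → Tendsto (fun n => G n t) atTop (nhds l) := by
    intro t l h0 hl
    simp only [hG, indicator_of_mem (mem_Ioi.2 h0)]
    have h1 := tendsto_integral_of_dominated_convergence (μ := volume.restrict (Ioc (0 : ℝ) 1))
      (F := fun n s => u t (δ n * s)) (f := fun _ => l) (fun _ => max |a| |b|)
      (fun n => ((S.measurable_slice t).comp (measurable_const_mul (δ n))).aestronglyMeasurable)
      (integrableOn_const (by simp)) (fun n => ae_of_all _ fun s => by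
        rw [Real.norm_eq_abs]
        exact abs_le_max_abs_abs (S.mem _ _).1 (S.mem _ _).2) (by
        rw [ae_restrict_iff' measurableSet_Ioc]
        filter_upwards [hl.ae_scale hδp hδ0] with s hs hs'
        exact hs hs'.1)
    simpa using h1
  obtain ⟨w, hw, hwl⟩ := measurable_limit_of_tendsto_metrizable_ae (μ := (volume : Measure ℝ))
    (L := atTop) (f := G) (fun n => (hGm n).aemeasurable) (by
      filter_upwards [S.exists_hasTrace H] with t ht
      by_cases h0 : 0 < t
      · obtain ⟨l, hl⟩ := ht h0
        exact ⟨l, hconv t l h0 hl⟩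
      · refine ⟨0, tendsto_const_nhds.congr fun n => ?_⟩
        simp only [hG]
        rw [indicator_of_notMem (by exact h0)])
  refine ⟨fun t => max a (min b (w t)), measurable_const.max (measurable_const.min hw),
    fun t => ⟨le_max_left _ _, max_le hab (min_le_left _ _)⟩, ?_⟩
  filter_upwards [S.exists_hasTrace H, hwl] with t ht hwt h0
  obtain ⟨l, hl⟩ := ht h0
  have e : w t = l := tendsto_nhds_unique hwt (hconv t l h0 hl)
  have hlm : l ∈ Icc a b := by
    obtain ⟨x, hx0, hx⟩ : ∃ x : ℝ, 0 < x ∧ Tendsto (fun n => u t (δ n * x)) atTop (nhds l) := by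
      by_contra hcon
      push Not at hcon
      have hnull : ∀ᵐ x : ℝ, x ∉ Ioo (0 : ℝ) 1 := by
        filter_upwards [hl.ae_scale hδp hδ0] with x hx hx' using hcon x hx'.1 (hx hx'.1)
      have h2 := measure_eq_zero_iff_ae_notMem.2 hnull
      rw [Real.volume_Ioo] at h2
      norm_num at h2
    exact isClosed_Icc.mem_of_tendsto hx (Eventually.of_forall fun n => S.mem _ _)
  show HasTrace (u t) (max a (min b (w t)))
  rw [e, min_eq_right hlm.2, max_eq_right hlm.1]
  exact hl

end IsLim

/-- Smooth cutoff vanishing for `x ≤ 1 / (n + 1)` and equal to one for `x ≥ 2 / (n + 1)`. -/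
noncomputable def cutoff (n : ℕ) (x : ℝ) : ℝ := Real.smoothTransition (((n : ℝ) + 1) * x - 1)

/-- Derivative of the unscaled cutoff. -/
noncomputable def bump (x : ℝ) : ℝ := deriv (cutoff 0) x

lemma cutoff_contDiff (n : ℕ) : ContDiff ℝ 1 (cutoff n) :=
  Real.smoothTransition.contDiff.comp ((contDiff_const.mul contDiff_id).sub contDiff_const)

lemma cutoff_eq_zero {n : ℕ} {x : ℝ} (hx : ((n : ℝ) + 1) * x ≤ 1) : cutoff n x = 0 :=
  Real.smoothTransition.zero_of_nonpos (by linarith)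

lemma cutoff_eq_one {n : ℕ} {x : ℝ} (hx : 2 ≤ ((n : ℝ) + 1) * x) : cutoff n x = 1 :=
  Real.smoothTransition.one_of_one_le (by linarith)

lemma cutoff_nonneg (n : ℕ) (x : ℝ) : 0 ≤ cutoff n x := Real.smoothTransition.nonneg _

lemma cutoff_le_one (n : ℕ) (x : ℝ) : cutoff n x ≤ 1 := Real.smoothTransition.le_one _

lemma cutoff_of_nonpos (n : ℕ) {x : ℝ} (hx : x ≤ 0) : cutoff n x = 0 :=
  cutoff_eq_zero (by nlinarith [mul_nonpos_of_nonneg_of_nonpos (Nat.cast_add_one_pos (α := ℝ) n).le hx])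

lemma cutoff_tendsto {x : ℝ} (hx : 0 < x) : Tendsto (fun n => cutoff n x) atTop (nhds 1) := by
  refine tendsto_const_nhds.congr' ?_
  have h1 : Tendsto (fun n : ℕ => ((n : ℝ) + 1) * x) atTop atTop :=
    (tendsto_atTop_add_const_right _ _ tendsto_natCast_atTop_atTop).atTop_mul_const hx
  filter_upwards [h1.eventually_ge_atTop 2] with n hn
  exact (cutoff_eq_one hn).symm

lemma cutoff_scale (n : ℕ) (x : ℝ) : cutoff n x = cutoff 0 (((n : ℝ) + 1) * x) := by
  unfold cutoff
  simp

lemma hasDerivAt_cutoff (n : ℕ) (x : ℝ) :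
    HasDerivAt (cutoff n) (((n : ℝ) + 1) * bump (((n : ℝ) + 1) * x)) x := by
  have h1 : HasDerivAt (cutoff 0) (bump (((n : ℝ) + 1) * x)) (((n : ℝ) + 1) * x) :=
    ((cutoff_contDiff 0).differentiable (by simp) _).hasDerivAt
  have h2 : HasDerivAt (fun y : ℝ => ((n : ℝ) + 1) * y) ((n : ℝ) + 1) x := by
    simpa using (hasDerivAt_id x).const_mul ((n : ℝ) + 1)
  have h3 := h1.comp x h2
  rw [mul_comm] at h3
  exact h3.congr_of_eventuallyEq (Eventually.of_forall fun y => cutoff_scale n y)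

lemma continuous_bump : Continuous bump := (cutoff_contDiff 0).continuous_deriv (by simp)

lemma bump_eq_zero {x : ℝ} (hx : x ∉ Icc (1 : ℝ) 2) : bump x = 0 := by
  unfold bump
  rw [mem_Icc, not_and_or, not_le, not_le] at hx
  rcases hx with hx | hx
  · have : cutoff 0 =ᶠ[nhds x] fun _ => 0 := by
      filter_upwards [Iio_mem_nhds hx] with y hy
      exact cutoff_eq_zero (by have := mem_Iio.1 hy; norm_num; linarith)
    rw [this.deriv_eq, deriv_const]
  · have : cutoff 0 =ᶠ[nhds x] fun _ => 1 := by
      filter_upwards [Ioi_mem_nhds hx] with y hy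
      exact cutoff_eq_one (by have := mem_Ioi.1 hy; norm_num; linarith)
    rw [this.deriv_eq, deriv_const]

lemma hasCompactSupport_bump : HasCompactSupport bump :=
  HasCompactSupport.intro isCompact_Icc fun _ hx => bump_eq_zero hx

lemma integrable_bump : Integrable bump :=
  continuous_bump.integrable_of_hasCompactSupport hasCompactSupport_bump

lemma integral_bump : ∫ x, bump x = 1 := by
  have h := integral_of_hasDerivAt_of_tendsto (f := cutoff 0) (f' := bump) (m := 0) (n := 1)
    (fun x => ((cutoff_contDiff 0).differentiable (by simp) x).hasDerivAt) integrable_bump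
    (tendsto_const_nhds.congr' (by
      filter_upwards [eventually_le_atBot 0] with x hx
      exact (cutoff_of_nonpos 0 hx).symm))
    (tendsto_const_nhds.congr' (by
      filter_upwards [eventually_ge_atTop 2] with x hx
      exact (cutoff_eq_one (by simpa using hx)).symm))
  rw [h, sub_zero]

/-- Concentrating kernels on the right of the origin see only the trace. -/
lemma HasTrace.tendsto_integral {v : ℝ → ℝ} {l B C : ℝ} (hv : HasTrace v l) (hm : Measurable v)
    (hB : ∀ x, |v x| ≤ B) {ψ : ℝ → ℝ} (hψ : Continuous ψ) (hC : ∀ x, |ψ x| ≤ C) :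
    Tendsto (fun n : ℕ => ∫ x, v x * ψ x * (((n : ℝ) + 1) * bump (((n : ℝ) + 1) * x))) atTop
      (nhds (l * ψ 0)) := by
  have hδp : ∀ n : ℕ, (0 : ℝ) < 1 / ((n : ℝ) + 1) := fun n => by positivity
  have hδ0 : Tendsto (fun n : ℕ => 1 / ((n : ℝ) + 1)) atTop (nhds 0) :=
    tendsto_one_div_add_atTop_nhds_zero_nat
  have h1 : ∀ n : ℕ, ∫ x, v x * ψ x * (((n : ℝ) + 1) * bump (((n : ℝ) + 1) * x)) =
      ∫ s, v (1 / ((n : ℝ) + 1) * s) * ψ (1 / ((n : ℝ) + 1) * s) * bump s := by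
    intro n
    have hn : (0 : ℝ) < (n : ℝ) + 1 := by positivity
    have h2 := Measure.integral_comp_mul_left
      (fun s => v (1 / ((n : ℝ) + 1) * s) * ψ (1 / ((n : ℝ) + 1) * s) * bump s) ((n : ℝ) + 1)
    rw [abs_of_pos (inv_pos.2 hn), smul_eq_mul, eq_comm, inv_mul_eq_iff_eq_mul₀ hn.ne'] at h2
    rw [h2, ← integral_const_mul]
    refine integral_congr_ae (ae_of_all _ fun x => ?_)
    have e : 1 / ((n : ℝ) + 1) * (((n : ℝ) + 1) * x) = x := by field_simp
    simp only [e]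
    ring
  simp only [h1]
  have h3 := tendsto_integral_of_dominated_convergence
    (F := fun n s => v (1 / ((n : ℝ) + 1) * s) * ψ (1 / ((n : ℝ) + 1) * s) * bump s)
    (f := fun s => l * ψ 0 * bump s) (fun s => B * C * |bump s|)
    (fun n => ((hm.comp (measurable_const_mul _)).mul
      (hψ.measurable.comp (measurable_const_mul _))).mul
        continuous_bump.measurable |>.aestronglyMeasurable)
    (integrable_bump.abs.const_mul _) (fun n => ae_of_all _ fun s => by
      rw [Real.norm_eq_abs, abs_mul, abs_mul]
      have := hB (1 / ((n : ℝ) + 1) * s)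
      have hB0 := (abs_nonneg _).trans this
      gcongr
      exact hC _) (by
      filter_upwards [hv.ae_scale hδp hδ0] with s hs
      by_cases h0 : 0 < s
      · refine ((hs h0).mul ?_).mul_const _
        have h4 : Tendsto (fun n : ℕ => 1 / ((n : ℝ) + 1) * s) atTop (nhds 0) := by
          simpa using hδ0.mul_const s
        exact (hψ.tendsto 0).comp h4
      · have : bump s = 0 := bump_eq_zero fun h => h0 (by linarith [h.1])
        simp [this])
  rw [integral_const_mul, integral_bump, mul_one] at h3
  exact h3

namespace IsTestC1
variable {φ : ℝ × ℝ → ℝ}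

lemma mul_fun (hφ : IsTestC1 φ) {θ : ℝ → ℝ} (hθ : ContDiff ℝ 1 θ) :
    IsTestC1 fun p => φ p * θ p.2 :=
  ⟨hφ.diff.mul (hθ.comp contDiff_snd), hφ.comp.mul_right,
    (closure_mono (Function.support_mul_subset_left _ _)).trans hφ.supp⟩

lemma fderiv_mul_fun (hφ : IsTestC1 φ) {θ : ℝ → ℝ} {p : ℝ × ℝ} {θ' : ℝ}
    (hθ : HasDerivAt θ θ' p.2) (v : ℝ × ℝ) :
    fderiv ℝ (fun p => φ p * θ p.2) p v = fderiv ℝ φ p v * θ p.2 + φ p * (θ' * v.2) := by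
  have h1 := (hφ.differentiableAt p).hasFDerivAt
  have h2 : HasFDerivAt (fun p : ℝ × ℝ => θ p.2) (θ' • ContinuousLinearMap.snd ℝ ℝ ℝ) p :=
    hθ.comp_hasFDerivAt p hasFDerivAt_snd
  have h3 : fderiv ℝ (fun p : ℝ × ℝ => φ p * θ p.2) p =
      φ p • θ' • ContinuousLinearMap.snd ℝ ℝ ℝ + θ p.2 • fderiv ℝ φ p := (h1.mul h2).fderiv
  rw [h3]
  simp
  ring

lemma exists_bound (hφ : IsTestC1 φ) : ∃ C, ∀ p, |φ p| ≤ C :=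
  hφ.comp.exists_bound_of_continuous hφ.diff.continuous

lemma integrable_slice (hφ : IsTestC1 φ) {w : ℝ → ℝ} (hw : Measurable w) {B : ℝ}
    (hB : ∀ t, |w t| ≤ B) : Integrable fun t => w t * φ (t, 0) := by
  have h1 : HasCompactSupport fun t : ℝ => φ (t, 0) :=
    HasCompactSupport.intro (hφ.comp.isCompact.image continuous_fst) fun t ht => by
      by_contra hc
      exact ht ⟨(t, 0), subset_tsupport φ hc, rfl⟩
  exact ((hφ.diff.continuous.comp (continuous_id.prodMk continuous_const)).integrable_of_hasCompactSupport
    h1).bdd_mul hw.aestronglyMeasurable (ae_of_all _ fun p => by rw [Real.norm_eq_abs]; exact hB p)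

end IsTestC1

/-- The weak divergence of `(η, q)` tested against `φ`. -/
noncomputable def weakDiv (η q φ : ℝ × ℝ → ℝ) : ℝ :=
  ∫ p, (η p * fderiv ℝ φ p (1, 0) + q p * fderiv ℝ φ p (0, 1))

/-- The open right half plane. -/
def rightHalf : Set (ℝ × ℝ) := {p | 0 < p.2}

/-- The open left half plane. -/
def leftHalf : Set (ℝ × ℝ) := {p | p.2 < 0}

lemma measurableSet_rightHalf : MeasurableSet rightHalf :=
  measurableSet_lt measurable_const measurable_snd

lemma measurableSet_leftHalf : MeasurableSet leftHalf :=
  measurableSet_lt measurable_snd measurable_const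

lemma abs_indicator_le {s : Set (ℝ × ℝ)} {F : ℝ × ℝ → ℝ} {B : ℝ} (hB : ∀ p, |F p| ≤ B)
    (p : ℝ × ℝ) : |s.indicator F p| ≤ B := by
  by_cases h : p ∈ s
  · rw [indicator_of_mem h]; exact hB p
  · rw [indicator_of_notMem h, abs_zero]; exact (abs_nonneg _).trans (hB p)

namespace IsTestC1
variable {φ : ℝ × ℝ → ℝ}

lemma weakDiv_integrable (hφ : IsTestC1 φ) {η q : ℝ × ℝ → ℝ} (hη : Measurable η)
    (hq : Measurable q) {B : ℝ} (hBη : ∀ p, |η p| ≤ B) (hBq : ∀ p, |q p| ≤ B) :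
    Integrable fun p => η p * fderiv ℝ φ p (1, 0) + q p * fderiv ℝ φ p (0, 1) :=
  (hφ.integrable_mul_fderiv (1, 0) hη hBη).add (hφ.integrable_mul_fderiv (0, 1) hq hBq)

lemma weakDiv_mul_cutoff (hφ : IsTestC1 φ) {η q : ℝ × ℝ → ℝ} (hη : Measurable η)
    (hq : Measurable q) {B : ℝ} (hBη : ∀ p, |η p| ≤ B) (hBq : ∀ p, |q p| ≤ B) (n : ℕ) :
    weakDiv η q (fun p => φ p * cutoff n p.2) =
      weakDiv (fun p => cutoff n p.2 * η p) (fun p => cutoff n p.2 * q p) φ +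
      ∫ t, ∫ x, q (t, x) * φ (t, x) * (((n : ℝ) + 1) * bump (((n : ℝ) + 1) * x)) := by
  have hcm : Measurable fun p : ℝ × ℝ => cutoff n p.2 :=
    (cutoff_contDiff n).continuous.measurable.comp measurable_snd
  have hc1 : ∀ p : ℝ × ℝ, |cutoff n p.2| ≤ 1 := fun p =>
    abs_le.2 ⟨by linarith [cutoff_nonneg n p.2], cutoff_le_one n p.2⟩
  have hbd : ∀ F : ℝ × ℝ → ℝ, (∀ p, |F p| ≤ B) → ∀ p, |cutoff n p.2 * F p| ≤ B := by
    intro F hF p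
    rw [abs_mul]
    have := hF p
    have h2 := (abs_nonneg _).trans this
    calc |cutoff n p.2| * |F p| ≤ 1 * B := by gcongr; exact hc1 p
      _ = B := one_mul B
  have hI1 := hφ.weakDiv_integrable (η := fun p => cutoff n p.2 * η p)
    (q := fun p => cutoff n p.2 * q p) (hcm.mul hη) (hcm.mul hq) (hbd η hBη) (hbd q hBq)
  obtain ⟨D, hD⟩ := hasCompactSupport_bump.exists_bound_of_continuous continuous_bump
  have hI2 : Integrable fun p : ℝ × ℝ =>
      q p * φ p * (((n : ℝ) + 1) * bump (((n : ℝ) + 1) * p.2)) := by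
    have h1 := hφ.integrable_mul (F := fun p => q p * (((n : ℝ) + 1) * bump (((n : ℝ) + 1) * p.2)))
      (hq.mul ((continuous_bump.measurable.comp (measurable_snd.const_mul _)).const_mul _))
      (B := B * (((n : ℝ) + 1) * D)) (fun p => by
        rw [abs_mul, abs_mul, abs_of_pos (by positivity : (0 : ℝ) < (n : ℝ) + 1)]
        have h1 := hBq p
        have h2 := (abs_nonneg _).trans h1
        have h3 : |bump (((n : ℝ) + 1) * p.2)| ≤ D := hD _
        gcongr)
    refine h1.congr (ae_of_all _ fun p => ?_)
    ring
  have e : ∫ t, ∫ x, q (t, x) * φ (t, x) * (((n : ℝ) + 1) * bump (((n : ℝ) + 1) * x)) =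
      ∫ p : ℝ × ℝ, q p * φ p * (((n : ℝ) + 1) * bump (((n : ℝ) + 1) * p.2)) := by
    rw [Measure.volume_eq_prod] at hI2 ⊢
    exact (integral_prod _ hI2).symm
  rw [e, weakDiv, weakDiv, ← integral_add hI1 hI2]
  refine integral_congr_ae (ae_of_all _ fun p => ?_)
  simp only [hφ.fderiv_mul_fun (hasDerivAt_cutoff n p.2)]
  ring

lemma weakDiv_cutoff_tendsto (hφ : IsTestC1 φ) {η q : ℝ × ℝ → ℝ} (hη : Measurable η)
    (hq : Measurable q) {B : ℝ} (hBη : ∀ p, |η p| ≤ B) (hBq : ∀ p, |q p| ≤ B) :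
    Tendsto (fun n => weakDiv (fun p => cutoff n p.2 * η p) (fun p => cutoff n p.2 * q p) φ) atTop
      (nhds (weakDiv (rightHalf.indicator η) (rightHalf.indicator q) φ)) := by
  have hlim : ∀ (F : ℝ × ℝ → ℝ) (p : ℝ × ℝ), Tendsto (fun n => cutoff n p.2 * F p) atTop
      (nhds (rightHalf.indicator F p)) := by
    intro F p
    by_cases h : p ∈ rightHalf
    · rw [indicator_of_mem h]
      simpa using (cutoff_tendsto h).mul_const (F p)
    · rw [indicator_of_notMem h]
      refine tendsto_const_nhds.congr fun n => ?_
      rw [cutoff_of_nonpos n (not_lt.1 h), zero_mul]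
  have hcm : ∀ n, Measurable fun p : ℝ × ℝ => cutoff n p.2 := fun n =>
    (cutoff_contDiff n).continuous.measurable.comp measurable_snd
  have hbd : ∀ F : ℝ × ℝ → ℝ, (∀ p, |F p| ≤ B) → ∀ n p, |cutoff n p.2 * F p| ≤ B := by
    intro F hF n p
    rw [abs_mul, abs_of_nonneg (cutoff_nonneg n p.2)]
    have := hF p
    have h2 := (abs_nonneg _).trans this
    calc cutoff n p.2 * |F p| ≤ 1 * B := by gcongr; exact cutoff_le_one n p.2
      _ = B := one_mul B
  refine tendsto_integral_of_dominated_convergence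
    (fun p => B * |fderiv ℝ φ p (1, 0)| + B * |fderiv ℝ φ p (0, 1)|) (fun n => ?_) ?_
    (fun n => ae_of_all _ fun p => ?_) (ae_of_all _ fun p => ?_)
  · exact (hφ.weakDiv_integrable ((hcm n).mul hη) ((hcm n).mul hq) (hbd η hBη n)
      (hbd q hBq n)).aestronglyMeasurable
  · exact ((hφ.integrable_fderiv _).abs.const_mul _).add ((hφ.integrable_fderiv _).abs.const_mul _)
  · rw [Real.norm_eq_abs]
    refine (abs_add_le _ _).trans (add_le_add ?_ ?_)
    · rw [abs_mul]
      exact mul_le_mul_of_nonneg_right (hbd η hBη n p) (abs_nonneg _)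
    · rw [abs_mul]
      exact mul_le_mul_of_nonneg_right (hbd q hBq n p) (abs_nonneg _)
  · exact ((hlim η p).mul_const _).add ((hlim q p).mul_const _)

lemma bump_term_tendsto (hφ : IsTestC1 φ) {q : ℝ × ℝ → ℝ} (hq : Measurable q) {B : ℝ}
    (hBq : ∀ p, |q p| ≤ B) {w : ℝ → ℝ}
    (hw : ∀ᵐ t, 0 < t → HasTrace (fun x => q (t, x)) (w t)) :
    Tendsto (fun n : ℕ => ∫ t, ∫ x, q (t, x) * φ (t, x) *
      (((n : ℝ) + 1) * bump (((n : ℝ) + 1) * x))) atTop (nhds (∫ t, w t * φ (t, 0))) := by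
  obtain ⟨C, hC⟩ := hφ.exists_bound
  have hB0 := (abs_nonneg _).trans (hBq 0)
  have hC0 := (abs_nonneg _).trans (hC 0)
  set K := Prod.fst '' tsupport φ with hK
  have hKc : IsCompact K := hφ.comp.isCompact.image continuous_fst
  have hKz : ∀ t x, t ∉ K → φ (t, x) = 0 := fun t x ht => by
    by_contra hc
    exact ht ⟨(t, x), subset_tsupport φ hc, rfl⟩
  refine tendsto_integral_of_dominated_convergence
    (K.indicator fun _ => B * C * ∫ x, |bump x|) (fun n => ?_) ?_
    (fun n => ae_of_all _ fun t => ?_) ?_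
  · have : Measurable fun p : ℝ × ℝ => q p * φ p * (((n : ℝ) + 1) * bump (((n : ℝ) + 1) * p.2)) :=
      (hq.mul hφ.diff.continuous.measurable).mul
        ((continuous_bump.measurable.comp (measurable_snd.const_mul _)).const_mul _)
    exact (this.stronglyMeasurable.integral_prod_right
      (ν := (volume : Measure ℝ))).measurable.aestronglyMeasurable
  · exact (integrableOn_const hKc.measure_lt_top.ne).integrable_indicator hKc.measurableSet
  · by_cases ht : t ∈ K
    · rw [indicator_of_mem ht]
      have hn : (0 : ℝ) < (n : ℝ) + 1 := by positivity
      have h2 : ∫ x, ((n : ℝ) + 1) * |bump (((n : ℝ) + 1) * x)| = ∫ x, |bump x| := by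
        rw [integral_const_mul, Measure.integral_comp_mul_left (fun s => |bump s|),
          abs_of_pos (inv_pos.2 hn), smul_eq_mul, mul_inv_cancel_left₀ hn.ne']
      rw [← h2, ← integral_const_mul]
      refine norm_integral_le_of_norm_le ?_ (ae_of_all _ fun x => ?_)
      · exact ((integrable_bump.abs.comp_mul_left' hn.ne').const_mul _).const_mul _
      · rw [Real.norm_eq_abs, abs_mul, abs_mul, abs_mul, abs_of_pos hn]
        have h3 := hBq (t, x)
        have h4 := hC (t, x)
        gcongr
    · rw [indicator_of_notMem ht]
      simp [hKz t _ ht]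
  · filter_upwards [hw] with t ht
    by_cases h0 : 0 < t
    · exact (ht h0).tendsto_integral (hq.comp measurable_prodMk_left) (fun x => hBq _)
        (hφ.diff.continuous.comp (continuous_const.prodMk continuous_id)) fun x => hC _
    · have : ∀ x, φ (t, x) = 0 := fun x => hφ.eq_zero (not_lt.1 h0)
      simp [this]

/-- Localizing on the right half plane produces the trace of the normal flux. -/
lemma weakDiv_right_tendsto (hφ : IsTestC1 φ) {η q : ℝ × ℝ → ℝ} (hη : Measurable η)
    (hq : Measurable q) {B : ℝ} (hBη : ∀ p, |η p| ≤ B) (hBq : ∀ p, |q p| ≤ B) {w : ℝ → ℝ}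
    (hw : ∀ᵐ t, 0 < t → HasTrace (fun x => q (t, x)) (w t)) :
    Tendsto (fun n => weakDiv η q (fun p => φ p * cutoff n p.2)) atTop
      (nhds (weakDiv (rightHalf.indicator η) (rightHalf.indicator q) φ +
        ∫ t, w t * φ (t, 0))) := by
  simp only [hφ.weakDiv_mul_cutoff hη hq hBη hBq]
  exact (hφ.weakDiv_cutoff_tendsto hη hq hBη hBq).add (hφ.bump_term_tendsto hq hBq hw)

lemma reflect (hφ : IsTestC1 φ) : IsTestC1 fun p => φ (p.1, -p.2) := by
  have hc : Continuous fun p : ℝ × ℝ => (p.1, -p.2) := by fun_prop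
  have hinv : ∀ p : ℝ × ℝ, ((p.1, -p.2) : ℝ × ℝ) ∈ tsupport φ → p ∈
      (fun p : ℝ × ℝ => (p.1, -p.2)) '' tsupport φ := fun p hp => ⟨_, hp, by simp⟩
  refine ⟨hφ.diff.comp (contDiff_fst.prodMk contDiff_snd.neg), ?_, ?_⟩
  · refine HasCompactSupport.intro (hφ.comp.isCompact.image hc) fun p hp => ?_
    by_contra h
    exact hp (hinv p (subset_tsupport φ h))
  · intro p hp
    have h1 : ((p.1, -p.2) : ℝ × ℝ) ∈ tsupport φ := by
      have h2 : IsClosed ((fun p : ℝ × ℝ => (p.1, -p.2)) ⁻¹' tsupport φ) :=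
        (isClosed_tsupport φ).preimage hc
      exact closure_minimal (s := Function.support fun p : ℝ × ℝ => φ (p.1, -p.2))
        (fun x hx => show (x.1, -x.2) ∈ tsupport φ from subset_tsupport φ hx) h2 hp
    exact ⟨(hφ.supp h1).1, mem_univ _⟩

lemma fderiv_reflect (hφ : IsTestC1 φ) (p v : ℝ × ℝ) :
    fderiv ℝ (fun p : ℝ × ℝ => φ (p.1, -p.2)) p v = fderiv ℝ φ (p.1, -p.2) (v.1, -v.2) := by
  have h1 : HasFDerivAt (fun p : ℝ × ℝ => (p.1, -p.2))
      ((ContinuousLinearMap.fst ℝ ℝ ℝ).prod (-ContinuousLinearMap.snd ℝ ℝ ℝ)) p :=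
    hasFDerivAt_fst.prodMk hasFDerivAt_snd.neg
  have h2 : HasFDerivAt (fun p : ℝ × ℝ => φ (p.1, -p.2)) ((fderiv ℝ φ (p.1, -p.2)).comp
      ((ContinuousLinearMap.fst ℝ ℝ ℝ).prod (-ContinuousLinearMap.snd ℝ ℝ ℝ))) p :=
    ((hφ.differentiableAt _).hasFDerivAt).comp p h1
  rw [h2.fderiv]
  simp

lemma weakDiv_reflect (hφ : IsTestC1 φ) (η q : ℝ × ℝ → ℝ) :
    weakDiv (fun p => η (p.1, -p.2)) (fun p => -q (p.1, -p.2)) (fun p => φ (p.1, -p.2)) =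
      weakDiv η q φ := by
  have hme : MeasurableEmbedding fun p : ℝ × ℝ => (p.1, -p.2) := by
    refine MeasurableEquiv.measurableEmbedding
      ⟨⟨fun p : ℝ × ℝ => (p.1, -p.2), fun p => (p.1, -p.2), fun p => by simp, fun p => by simp⟩,
        ?_, ?_⟩ <;> exact measurable_fst.prodMk measurable_snd.neg
  have h1 := measurePreserving_reflect.integral_comp hme
    (fun p => η p * fderiv ℝ φ p (1, 0) + q p * fderiv ℝ φ p (0, 1))
  rw [weakDiv, weakDiv, ← h1]
  refine integral_congr_ae (ae_of_all _ fun p => ?_)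
  simp only [hφ.fderiv_reflect]
  have : ((0 : ℝ), -(1 : ℝ)) = -((0 : ℝ), (1 : ℝ)) := by simp
  rw [neg_zero, this, map_neg]
  ring

lemma weakDiv_left_tendsto (hφ : IsTestC1 φ) {η q : ℝ × ℝ → ℝ} (hη : Measurable η)
    (hq : Measurable q) {B : ℝ} (hBη : ∀ p, |η p| ≤ B) (hBq : ∀ p, |q p| ≤ B) {w : ℝ → ℝ}
    (hw : ∀ᵐ t, 0 < t → HasTrace (fun x => q (t, -x)) (w t)) :
    Tendsto (fun n => weakDiv η q (fun p => φ p * cutoff n (-p.2))) atTop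
      (nhds (weakDiv (leftHalf.indicator η) (leftHalf.indicator q) φ -
        ∫ t, w t * φ (t, 0))) := by
  have hr : Measurable fun p : ℝ × ℝ => (p.1, -p.2) := measurable_fst.prodMk measurable_snd.neg
  have h1 := hφ.reflect.weakDiv_right_tendsto (η := fun p => η (p.1, -p.2))
    (q := fun p => -q (p.1, -p.2)) (hη.comp hr) (hq.comp hr).neg (fun p => hBη _)
    (fun p => by rw [abs_neg]; exact hBq _) (w := fun t => -w t) (by
      filter_upwards [hw] with t ht h0
      obtain ⟨E, hE, hl⟩ := ht h0
      exact ⟨E, hE, hl.neg⟩)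
  have e1 : ∀ n, weakDiv (fun p => η (p.1, -p.2)) (fun p => -q (p.1, -p.2))
      (fun p => φ (p.1, -p.2) * cutoff n p.2) =
      weakDiv η q (fun p => φ p * cutoff n (-p.2)) := by
    intro n
    have h2 : IsTestC1 fun p => φ p * cutoff n (-p.2) :=
      hφ.mul_fun (θ := fun x => cutoff n (-x)) ((cutoff_contDiff n).comp contDiff_neg)
    rw [← h2.weakDiv_reflect]
    simp only [neg_neg]
  have e2 : weakDiv (rightHalf.indicator fun p => η (p.1, -p.2))
      (rightHalf.indicator fun p => -q (p.1, -p.2)) (fun p => φ (p.1, -p.2)) =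
      weakDiv (leftHalf.indicator η) (leftHalf.indicator q) φ := by
    rw [← hφ.weakDiv_reflect]
    congr 1 <;>
    · funext p
      by_cases h : 0 < p.2 <;> simp [indicator, rightHalf, leftHalf, h]
  simp only [e1, e2, neg_zero, neg_mul, integral_neg] at h1
  exact h1

end IsTestC1

lemma HasTrace.comp {v : ℝ → ℝ} {l : ℝ} (hv : HasTrace v l) {F : ℝ → ℝ} (hF : Continuous F) :
    HasTrace (fun x => F (v x)) (F l) := by
  obtain ⟨E, hE, hl⟩ := hv
  exact ⟨E, hE, (hF.tendsto l).comp hl⟩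

lemma HasTrace.congr {v v' : ℝ → ℝ} {l : ℝ} (hv : HasTrace v l) (h : ∀ x, 0 < x → v' x = v x) :
    HasTrace v' l := by
  obtain ⟨E, hE, hl⟩ := hv
  refine ⟨E, hE, hl.congr' ?_⟩
  filter_upwards [self_mem_nhdsWithin] with x hx
  exact (h x hx.2).symm

/-- One sided traces of `u` on the line `x = 0`. -/
structure HasTraces (a b : ℝ) (u : ℝ → ℝ → ℝ) (ul ur : ℝ → ℝ) : Prop where
  meas_left : Measurable ul
  meas_right : Measurable ur
  mem_left : ∀ t, ul t ∈ Icc a b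
  mem_right : ∀ t, ur t ∈ Icc a b
  left : ∀ᵐ t : ℝ, 0 < t → HasTrace (fun x => u t (-x)) (ul t)
  right : ∀ᵐ t : ℝ, 0 < t → HasTrace (u t) (ur t)

lemma HasTraces.reflect {a b : ℝ} {u : ℝ → ℝ → ℝ} {ul ur : ℝ → ℝ} (T : HasTraces a b u ul ur) :
    HasTraces a b (fun t x => u t (-x)) ur ul :=
  ⟨T.meas_right, T.meas_left, T.mem_right, T.mem_left, by simpa using T.right, T.left⟩

lemma entFlux_neg (f : ℝ → ℝ) (x k : ℝ) : entFlux (fun y => -f y) x k = -entFlux f x k := by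
  unfold entFlux
  ring

lemma continuous_entFlux_left {f : ℝ → ℝ} (hf : Continuous f) (k : ℝ) :
    Continuous fun x => entFlux f x k :=
  (continuous_entFlux hf).comp (continuous_id.prodMk continuous_const)

lemma continuous_entFlux_right {f : ℝ → ℝ} (hf : Continuous f) (x : ℝ) :
    Continuous fun k => entFlux f x k :=
  (continuous_entFlux hf).comp (continuous_const.prodMk continuous_id)

lemma abs_sub_le_of_mem {a b x y : ℝ} (hx : x ∈ Icc a b) (hy : y ∈ Icc a b) : |x - y| ≤ b - a :=
  abs_le.2 ⟨by linarith [hx.1, hy.2], by linarith [hx.2, hy.1]⟩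

lemma abs_entFlux_le_of_mem {a b L : ℝ} (hL : 0 ≤ L) {f : ℝ → ℝ}
    (hf : ∀ x y, |f x - f y| ≤ L * |x - y|) {x k : ℝ} (hx : x ∈ Icc a b) (hk : k ∈ Icc a b) :
    |entFlux f x k| ≤ L * (b - a) :=
  (abs_entFlux_le hf x k).trans (mul_le_mul_of_nonneg_left (abs_sub_le_of_mem hx hk) hL)

namespace IsTestC1
variable {φ ψ : ℝ × ℝ → ℝ}

lemma fderiv_add_apply (hφ : IsTestC1 φ) (hψ : IsTestC1 ψ) (p v : ℝ × ℝ) :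
    fderiv ℝ (fun p => φ p + ψ p) p v = fderiv ℝ φ p v + fderiv ℝ ψ p v := by
  have h : fderiv ℝ (fun p => φ p + ψ p) p = fderiv ℝ φ p + fderiv ℝ ψ p :=
    ((hφ.differentiableAt p).hasFDerivAt.add (hψ.differentiableAt p).hasFDerivAt).fderiv
  rw [h]
  rfl

lemma weakDiv_add (hφ : IsTestC1 φ) (hψ : IsTestC1 ψ) {η q : ℝ × ℝ → ℝ} (hη : Measurable η)
    (hq : Measurable q) {B : ℝ} (hBη : ∀ p, |η p| ≤ B) (hBq : ∀ p, |q p| ≤ B) :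
    weakDiv η q (fun p => φ p + ψ p) = weakDiv η q φ + weakDiv η q ψ := by
  rw [weakDiv, weakDiv, weakDiv, ← integral_add (hφ.weakDiv_integrable hη hq hBη hBq)
    (hψ.weakDiv_integrable hη hq hBη hBq)]
  refine integral_congr_ae (ae_of_all _ fun p => ?_)
  simp only [hφ.fderiv_add_apply hψ]
  ring

lemma weakDiv_half_add (hφ : IsTestC1 φ) {η q : ℝ × ℝ → ℝ} (hη : Measurable η)
    (hq : Measurable q) {B : ℝ} (hBη : ∀ p, |η p| ≤ B) (hBq : ∀ p, |q p| ≤ B) :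
    weakDiv (rightHalf.indicator η) (rightHalf.indicator q) φ +
      weakDiv (leftHalf.indicator η) (leftHalf.indicator q) φ = weakDiv η q φ := by
  rw [weakDiv, weakDiv, weakDiv, ← integral_add]
  · have hne : ∀ᵐ x : ℝ, x ≠ 0 := by simp [ae_iff]
    refine integral_congr_ae ?_
    filter_upwards [ae_snd hne] with p hp
    rcases lt_or_gt_of_ne hp with h | h
    · simp [rightHalf, leftHalf, indicator, h, not_lt.2 h.le]
    · simp [rightHalf, leftHalf, indicator, h, not_lt.2 h.le]
  · exact hφ.weakDiv_integrable (hη.indicator measurableSet_rightHalf)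
      (hq.indicator measurableSet_rightHalf) (abs_indicator_le hBη) (abs_indicator_le hBq)
  · exact hφ.weakDiv_integrable (hη.indicator measurableSet_leftHalf)
      (hq.indicator measurableSet_leftHalf) (abs_indicator_le hBη) (abs_indicator_le hBq)

end IsTestC1

lemma cutoff_add_le_one (n : ℕ) (x : ℝ) : cutoff n x + cutoff n (-x) ≤ 1 := by
  rcases le_total x 0 with h | h
  · rw [cutoff_of_nonpos n h, zero_add]
    exact cutoff_le_one n _
  · rw [cutoff_of_nonpos n (neg_nonpos.2 h), add_zero]
    exact cutoff_le_one n _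

namespace IsLim
variable {a b L M : ℝ} {f g : ℝ → ℝ} {U : ℕ → ℕ → ℤ → ℝ} {h : ℕ → ℝ} {u : ℝ → ℝ → ℝ}
  {ul ur : ℝ → ℝ} {φ : ℝ × ℝ → ℝ}

lemma exists_hasTraces (H : FluxPair a b L f g) (S : IsLim a b L M f g U h u) :
    ∃ ul ur, HasTraces a b u ul ur := by
  obtain ⟨ur, h1, h2, h3⟩ := S.exists_measurable_trace H
  obtain ⟨ul, h4, h5, h6⟩ := (IsLim.reflect H S).exists_measurable_trace H.reflect
  exact ⟨ul, ur, h4, h1, h5, h2, h6, h3⟩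

lemma measurable_eta (S : IsLim a b L M f g U h u) (ξ : ℝ) :
    Measurable fun p : ℝ × ℝ => |u p.1 p.2 - ξ| :=
  (S.meas.sub_const ξ).abs

lemma measurable_entFlux (S : IsLim a b L M f g U h u) {F : ℝ → ℝ} (hF : Continuous F) (ξ : ℝ) :
    Measurable fun p : ℝ × ℝ => entFlux F (u p.1 p.2) ξ :=
  (continuous_entFlux_left hF ξ).measurable.comp S.meas

lemma entropy_right (H : FluxPair a b L f g) (S : IsLim a b L M f g U h u)
    (T : HasTraces a b u ul ur) (hφ : IsTestC1 φ) (hφ0 : ∀ p, 0 ≤ φ p) {ξ : ℝ}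
    (hξ : ξ ∈ Icc a b) :
    0 ≤ weakDiv (rightHalf.indicator fun p => |u p.1 p.2 - ξ|)
        (rightHalf.indicator fun p => entFlux f (u p.1 p.2) ξ) φ +
      ∫ t, entFlux f (ur t) ξ * φ (t, 0) := by
  refine ge_of_tendsto' (hφ.weakDiv_right_tendsto (B := max (b - a) (L * (b - a)))
    (S.measurable_eta ξ) (S.measurable_entFlux H.cont_f ξ)
    (fun p => ?_) (fun p => ?_) ?_) fun n => ?_
  · rw [abs_abs]
    exact (abs_sub_le_of_mem (S.mem _ _) hξ).trans (le_max_left _ _)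
  · exact (abs_entFlux_le_of_mem H.pos.le H.lip_f (S.mem _ _) hξ).trans (le_max_right _ _)
  · filter_upwards [T.right] with t ht h0
    exact (ht h0).comp (continuous_entFlux_left H.cont_f ξ)
  · refine S.kruzhkov_right H (hφ.mul_fun (cutoff_contDiff n))
      (fun p => mul_nonneg (hφ0 p) (cutoff_nonneg n _)) (r := 1 / ((n : ℝ) + 1)) (by positivity)
      (fun p hp => ?_) hξ
    have hn : (0 : ℝ) < (n : ℝ) + 1 := by positivity
    rw [cutoff_eq_zero (by rw [lt_div_iff₀ hn] at hp; linarith), mul_zero]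

lemma entropy_left (H : FluxPair a b L f g) (S : IsLim a b L M f g U h u)
    (T : HasTraces a b u ul ur) (hφ : IsTestC1 φ) (hφ0 : ∀ p, 0 ≤ φ p) {ξ : ℝ}
    (hξ : ξ ∈ Icc a b) :
    0 ≤ weakDiv (leftHalf.indicator fun p => |u p.1 p.2 - ξ|)
        (leftHalf.indicator fun p => entFlux g (u p.1 p.2) ξ) φ -
      ∫ t, entFlux g (ul t) ξ * φ (t, 0) := by
  have h1 := (IsLim.reflect H S).entropy_right H.reflect T.reflect hφ.reflect (fun p => hφ0 _) hξ
  rw [← hφ.weakDiv_reflect]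
  refine h1.trans_eq ?_
  rw [sub_eq_add_neg, ← integral_neg]
  congr 2
  · funext p
    by_cases h : 0 < p.2 <;> simp [indicator, rightHalf, leftHalf, h]
  · funext p
    by_cases h : 0 < p.2 <;> simp [indicator, rightHalf, leftHalf, h, entFlux_neg]
  · funext t
    simp only [entFlux_neg, neg_zero]
    ring

lemma germ_trace_integral (H : FluxPair a b L f g) (S : IsLim a b L M f g U h u)
    (T : HasTraces a b u ul ur) (hφ : IsTestC1 φ) (hφ0 : ∀ p, 0 ≤ φ p) {km kp p c : ℝ}
    (hG : IsGerm a b f g km kp p c) :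
    0 ≤ ∫ t, (entFlux g (ul t) km - entFlux f (ur t) kp) * φ (t, 0) := by
  set η : ℝ × ℝ → ℝ := fun p => |u p.1 p.2 - if 0 < p.2 then kp else km| with hη
  set q : ℝ × ℝ → ℝ := fun p =>
    if 0 < p.2 then entFlux f (u p.1 p.2) kp else entFlux g (u p.1 p.2) km with hq
  have hηm : Measurable η := (S.meas.sub
    (Measurable.ite measurableSet_rightHalf measurable_const measurable_const)).abs
  have hqm : Measurable q := Measurable.ite measurableSet_rightHalf
    (S.measurable_entFlux H.cont_f kp) (S.measurable_entFlux H.cont_g km)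
  set B := max (b - a) (L * (b - a)) with hB
  have hηB : ∀ p, |η p| ≤ B := fun p => by
    simp only [hη, abs_abs]
    refine (abs_sub_le_of_mem (S.mem _ _) ?_).trans (le_max_left _ _)
    split_ifs
    exacts [hG.kp_mem, hG.km_mem]
  have hqB : ∀ p, |q p| ≤ B := fun p => by
    simp only [hq]
    refine le_trans ?_ (le_max_right _ _)
    split_ifs
    · exact abs_entFlux_le_of_mem H.pos.le H.lip_f (S.mem _ _) hG.kp_mem
    · exact abs_entFlux_le_of_mem H.pos.le H.lip_g (S.mem _ _) hG.km_mem
  have hr := hφ.weakDiv_right_tendsto hηm hqm hηB hqB (w := fun t => entFlux f (ur t) kp) (by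
    filter_upwards [T.right] with t ht h0
    refine ((ht h0).comp (continuous_entFlux_left H.cont_f kp)).congr fun x hx => ?_
    simp only [hq]
    rw [if_pos hx])
  have hl := hφ.weakDiv_left_tendsto hηm hqm hηB hqB (w := fun t => entFlux g (ul t) km) (by
    filter_upwards [T.left] with t ht h0
    refine ((ht h0).comp (continuous_entFlux_left H.cont_g km)).congr fun x hx => ?_
    simp only [hq]
    rw [if_neg (by simpa using hx.le)])
  have hsum := hφ.weakDiv_half_add hηm hqm hηB hqB
  have hC0 : ∀ n, 0 ≤ weakDiv η q φ - (weakDiv η q (fun p => φ p * cutoff n p.2) +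
      weakDiv η q (fun p => φ p * cutoff n (-p.2))) := by
    intro n
    have t1 : IsTestC1 fun p => φ p * cutoff n p.2 := hφ.mul_fun (cutoff_contDiff n)
    have t2 : IsTestC1 fun p => φ p * cutoff n (-p.2) :=
      hφ.mul_fun (θ := fun x => cutoff n (-x)) ((cutoff_contDiff n).comp contDiff_neg)
    have t3 : IsTestC1 fun p => φ p * (1 - (cutoff n p.2 + cutoff n (-p.2))) :=
      hφ.mul_fun (θ := fun x => 1 - (cutoff n x + cutoff n (-x))) (contDiff_const.sub
        ((cutoff_contDiff n).add ((cutoff_contDiff n).comp contDiff_neg)))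
    have t4 : IsTestC1 fun p => φ p * cutoff n p.2 + φ p * cutoff n (-p.2) := by
      have := hφ.mul_fun (θ := fun x => cutoff n x + cutoff n (-x))
        ((cutoff_contDiff n).add ((cutoff_contDiff n).comp contDiff_neg))
      simpa only [mul_add] using this
    have h1 : 0 ≤ weakDiv η q fun p => φ p * (1 - (cutoff n p.2 + cutoff n (-p.2))) :=
      S.germ_comparison H t3 (fun p => mul_nonneg (hφ0 p)
        (sub_nonneg.2 (cutoff_add_le_one n p.2))) hG
    have h2 := t3.weakDiv_add t4 hηm hqm hηB hqB
    rw [t1.weakDiv_add t2 hηm hqm hηB hqB] at h2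
    have h3 : (fun p : ℝ × ℝ => φ p * (1 - (cutoff n p.2 + cutoff n (-p.2))) +
        (φ p * cutoff n p.2 + φ p * cutoff n (-p.2))) = φ := by
      funext p
      ring
    rw [h3] at h2
    linarith
  have hfin := ge_of_tendsto' (tendsto_const_nhds.sub (hr.add hl)) hC0
  have e : ∫ t, (entFlux g (ul t) km - entFlux f (ur t) kp) * φ (t, 0) =
      (∫ t, entFlux g (ul t) km * φ (t, 0)) - ∫ t, entFlux f (ur t) kp * φ (t, 0) := by
    rw [← integral_sub]
    · simp only [sub_mul]
    · exact hφ.integrable_slice ((continuous_entFlux_left H.cont_g km).measurable.comp T.meas_left)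
        fun t => abs_entFlux_le_of_mem H.pos.le H.lip_g (T.mem_left t) hG.km_mem
    · exact hφ.integrable_slice ((continuous_entFlux_left H.cont_f kp).measurable.comp T.meas_right)
        fun t => abs_entFlux_le_of_mem H.pos.le H.lip_f (T.mem_right t) hG.kp_mem
  rw [e]
  linarith

end IsLim

namespace IsTestC1
variable {φ : ℝ × ℝ → ℝ}

lemma integral_fderiv (hφ : IsTestC1 φ) (v : ℝ × ℝ) : ∫ p, fderiv ℝ φ p v = 0 := by
  have h := integral_mul_fderiv_eq_neg_fderiv_mul_of_integrable (μ := volume)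
    (f := fun _ : ℝ × ℝ => (1 : ℝ)) (g := φ) (v := v) (by simp)
    (by simpa using hφ.integrable_fderiv v)
    (by simpa using hφ.diff.continuous.integrable_of_hasCompactSupport hφ.comp)
    (fun _ _ => differentiableAt_const _) (fun p _ => hφ.differentiableAt p)
  simpa using h

lemma weakDiv_sub_const (hφ : IsTestC1 φ) {η q : ℝ × ℝ → ℝ} (hη : Measurable η)
    (hq : Measurable q) {B : ℝ} (hBη : ∀ p, |η p| ≤ B) (hBq : ∀ p, |q p| ≤ B) (c d : ℝ) :
    weakDiv (fun p => η p - c) (fun p => q p - d) φ = weakDiv η q φ := by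
  have h1 : weakDiv (fun p => η p - c) (fun p => q p - d) φ =
      weakDiv η q φ - ((∫ p, c * fderiv ℝ φ p (1, 0)) + ∫ p, d * fderiv ℝ φ p (0, 1)) := by
    have i1 := (hφ.integrable_fderiv (1, 0)).const_mul c
    have i2 := (hφ.integrable_fderiv (0, 1)).const_mul d
    have i3 : Integrable fun p => c * fderiv ℝ φ p (1, 0) + d * fderiv ℝ φ p (0, 1) := i1.add i2
    rw [weakDiv, weakDiv, ← integral_add i1 i2,
      ← integral_sub (hφ.weakDiv_integrable hη hq hBη hBq) i3]
    refine integral_congr_ae (ae_of_all _ fun p => ?_)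
    simp only
    ring
  rw [h1, integral_const_mul, integral_const_mul, hφ.integral_fderiv, hφ.integral_fderiv]
  ring

lemma weakDiv_neg (η q φ : ℝ × ℝ → ℝ) :
    weakDiv (fun p => -η p) (fun p => -q p) φ = -weakDiv η q φ := by
  rw [weakDiv, weakDiv, ← integral_neg]
  refine integral_congr_ae (ae_of_all _ fun p => ?_)
  simp only
  ring

/-- Every test function is dominated by a nonnegative one. -/
lemma exists_dominating (hφ : IsTestC1 φ) :
    ∃ χ, IsTestC1 χ ∧ (∀ p, 0 ≤ χ p) ∧ ∀ p, |φ p| ≤ χ p := by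
  obtain ⟨C, hC⟩ := hφ.exists_bound
  have hC0 : 0 ≤ C := (abs_nonneg _).trans (hC 0)
  obtain ⟨R, hR⟩ := hφ.comp.isCompact.isBounded.subset_closedBall (0 : ℝ × ℝ)
  have hR' : (0 : ℝ) < max R 1 := lt_max_of_lt_right one_pos
  let β : ContDiffBump (0 : ℝ × ℝ) := ⟨max R 1, max R 1 + 1, hR', by linarith⟩
  obtain ⟨n, hn⟩ : ∃ n : ℕ, ∀ p ∈ tsupport φ, 2 ≤ ((n : ℝ) + 1) * p.1 := by
    rcases (tsupport φ).eq_empty_or_nonempty with he | he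
    · exact ⟨0, fun p hp => by simp [he] at hp⟩
    · obtain ⟨q, hq, hmin⟩ := hφ.comp.isCompact.exists_isMinOn he continuous_fst.continuousOn
      have hq0 : 0 < q.1 := (hφ.supp hq).1
      obtain ⟨n, hn⟩ := exists_nat_ge (2 / q.1)
      refine ⟨n, fun p hp => ?_⟩
      have h1 : q.1 ≤ p.1 := hmin hp
      rw [div_le_iff₀ hq0] at hn
      have h2 : (n : ℝ) * q.1 ≤ n * p.1 := mul_le_mul_of_nonneg_left h1 n.cast_nonneg
      nlinarith
  refine ⟨fun p => C * (cutoff n p.1 * β p), ⟨?_, ?_, ?_⟩, fun p => ?_, fun p => ?_⟩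
  · exact contDiff_const.mul (((cutoff_contDiff n).comp contDiff_fst).mul β.contDiff)
  · exact (β.hasCompactSupport.mul_left).mul_left
  · have hn : (0 : ℝ) < (n : ℝ) + 1 := by positivity
    have h1 : IsClosed {p : ℝ × ℝ | 1 / ((n : ℝ) + 1) ≤ p.1} :=
      isClosed_le continuous_const continuous_fst
    intro p hp
    have h2 : p ∈ {p : ℝ × ℝ | 1 / ((n : ℝ) + 1) ≤ p.1} := by
      refine closure_minimal (fun x hx => ?_) h1 hp
      by_contra hc
      refine hx ?_
      have : ((n : ℝ) + 1) * x.1 ≤ 1 := by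
        have h3 : x.1 < 1 / ((n : ℝ) + 1) := not_le.1 hc
        rw [lt_div_iff₀ hn] at h3
        linarith
      simp only [cutoff_eq_zero this, zero_mul, mul_zero]
    have h3 : 0 < p.1 := lt_of_lt_of_le (by positivity) h2
    exact ⟨h3, mem_univ _⟩
  · exact mul_nonneg hC0 (mul_nonneg (cutoff_nonneg _ _) β.nonneg)
  · by_cases hp : p ∈ tsupport φ
    · have h1 : β p = 1 := β.one_of_mem_closedBall
        (Metric.closedBall_subset_closedBall (le_max_left _ _) (hR hp))
      simp only [cutoff_eq_one (hn p hp), h1, mul_one]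
      exact hC p
    · rw [image_eq_zero_of_notMem_tsupport hp, abs_zero]
      exact mul_nonneg hC0 (mul_nonneg (cutoff_nonneg _ _) β.nonneg)

lemma add (hφ : IsTestC1 φ) {ψ : ℝ × ℝ → ℝ} (hψ : IsTestC1 ψ) : IsTestC1 fun p => φ p + ψ p :=
  ⟨hφ.diff.add hψ.diff, hφ.comp.add hψ.comp,
    (tsupport_add φ ψ).trans (union_subset hφ.supp hψ.supp)⟩

/-- A function on the half line with nonnegative integral against traces of nonnegative test
functions is nonnegative. -/
lemma ae_nonneg {F : ℝ → ℝ} (hF : Measurable F) {B : ℝ} (hB : ∀ t, |F t| ≤ B)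
    (h : ∀ φ, IsTestC1 φ → (∀ p, 0 ≤ φ p) → 0 ≤ ∫ t, F t * φ (t, 0)) :
    ∀ᵐ t, 0 < t → 0 ≤ F t := by
  have hloc : LocallyIntegrable F := by
    intro x
    refine ⟨Metric.ball x 1, Metric.ball_mem_nhds x one_pos, ?_⟩
    exact measurable_bounded_integrableOn hF hB measure_ball_lt_top.ne
  let ρ : ℕ → ContDiffBump (0 : ℝ) := fun n =>
    ⟨1 / ((n : ℝ) + 1), 2 * (1 / ((n : ℝ) + 1)), by positivity, by
      have : (0 : ℝ) < 1 / ((n : ℝ) + 1) := by positivity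
      linarith⟩
  have hr : Tendsto (fun n => (ρ n).rOut) atTop (nhds 0) := by
    have := (tendsto_one_div_add_atTop_nhds_zero_nat (𝕜 := ℝ)).const_mul 2
    rwa [mul_zero] at this
  let κ : ContDiffBump (0 : ℝ) := ⟨1, 2, one_pos, one_lt_two⟩
  filter_upwards [ContDiffBump.ae_convolution_tendsto_right_of_locallyIntegrable (μ := volume)
    (φ := ρ) hr (K := 2) (Eventually.of_forall fun n => le_rfl) hloc] with t ht h0
  refine ge_of_tendsto ht ?_
  filter_upwards [hr.eventually (gt_mem_nhds h0)] with n hn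
  rw [convolution_eq_swap]
  have ht1 : IsTestC1 fun p : ℝ × ℝ => (ρ n).normed volume (t - p.1) * κ p.2 := by
    have hz : ∀ p : ℝ × ℝ, p ∉ Icc (t - (ρ n).rOut) (t + (ρ n).rOut) ×ˢ Icc (-2 : ℝ) 2 →
        (ρ n).normed volume (t - p.1) * κ p.2 = 0 := by
      intro p hp
      by_contra hc
      refine hp ⟨?_, ?_⟩
      · have h1 : t - p.1 ∈ Function.support ((ρ n).normed volume) := left_ne_zero_of_mul hc
        rw [ContDiffBump.support_normed_eq, mem_ball_zero_iff, Real.norm_eq_abs, abs_lt] at h1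
        constructor <;> linarith [h1.1, h1.2]
      · have h1 : p.2 ∈ Function.support κ := right_ne_zero_of_mul hc
        rw [ContDiffBump.support_eq, mem_ball_zero_iff, Real.norm_eq_abs, abs_lt] at h1
        exact ⟨h1.1.le, h1.2.le⟩
    refine ⟨?_, HasCompactSupport.intro (isCompact_Icc.prod isCompact_Icc) hz, ?_⟩
    · exact ((ρ n).contDiff_normed.comp (contDiff_const.sub contDiff_fst)).mul
        (κ.contDiff.comp contDiff_snd)
    · intro p hp
      have h2 : p ∈ Icc (t - (ρ n).rOut) (t + (ρ n).rOut) ×ˢ Icc (-2 : ℝ) 2 := by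
        refine closure_minimal (fun x hx => ?_) (isClosed_Icc.prod isClosed_Icc) hp
        by_contra hc
        exact hx (hz x hc)
      exact ⟨lt_of_lt_of_le (sub_pos.2 hn) h2.1.1, mem_univ _⟩
  have h3 := h _ ht1 fun p => mul_nonneg ((ρ n).nonneg_normed _) κ.nonneg
  refine h3.trans_eq (integral_congr_ae (ae_of_all _ fun s => ?_))
  have hk : κ 0 = 1 := κ.one_of_mem_closedBall (by simp [κ])
  simp [hk, mul_comm]

end IsTestC1

namespace IsLim
variable {a b L M : ℝ} {f g : ℝ → ℝ} {U : ℕ → ℕ → ℤ → ℝ} {h : ℕ → ℝ} {u : ℝ → ℝ → ℝ}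
  {ul ur : ℝ → ℝ} {φ : ℝ × ℝ → ℝ}

/-- The traces satisfy the interface inequality with respect to all stationary states. -/
lemma germ_trace (H : FluxPair a b L f g) (S : IsLim a b L M f g U h u)
    (T : HasTraces a b u ul ur) :
    ∀ᵐ t : ℝ, 0 < t → ∀ km kp p c, IsGerm a b f g km kp p c →
      entFlux f (ur t) kp ≤ entFlux g (ul t) km := by
  set Γ : Set (ℝ × ℝ) := {k | ∃ p c, IsGerm a b f g k.1 k.2 p c} with hΓ
  obtain ⟨D, hDc, hDd⟩ := TopologicalSpace.exists_countable_dense Γ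
  have : Countable D := hDc.to_subtype
  have h1 : ∀ k : D, ∀ᵐ t : ℝ, 0 < t →
      0 ≤ entFlux g (ul t) k.1.1.1 - entFlux f (ur t) k.1.1.2 := by
    rintro ⟨⟨⟨km, kp⟩, p, c, hG⟩, hk⟩
    refine IsTestC1.ae_nonneg (B := L * (b - a) + L * (b - a))
      (((continuous_entFlux_left H.cont_g km).measurable.comp T.meas_left).sub
      ((continuous_entFlux_left H.cont_f kp).measurable.comp T.meas_right)) (fun t => ?_)
      fun φ hφ hφ0 => S.germ_trace_integral H T hφ hφ0 hG
    exact (abs_sub _ _).trans (add_le_add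
      (abs_entFlux_le_of_mem H.pos.le H.lip_g (T.mem_left t) hG.km_mem)
      (abs_entFlux_le_of_mem H.pos.le H.lip_f (T.mem_right t) hG.kp_mem))
  filter_upwards [ae_all_iff.2 h1] with t ht h0 km kp p c hG
  have hc : IsClosed {k : Γ | entFlux f (ur t) k.1.2 ≤ entFlux g (ul t) k.1.1} :=
    isClosed_le
      ((continuous_entFlux_right H.cont_f _).comp (continuous_snd.comp continuous_subtype_val))
      ((continuous_entFlux_right H.cont_g _).comp (continuous_fst.comp continuous_subtype_val))
  have h2 : D ⊆ {k : Γ | entFlux f (ur t) k.1.2 ≤ entFlux g (ul t) k.1.1} := fun k hk =>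
    sub_nonneg.1 (ht ⟨k, hk⟩ h0)
  have h3 := closure_minimal h2 hc (hDd ⟨(km, kp), p, c, hG⟩)
  exact h3

lemma isGerm_const {k : ℝ} (hk : k ∈ Icc a b) (he : f k = g k) :
    IsGerm a b f g k k k (f k) :=
  ⟨hk, hk, hk, he.symm, rfl, by rw [godunov_self, he], by rw [godunov_self]⟩

lemma measurable_flux (H : FluxPair a b L f g) (S : IsLim a b L M f g U h u) :
    Measurable fun p : ℝ × ℝ => if 0 < p.2 then f (u p.1 p.2) else g (u p.1 p.2) :=
  Measurable.ite measurableSet_rightHalf (H.cont_f.measurable.comp S.meas)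
    (H.cont_g.measurable.comp S.meas)

lemma exists_flux_bound (H : FluxPair a b L f g) (S : IsLim a b L M f g U h u) :
    ∃ B, (∀ p : ℝ × ℝ, |u p.1 p.2| ≤ B) ∧
      ∀ p : ℝ × ℝ, |if 0 < p.2 then f (u p.1 p.2) else g (u p.1 p.2)| ≤ B := by
  obtain ⟨Bf, hBf⟩ := isCompact_Icc.exists_bound_of_continuousOn (s := Icc a b)
    H.cont_f.continuousOn
  obtain ⟨Bg, hBg⟩ := isCompact_Icc.exists_bound_of_continuousOn (s := Icc a b)
    H.cont_g.continuousOn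
  refine ⟨max (max |a| |b|) (max Bf Bg), fun p => ?_, fun p => ?_⟩
  · exact (abs_le_max_abs_abs (S.mem _ _).1 (S.mem _ _).2).trans (le_max_left _ _)
  · refine le_trans ?_ (le_max_right _ _)
    split_ifs
    · exact (hBf _ (S.mem _ _)).trans (le_max_left _ _)
    · exact (hBg _ (S.mem _ _)).trans (le_max_right _ _)

lemma weak_solution_of_nonneg (H : FluxPair a b L f g) (S : IsLim a b L M f g U h u)
    (hφ : IsTestC1 φ) (hφ0 : ∀ p, 0 ≤ φ p) :
    weakDiv (fun p => u p.1 p.2) (fun p => if 0 < p.2 then f (u p.1 p.2) else g (u p.1 p.2)) φ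
      = 0 := by
  have ha := S.germ_comparison H hφ hφ0 (isGerm_const (left_mem_Icc.2 H.lt.le) H.eq_a)
  have hb := S.germ_comparison H hφ hφ0 (isGerm_const (right_mem_Icc.2 H.lt.le) H.eq_b)
  have hqm := S.measurable_flux H
  obtain ⟨B, h1, h2⟩ := S.exists_flux_bound H
  have ea := hφ.weakDiv_sub_const S.meas hqm h1 h2 a (f a)
  have eb := hφ.weakDiv_sub_const S.meas hqm h1 h2 b (f b)
  refine le_antisymm ?_ ?_
  · rw [← neg_nonneg, ← eb, ← IsTestC1.weakDiv_neg]
    refine hb.trans_eq (integral_congr_ae (ae_of_all _ fun p => ?_))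
    have := S.mem p.1 p.2
    simp only [ite_self, entFlux, max_eq_right this.2, min_eq_left this.2,
      abs_of_nonpos (sub_nonpos.2 this.2)]
    split_ifs
    · ring
    · rw [H.eq_b]; ring
  · rw [← ea]
    refine ha.trans_eq (integral_congr_ae (ae_of_all _ fun p => ?_))
    have := S.mem p.1 p.2
    simp only [ite_self, entFlux, max_eq_left this.1, min_eq_right this.1,
      abs_of_nonneg (sub_nonneg.2 this.1)]
    split_ifs
    · ring
    · rw [H.eq_a]

lemma weak_solution (H : FluxPair a b L f g) (S : IsLim a b L M f g U h u) (hφ : IsTestC1 φ) :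
    weakDiv (fun p => u p.1 p.2) (fun p => if 0 < p.2 then f (u p.1 p.2) else g (u p.1 p.2)) φ
      = 0 := by
  obtain ⟨χ, hχ, hχ0, hd⟩ := hφ.exists_dominating
  have h1 := S.weak_solution_of_nonneg H hχ hχ0
  have h2 := S.weak_solution_of_nonneg H (hφ.add hχ) fun p => by
    linarith [neg_le_of_abs_le (hd p)]
  obtain ⟨B, hB, hBq⟩ := S.exists_flux_bound H
  rwa [hφ.weakDiv_add hχ S.meas (S.measurable_flux H) hB hBq, h1, add_zero] at h2

end IsLim

lemma godunov_neg_neg {f : ℝ → ℝ} (hf : Continuous f) (u v : ℝ) :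
    godunov (fun y => -f (-y)) (-u) (-v) = -godunov f u v := by
  have hF : Continuous fun y => -f (-y) := (hf.comp continuous_neg).neg
  rcases le_total u v with h | h
  · obtain ⟨⟨x, hx, hx'⟩, h1⟩ := godunov_of_le hf h
    obtain ⟨⟨y, hy, hy'⟩, h2⟩ := godunov_of_ge hF (neg_le_neg h)
    apply le_antisymm
    · rw [hy', neg_le_neg_iff]
      exact h1 (-y) ⟨by linarith [hy.2], by linarith [hy.1]⟩
    · have := h2 (-x) ⟨neg_le_neg hx.2, neg_le_neg hx.1⟩
      rw [neg_neg] at this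
      rwa [hx']
  · obtain ⟨⟨x, hx, hx'⟩, h1⟩ := godunov_of_ge hf h
    obtain ⟨⟨y, hy, hy'⟩, h2⟩ := godunov_of_le hF (neg_le_neg h)
    apply le_antisymm
    · have := h2 (-x) ⟨neg_le_neg hx.2, neg_le_neg hx.1⟩
      rw [neg_neg] at this
      rwa [hx']
    · rw [hy', neg_le_neg_iff]
      exact h1 (-y) ⟨by linarith [hy.2], by linarith [hy.1]⟩

lemma FluxPair.dual {a b L : ℝ} {f g : ℝ → ℝ} (H : FluxPair a b L f g) :
    FluxPair (-b) (-a) L (fun y => -f (-y)) (fun y => -g (-y)) := by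
  have hlip : ∀ F : ℝ → ℝ, (∀ x y, |F x - F y| ≤ L * |x - y|) →
      ∀ x y, |-F (-x) - -F (-y)| ≤ L * |x - y| := by
    intro F hF x y
    have h1 := hF (-y) (-x)
    rwa [show F (-y) - F (-x) = -F (-x) - -F (-y) by ring,
      show -y - -x = x - y by ring] at h1
  have hne : ∀ F : ℝ → ℝ, (∀ c d, a ≤ c → c < d → d ≤ b → ∃ x ∈ Icc c d, F x ≠ F c) →
      ∀ c d, -b ≤ c → c < d → d ≤ -a → ∃ x ∈ Icc c d, -F (-x) ≠ -F (-c) := by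
    intro F hF c d hc hcd hd
    obtain ⟨x, hx, hx'⟩ := hF (-d) (-c) (by linarith) (by linarith) (by linarith)
    by_contra hcon
    push Not at hcon
    have e1 := hcon (-x) ⟨by linarith [hx.2], by linarith [hx.1]⟩
    have e2 := hcon d (right_mem_Icc.2 hcd.le)
    rw [neg_neg] at e1
    exact hx' (by linarith)
  exact ⟨neg_lt_neg H.lt, H.pos, hlip f H.lip_f, hlip g H.lip_g,
    by simp only [neg_neg, H.eq_b], by simp only [neg_neg, H.eq_a],
    hne f H.nonconst_f, hne g H.nonconst_g⟩

lemma entFlux_dual (f : ℝ → ℝ) (u k : ℝ) :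
    entFlux (fun y => -f (-y)) u k = entFlux f (-u) (-k) := by
  unfold entFlux
  rw [max_neg_neg, min_neg_neg]
  ring

lemma IsGerm.dual {a b : ℝ} {f g : ℝ → ℝ} (hf : Continuous f) (hg : Continuous g)
    {km kp p c : ℝ} (G : IsGerm (-b) (-a) (fun y => -f (-y)) (fun y => -g (-y)) km kp p c) :
    IsGerm a b f g (-km) (-kp) (-p) (-c) := by
  have hm : ∀ {x : ℝ}, x ∈ Icc (-b) (-a) → -x ∈ Icc a b := fun hx =>
    ⟨by linarith [hx.2], by linarith [hx.1]⟩
  refine ⟨hm G.km_mem, hm G.kp_mem, hm G.p_mem, by linarith [G.left], by linarith [G.right], ?_, ?_⟩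
  · have h1 := godunov_neg_neg hg (-km) (-p)
    rw [neg_neg, neg_neg, G.god_left] at h1
    linarith
  · have h1 := godunov_neg_neg hf (-p) (-kp)
    rw [neg_neg, neg_neg, G.god_right] at h1
    linarith

/-- The largest `p ≤ b` such that `g` stays above `g v` between `v` and `p`. -/
noncomputable def upReach (g : ℝ → ℝ) (b v : ℝ) : ℝ :=
  sSup {p | p ∈ Icc v b ∧ ∀ x ∈ Icc v p, g v ≤ g x}

lemma upReach_mem {g : ℝ → ℝ} (hg : Continuous g) {b v : ℝ} (hv : v ≤ b) :
    upReach g b v ∈ Icc v b ∧ ∀ x ∈ Icc v (upReach g b v), g v ≤ g x := by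
  have hcl : IsClosed {p | p ∈ Icc v b ∧ ∀ x ∈ Icc v p, g v ≤ g x} := by
    have e : {p | p ∈ Icc v b ∧ ∀ x ∈ Icc v p, g v ≤ g x} =
        Icc v b ∩ ⋂ x, {p | g v ≤ g (max v (min x p))} := by
      ext p
      simp only [mem_ofPred_eq, mem_inter_iff, mem_iInter]
      refine and_congr_right fun hp => ⟨fun h x => h _ ⟨le_max_left _ _,
        max_le hp.1 (min_le_right _ _)⟩, fun h x hx => ?_⟩
      have := h x
      rwa [min_eq_left hx.2, max_eq_right hx.1] at this
    rw [e]
    refine isClosed_Icc.inter (isClosed_iInter fun x => isClosed_le continuous_const ?_)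
    exact hg.comp (continuous_const.max (continuous_const.min continuous_id))
  exact hcl.csSup_mem ⟨v, left_mem_Icc.2 hv, fun x hx => by rw [le_antisymm hx.2 hx.1]⟩
    ⟨b, fun p hp => hp.1.2⟩

lemma le_upReach_iff {g : ℝ → ℝ} (hg : Continuous g) {b v c : ℝ} (hv : v ≤ b) :
    c ≤ upReach g b v ↔ c ≤ b ∧ ∀ x, g v ≤ g (max v (min x c)) := by
  obtain ⟨h1, h2⟩ := upReach_mem hg hv
  refine ⟨fun h => ⟨h.trans h1.2, fun x => h2 _ ⟨le_max_left _ _,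
    max_le h1.1 ((min_le_right _ _).trans h)⟩⟩, fun h => ?_⟩
  rcases le_total c v with hc | hc
  · exact hc.trans h1.1
  · refine le_csSup ⟨b, fun p hp => hp.1.2⟩ ⟨⟨hc, h.1⟩, fun x hx => ?_⟩
    have := h.2 x
    rwa [min_eq_left hx.2, max_eq_right hx.1] at this

lemma measurable_upReach {g : ℝ → ℝ} (hg : Continuous g) (b : ℝ) :
    Measurable fun v => upReach g b (min v b) := by
  refine measurable_of_Ici fun c => ?_
  have e : (fun v => upReach g b (min v b)) ⁻¹' Ici c =
      {v | c ≤ b ∧ ∀ x, g (min v b) ≤ g (max (min v b) (min x c))} := by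
    ext v
    exact le_upReach_iff hg (min_le_right v b)
  rw [e]
  by_cases hc : c ≤ b
  · simp only [hc, true_and, ofPred_forall]
    have hm : Continuous fun v : ℝ => min v b := continuous_id.min continuous_const
    exact (isClosed_iInter fun x => isClosed_le (hg.comp hm)
      (hg.comp (hm.max continuous_const))).measurableSet
  · simp [hc]

/-- Traces compatible with all stationary profiles leave no room for a crossing below the common
flux value. -/
lemma not_below_of_germ {a b L : ℝ} {f g : ℝ → ℝ} (H : FluxPair a b L f g) {v w : ℝ}
    (hv : v ∈ Icc a b) (hw : w ∈ Icc a b) (hvw : g v = f w)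
    (hG : ∀ km kp p c, IsGerm a b f g km kp p c → entFlux f w kp ≤ entFlux g v km)
    {c ξ : ℝ} (hc : v ≤ c) (hcξ : c ≤ ξ) (hξ : ξ ≤ w) (hgc : g c < g v) (hfξ : f ξ < g v) :
    False := by
  have hle : v ≤ w := hc.trans (hcξ.trans hξ)
  have cont : Continuous fun p => godunov g v p - godunov f p w := by
    have hg := isNumFlux_godunov H.pos.le H.lip_g
    have hf := isNumFlux_godunov H.pos.le H.lip_f
    have c1 : Continuous fun p => godunov g v p := continuous_of_abs_le (L := L) fun x y => by
      simpa using hg.abs_sub_le v x v y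
    have c2 : Continuous fun p => godunov f p w := continuous_of_abs_le (L := L) fun x y => by
      simpa using hf.abs_sub_le x w y w
    exact c1.sub c2
  have hd0 : 0 ≤ godunov g v v - godunov f v w := by
    rw [godunov_self]
    have := (godunov_of_le H.cont_f hle).2 ξ ⟨hc.trans hcξ, hξ⟩
    linarith
  have hd1 : godunov g v w - godunov f w w ≤ 0 := by
    rw [godunov_self]
    have := (godunov_of_le H.cont_g hle).2 c ⟨hc, hcξ.trans hξ⟩
    linarith
  obtain ⟨p, hp, hp0⟩ := intermediate_value_Icc' hle cont.continuousOn ⟨hd1, hd0⟩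
  obtain ⟨⟨km, hkm, hkm'⟩, hgm⟩ := godunov_of_le H.cont_g hp.1
  obtain ⟨⟨kp, hkp, hkp'⟩, hfm⟩ := godunov_of_le H.cont_f hp.2
  set d := godunov g v p with hd
  have hd2 : godunov f p w = d := by
    have : d - godunov f p w = 0 := hp0
    linarith
  rw [hd2] at hkp' hfm
  have hlt : d < g v := by
    rcases le_total c p with h | h
    · exact (hgm c ⟨hc, h⟩).trans_lt hgc
    · exact (hfm ξ ⟨h.trans hcξ, hξ⟩).trans_lt hfξ
  have key := hG km kp p d ⟨⟨hv.1.trans hkm.1, hkm.2.trans (hp.2.trans hw.2)⟩,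
    ⟨hv.1.trans (hp.1.trans hkp.1), hkp.2.trans hw.2⟩, ⟨hv.1.trans hp.1, hp.2.trans hw.2⟩,
    hkm'.symm, hkp'.symm,
    godunov_eq_of_le H.cont_g hkm.2 (fun x hx => hgm x ⟨hkm.1.trans hx.1, hx.2⟩)
      (Or.inl hkm'.symm),
    godunov_eq_of_le H.cont_f hkp.1 (fun x hx => hfm x ⟨hx.1, hx.2.trans hkp.2⟩)
      (Or.inr hkp'.symm)⟩
  unfold entFlux at key
  rw [max_eq_left hkp.2, min_eq_right hkp.2, max_eq_right hkm.1, min_eq_left hkm.1] at key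
  linarith

lemma interface_ineq {f g : ℝ → ℝ} {v w p : ℝ} (hp : p ∈ Icc v w) (hvw : g v = f w)
    (hg : ∀ x ∈ Icc v p, g v ≤ g x) (hf : ∀ x ∈ Icc p w, g v ≤ f x) (ξ : ℝ) :
    Real.sign (p - ξ) * (f ξ - g ξ) ≤ entFlux g v ξ - entFlux f w ξ := by
  unfold entFlux
  rcases lt_trichotomy ξ p with h | h | h
  · rw [Real.sign_of_pos (sub_pos.2 h), max_eq_left (h.le.trans hp.2), min_eq_right (h.le.trans hp.2)]
    rcases le_total ξ v with h1 | h1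
    · rw [max_eq_left h1, min_eq_right h1]
      linarith
    · rw [max_eq_right h1, min_eq_left h1]
      linarith [hg ξ ⟨h1, h.le⟩]
  · subst h
    rw [sub_self, Real.sign_zero, zero_mul, max_eq_left hp.2, min_eq_right hp.2,
      max_eq_right hp.1, min_eq_left hp.1]
    linarith [hg ξ ⟨hp.1, le_rfl⟩, hf ξ ⟨le_rfl, hp.2⟩]
  · rw [Real.sign_of_neg (sub_neg.2 h), max_eq_right (hp.1.trans h.le), min_eq_left (hp.1.trans h.le)]
    rcases le_total ξ w with h1 | h1
    · rw [max_eq_left h1, min_eq_right h1]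
      linarith [hf ξ ⟨h.le, h1⟩]
    · rw [max_eq_right h1, min_eq_left h1]
      linarith

lemma trace_flux_eq {a b L : ℝ} {f g : ℝ → ℝ} (H : FluxPair a b L f g) {v w : ℝ}
    (hv : v ∈ Icc a b) (hw : w ∈ Icc a b)
    (hG : ∀ km kp p c, IsGerm a b f g km kp p c → entFlux f w kp ≤ entFlux g v km) :
    g v = f w := by
  have ha := hG _ _ _ _ (IsLim.isGerm_const (left_mem_Icc.2 H.lt.le) H.eq_a)
  have hb := hG _ _ _ _ (IsLim.isGerm_const (right_mem_Icc.2 H.lt.le) H.eq_b)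
  unfold entFlux at ha hb
  rw [max_eq_left hv.1, max_eq_left hw.1, min_eq_right hv.1, min_eq_right hw.1, H.eq_a] at ha
  rw [max_eq_right hv.2, max_eq_right hw.2, min_eq_left hv.2, min_eq_left hw.2, H.eq_b] at hb
  linarith

lemma interface_up {a b L : ℝ} {f g : ℝ → ℝ} (H : FluxPair a b L f g) {v w : ℝ}
    (hv : v ∈ Icc a b) (hw : w ∈ Icc a b) (hle : v ≤ w)
    (hG : ∀ km kp p c, IsGerm a b f g km kp p c → entFlux f w kp ≤ entFlux g v km) (ξ : ℝ) :
    Real.sign (min (upReach g b v) w - ξ) * (f ξ - g ξ) ≤ entFlux g v ξ - entFlux f w ξ := by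
  have hvw := trace_flux_eq H hv hw hG
  obtain ⟨h1, h2⟩ := upReach_mem H.cont_g hv.2
  refine interface_ineq ⟨le_min h1.1 hle, min_le_right _ _⟩ hvw
    (fun x hx => h2 x ⟨hx.1, hx.2.trans (min_le_left _ _)⟩) (fun x hx => ?_) ξ
  by_contra hcon
  rw [not_le] at hcon
  have hxw : x < w := lt_of_le_of_ne hx.2 fun h => by
    rw [h] at hcon
    linarith
  have hr : upReach g b v ≤ x := by
    rcases min_le_iff.1 hx.1 with h | h
    · exact h
    · exact absurd hxw (not_lt.2 h)
  obtain ⟨y, hy, hyw, hfy⟩ : ∃ y, x < y ∧ y ≤ w ∧ f y < g v := by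
    have h3 : ∀ᶠ y in nhdsWithin x (Ioi x), f y < g v :=
      nhdsWithin_le_nhds ((H.cont_f.tendsto x).eventually (gt_mem_nhds hcon))
    have h4 : ∀ᶠ y in nhdsWithin x (Ioi x), y ∈ Ioc x w := Ioc_mem_nhdsGT hxw
    obtain ⟨y, hy1, hy2⟩ := (h3.and h4).exists
    exact ⟨y, hy2.1, hy2.2, hy1⟩
  have h5 : ¬ y ≤ upReach g b v := not_le.2 (hr.trans_lt hy)
  rw [le_upReach_iff H.cont_g hv.2, not_and] at h5
  have h6 := h5 (hyw.trans hw.2)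
  push Not at h6
  obtain ⟨z, hz⟩ := h6
  exact not_below_of_germ H hv hw hvw hG (le_max_left v (min z y))
    (max_le (h1.1.trans (hr.trans hy.le)) (min_le_right _ _)) hyw hz hfy

/-- The intermediate state at the interface with traces `v` and `w`. -/
noncomputable def interfaceState (a b : ℝ) (g : ℝ → ℝ) (v w : ℝ) : ℝ :=
  if v ≤ w then min (upReach g b v) w else max (-upReach (fun y => -g (-y)) (-a) (-v)) w

lemma interfaceState_mem {a b : ℝ} {g : ℝ → ℝ} (hg : Continuous g) {v w : ℝ}
    (hv : v ∈ Icc a b) (hw : w ∈ Icc a b) : interfaceState a b g v w ∈ Icc a b := by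
  unfold interfaceState
  split_ifs with h
  · obtain ⟨h1, -⟩ := upReach_mem hg hv.2
    exact ⟨le_min (hv.1.trans h1.1) hw.1, (min_le_right _ _).trans hw.2⟩
  · obtain ⟨h1, -⟩ := upReach_mem (g := fun y => -g (-y)) (hg.comp continuous_neg).neg
      (neg_le_neg hv.1)
    exact ⟨le_max_of_le_right hw.1, max_le (by linarith [h1.1, hv.2]) hw.2⟩

lemma interfaceState_ineq {a b L : ℝ} {f g : ℝ → ℝ} (H : FluxPair a b L f g) {v w : ℝ}
    (hv : v ∈ Icc a b) (hw : w ∈ Icc a b)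
    (hG : ∀ km kp p c, IsGerm a b f g km kp p c → entFlux f w kp ≤ entFlux g v km) (ξ : ℝ) :
    Real.sign (interfaceState a b g v w - ξ) * (f ξ - g ξ) ≤ entFlux g v ξ - entFlux f w ξ := by
  unfold interfaceState
  split_ifs with h
  · exact interface_up H hv hw h hG ξ
  · have hn : ∀ {x : ℝ}, x ∈ Icc a b → -x ∈ Icc (-b) (-a) := fun hx =>
      ⟨neg_le_neg hx.2, neg_le_neg hx.1⟩
    have h1 := interface_up H.dual (hn hv) (hn hw) (neg_le_neg (not_le.1 h).le)
      (fun km kp p c G => by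
        have := hG _ _ _ _ (G.dual H.cont_f H.cont_g)
        simpa only [entFlux_dual, neg_neg] using this) (-ξ)
    simp only [entFlux_dual, neg_neg] at h1
    rw [show min (upReach (fun y => -g (-y)) (-a) (-v)) (-w) - -ξ =
      -(max (-upReach (fun y => -g (-y)) (-a) (-v)) w - ξ) by
        rw [neg_sub, ← neg_neg w, max_neg_neg, neg_neg w]; ring, Real.sign_neg] at h1
    linarith

lemma measurable_interfaceState {a b : ℝ} {g : ℝ → ℝ} (hg : Continuous g) {ul ur : ℝ → ℝ}
    (hl : Measurable ul) (hr : Measurable ur) (hm : ∀ t, ul t ∈ Icc a b) :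
    Measurable fun t => interfaceState a b g (ul t) (ur t) := by
  have h1 : Measurable fun t => upReach g b (ul t) := by
    have := (measurable_upReach hg b).comp hl
    simpa only [Function.comp_def, min_eq_left (hm _).2] using this
  have h2 : Measurable fun t => upReach (fun y => -g (-y)) (-a) (-ul t) := by
    have := (measurable_upReach (g := fun y => -g (-y)) (hg.comp continuous_neg).neg (-a)).comp
      hl.neg
    simpa only [Function.comp_def, Pi.neg_apply, min_eq_left (neg_le_neg (hm _).1)] using this
  exact Measurable.ite (measurableSet_le hl hr) (h1.min hr) (h2.neg.max hr)

lemma hasTrace_const (c : ℝ) : HasTrace (fun _ => c) c :=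
  ⟨univ, by simp, tendsto_const_nhds⟩

namespace IsTestC1
variable {φ : ℝ × ℝ → ℝ}

lemma weakDiv_zero_const (hφ : IsTestC1 φ) (c : ℝ) : weakDiv (fun _ => 0) (fun _ => c) φ = 0 := by
  simp only [weakDiv, zero_mul, zero_add]
  rw [integral_const_mul, hφ.integral_fderiv, mul_zero]

/-- A flux that is constant on each side of the interface. -/
lemma weakDiv_zero_ite (hφ : IsTestC1 φ) (c d : ℝ) :
    weakDiv (fun _ => 0) (fun p => if 0 < p.2 then c else d) φ =
      -((c - d) * ∫ t, φ (t, 0)) := by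
  have h1 := hφ.weakDiv_right_tendsto (η := fun _ => 0) (q := fun _ => c) measurable_const
    measurable_const (B := |c|) (fun _ => by simp) (fun _ => le_rfl)
    (ae_of_all _ fun t _ => hasTrace_const c)
  have h2 := hφ.weakDiv_left_tendsto (η := fun _ => 0) (q := fun _ => d) measurable_const
    measurable_const (B := |d|) (fun _ => by simp) (fun _ => le_rfl)
    (ae_of_all _ fun t _ => hasTrace_const d)
  have e1 : ∀ n, weakDiv (fun _ => 0) (fun _ => c) (fun p => φ p * cutoff n p.2) = 0 := fun n =>
    (hφ.mul_fun (cutoff_contDiff n)).weakDiv_zero_const c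
  have e2 : ∀ n, weakDiv (fun _ => 0) (fun _ => d) (fun p => φ p * cutoff n (-p.2)) = 0 := fun n =>
    (hφ.mul_fun (θ := fun x => cutoff n (-x))
      ((cutoff_contDiff n).comp contDiff_neg)).weakDiv_zero_const d
  simp only [e1] at h1
  simp only [e2] at h2
  have h3 := tendsto_nhds_unique h1 tendsto_const_nhds
  have h4 := tendsto_nhds_unique h2 tendsto_const_nhds
  have hq : Measurable fun p : ℝ × ℝ => if 0 < p.2 then c else d :=
    Measurable.ite measurableSet_rightHalf measurable_const measurable_const
  have h5 := hφ.weakDiv_half_add (η := fun _ => 0) measurable_const hq (B := max |c| |d|)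
    (fun _ => by simp) (fun p => by split_ifs <;> simp)
  have e3 : (rightHalf.indicator fun p : ℝ × ℝ => if 0 < p.2 then c else d) =
      rightHalf.indicator fun _ => c := by
    funext p
    by_cases h : 0 < p.2 <;> simp [indicator, rightHalf, h]
  have e4 : (leftHalf.indicator fun p : ℝ × ℝ => if 0 < p.2 then c else d) =
      leftHalf.indicator fun _ => d := by
    funext p
    by_cases h : p.2 < 0
    · simp [indicator, leftHalf, h, not_lt.2 h.le]
    · simp [indicator, leftHalf, h]
  rw [e3, e4] at h5
  rw [integral_const_mul] at h3 h4
  linarith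

lemma integral_interface_eq_setIntegral (hφ : IsTestC1 φ) (w : ℝ → ℝ) :
    ∫ t in Ioi (0 : ℝ), w t * φ (t, 0) = ∫ t, w t * φ (t, 0) :=
  setIntegral_eq_integral_of_forall_compl_eq_zero fun t ht => by
    rw [hφ.eq_zero (p := (t, 0)) (not_lt.1 ht), mul_zero]

end IsTestC1

lemma sign_mul_sub_eq_entFlux (f : ℝ → ℝ) (x k : ℝ) :
    Real.sign (x - k) * (f x - f k) = entFlux f x k := by
  unfold entFlux
  rcases lt_trichotomy x k with h | h | h
  · rw [Real.sign_of_neg (sub_neg.2 h), max_eq_right h.le, min_eq_left h.le]; ring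
  · simp [h]
  · rw [Real.sign_of_pos (sub_pos.2 h), max_eq_left h.le, min_eq_right h.le]; ring

lemma abs_sign_le_one (x : ℝ) : |Real.sign x| ≤ 1 := by
  rcases Real.sign_apply_eq x with h | h | h <;> simp [h]

lemma measurable_sign : Measurable Real.sign :=
  Measurable.ite measurableSet_Iio measurable_const
    (Measurable.ite measurableSet_Ioi measurable_const measurable_const)

namespace IsLim
variable {a b L M : ℝ} {f g : ℝ → ℝ} {U : ℕ → ℕ → ℤ → ℝ} {h : ℕ → ℝ} {u : ℝ → ℝ → ℝ}
  {ul ur : ℝ → ℝ} {φ : ℝ × ℝ → ℝ}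

lemma weakDiv_sub_state (H : FluxPair a b L f g) (S : IsLim a b L M f g U h u) (hφ : IsTestC1 φ)
    (ξ c d : ℝ) :
    weakDiv (fun p => u p.1 p.2 - ξ)
        (fun p => if 0 < p.2 then f (u p.1 p.2) - c else g (u p.1 p.2) - d) φ =
      (c - d) * ∫ t, φ (t, 0) := by
  obtain ⟨B, h1, h2⟩ := S.exists_flux_bound H
  have hq : Measurable fun p : ℝ × ℝ => if 0 < p.2 then c else d :=
    Measurable.ite measurableSet_rightHalf measurable_const measurable_const
  have i1 := hφ.weakDiv_integrable S.meas (S.measurable_flux H) h1 h2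
  have i2 := (hφ.integrable_fderiv (1, 0)).const_mul ξ
  have i3 := hφ.integrable_mul_fderiv (0, 1) hq (B := max |c| |d|)
    (fun p => by split_ifs <;> simp)
  have h3 := hφ.weakDiv_zero_ite c d
  have h4 := S.weak_solution H hφ
  simp only [weakDiv, zero_mul, zero_add] at h3
  rw [weakDiv] at h4
  have h5 : weakDiv (fun p => u p.1 p.2 - ξ)
        (fun p => if 0 < p.2 then f (u p.1 p.2) - c else g (u p.1 p.2) - d) φ =
      (∫ p, (u p.1 p.2 * fderiv ℝ φ p (1, 0) +
        (if 0 < p.2 then f (u p.1 p.2) else g (u p.1 p.2)) * fderiv ℝ φ p (0, 1))) -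
      (∫ p, ξ * fderiv ℝ φ p (1, 0)) -
      ∫ p, (if 0 < p.2 then c else d) * fderiv ℝ φ p (0, 1) := by
    rw [weakDiv, ← integral_sub i1 i2, ← integral_sub (by exact i1.sub i2) i3]
    refine integral_congr_ae (ae_of_all _ fun p => ?_)
    dsimp only
    split_ifs <;> ring
  rw [h5, h4, h3, integral_const_mul, hφ.integral_fderiv]
  ring

lemma interface_entropy (H : FluxPair a b L f g) (S : IsLim a b L M f g U h u)
    (T : HasTraces a b u ul ur) (hφ : IsTestC1 φ) (hφ0 : ∀ p, 0 ≤ φ p) {ξ : ℝ}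
    (hξ : ξ ∈ Icc a b) :
    ∫ t, Real.sign (interfaceState a b g (ul t) (ur t) - ξ) * (f ξ - g ξ) * φ (t, 0) ≤
      weakDiv (fun p => |u p.1 p.2 - ξ|)
        (fun p => if 0 < p.2 then entFlux f (u p.1 p.2) ξ else entFlux g (u p.1 p.2) ξ) φ := by
  have hr := S.entropy_right H T hφ hφ0 hξ
  have hl := S.entropy_left H T hφ hφ0 hξ
  have hB : ∀ {F : ℝ → ℝ} {x : ℝ}, (∀ x y, |F x - F y| ≤ L * |x - y|) → x ∈ Icc a b →
      |entFlux F x ξ| ≤ L * (b - a) := fun hF hx => abs_entFlux_le_of_mem H.pos.le hF hx hξ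
  have hsplit := hφ.weakDiv_half_add (S.measurable_eta ξ)
    (q := fun p => if 0 < p.2 then entFlux f (u p.1 p.2) ξ else entFlux g (u p.1 p.2) ξ)
    (Measurable.ite measurableSet_rightHalf (S.measurable_entFlux H.cont_f ξ)
      (S.measurable_entFlux H.cont_g ξ)) (B := max (b - a) (L * (b - a)))
    (fun p => by
      rw [abs_abs]
      exact (abs_sub_le_of_mem (S.mem _ _) hξ).trans (le_max_left _ _))
    (fun p => by
      refine le_trans ?_ (le_max_right _ _)
      split_ifs
      · exact hB H.lip_f (S.mem _ _)
      · exact hB H.lip_g (S.mem _ _))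
  have e1 : (rightHalf.indicator fun p : ℝ × ℝ =>
      if 0 < p.2 then entFlux f (u p.1 p.2) ξ else entFlux g (u p.1 p.2) ξ) =
      rightHalf.indicator fun p => entFlux f (u p.1 p.2) ξ := by
    funext p
    by_cases h : 0 < p.2 <;> simp [indicator, rightHalf, h]
  have e2 : (leftHalf.indicator fun p : ℝ × ℝ =>
      if 0 < p.2 then entFlux f (u p.1 p.2) ξ else entFlux g (u p.1 p.2) ξ) =
      leftHalf.indicator fun p => entFlux g (u p.1 p.2) ξ := by
    funext p
    by_cases h : p.2 < 0
    · simp [indicator, leftHalf, h, not_lt.2 h.le]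
    · simp [indicator, leftHalf, h]
  rw [e1, e2] at hsplit
  have m1 := (continuous_entFlux_left H.cont_f ξ).measurable.comp T.meas_right
  have m2 := (continuous_entFlux_left H.cont_g ξ).measurable.comp T.meas_left
  have mp := measurable_interfaceState H.cont_g T.meas_left T.meas_right T.mem_left
  have i1 : Integrable fun t => entFlux f (ur t) ξ * φ (t, 0) := hφ.integrable_slice m1 fun t => hB H.lip_f (T.mem_right t)
  have i2 : Integrable fun t => entFlux g (ul t) ξ * φ (t, 0) := hφ.integrable_slice m2 fun t => hB H.lip_g (T.mem_left t)
  have i3 := hφ.integrable_slice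
    (w := fun t => Real.sign (interfaceState a b g (ul t) (ur t) - ξ) * (f ξ - g ξ))
    ((measurable_sign.comp (mp.sub_const ξ)).mul_const _) (B := |f ξ - g ξ|) fun t => by
      rw [abs_mul]
      exact mul_le_of_le_one_left (abs_nonneg _) (abs_sign_le_one _)
  have hle : ∫ t, Real.sign (interfaceState a b g (ul t) (ur t) - ξ) * (f ξ - g ξ) * φ (t, 0) ≤
      (∫ t, entFlux g (ul t) ξ * φ (t, 0)) - ∫ t, entFlux f (ur t) ξ * φ (t, 0) := by
    rw [← integral_sub i2 i1]
    refine integral_mono_ae i3 (i2.sub i1) ?_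
    filter_upwards [S.germ_trace H T] with t ht
    by_cases h0 : 0 < t
    · have := interfaceState_ineq H (T.mem_left t) (T.mem_right t) (ht h0) ξ
      have := mul_le_mul_of_nonneg_right this (hφ0 (t, 0))
      linarith
    · simp [hφ.eq_zero (p := (t, 0)) (not_lt.1 h0)]
  linarith

end IsLim

lemma IsTestFun.isTestC1 {φ : ℝ × ℝ → ℝ} (hφ : IsTestFun φ) : IsTestC1 φ :=
  ⟨hφ.1.of_le (by exact_mod_cast le_top), hφ.2.1, hφ.2.2⟩

/-- Truncation of a flux outside the invariant interval. -/
def clampFlux (a b : ℝ) (f : ℝ → ℝ) (x : ℝ) : ℝ := f (max a (min b x))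

lemma clampFlux_of_mem {a b x : ℝ} (f : ℝ → ℝ) (hx : x ∈ Icc a b) : clampFlux a b f x = f x := by
  rw [clampFlux, min_eq_right hx.2, max_eq_right hx.1]

lemma exists_clampFlux_lipschitz {a b : ℝ} (hab : a ≤ b) {f : ℝ → ℝ} (hf : ContDiff ℝ 1 f) :
    ∃ L : ℝ, 0 < L ∧ ∀ x y, |clampFlux a b f x - clampFlux a b f y| ≤ L * |x - y| := by
  obtain ⟨K, hK⟩ := (hf.contDiffOn (s := Icc a b)).exists_lipschitzOnWith one_ne_zero
    (convex_Icc a b) isCompact_Icc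
  have hm : ∀ x, max a (min b x) ∈ Icc a b := fun x =>
    ⟨le_max_left _ _, max_le hab (min_le_left _ _)⟩
  refine ⟨K + 1, by positivity, fun x y => ?_⟩
  have h1 := hK.dist_le_mul _ (hm x) _ (hm y)
  rw [Real.dist_eq, Real.dist_eq] at h1
  have h2 : |max a (min b x) - max a (min b y)| ≤ |x - y| :=
    (abs_max_sub_max_le_max _ _ _ _).trans (max_le (by simp) ((abs_min_sub_min_le_max _ _ _ _).trans
      (max_le (by simp) le_rfl)))
  calc |clampFlux a b f x - clampFlux a b f y| ≤ K * |max a (min b x) - max a (min b y)| := h1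
    _ ≤ (K + 1) * |x - y| := by gcongr; linarith

lemma exists_clampFlux_ne {a b : ℝ} {f : ℝ → ℝ}
    (hf : ∀ c d : ℝ, a ≤ c → c < d → d ≤ b → ¬ ∃ k : ℝ, ∀ x ∈ Ioo c d, deriv f x = k)
    (c d : ℝ) (hac : a ≤ c) (hcd : c < d) (hdb : d ≤ b) :
    ∃ x ∈ Icc c d, clampFlux a b f x ≠ clampFlux a b f c := by
  by_contra! hcon
  refine hf c d hac hcd hdb ⟨0, fun x hx => ?_⟩
  have h1 : f =ᶠ[nhds x] fun _ => clampFlux a b f c := by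
    filter_upwards [Ioo_mem_nhds hx.1 hx.2] with y hy
    rw [← hcon y ⟨hy.1.le, hy.2.le⟩, clampFlux_of_mem f ⟨hac.trans hy.1.le, hy.2.le.trans hdb⟩]
  rw [h1.deriv_eq, deriv_const]

lemma exists_fluxPair {a b : ℝ} (hab : a < b) {f g : ℝ → ℝ}
    (hf : ContDiff ℝ 1 f) (hg : ContDiff ℝ 1 g) (hfa : f a = g a) (hfb : f b = g b)
    (hgnlf : ∀ c d : ℝ, a ≤ c → c < d → d ≤ b → ¬ ∃ k : ℝ, ∀ x ∈ Ioo c d, deriv f x = k)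
    (hgnlg : ∀ c d : ℝ, a ≤ c → c < d → d ≤ b → ¬ ∃ k : ℝ, ∀ x ∈ Ioo c d, deriv g x = k) :
    ∃ L, FluxPair a b L (clampFlux a b f) (clampFlux a b g) := by
  obtain ⟨Lf, hLf, h1⟩ := exists_clampFlux_lipschitz hab.le hf
  obtain ⟨Lg, -, h2⟩ := exists_clampFlux_lipschitz hab.le hg
  have ha := left_mem_Icc.2 hab.le
  have hb := right_mem_Icc.2 hab.le
  exact ⟨max Lf Lg, hab, lt_max_of_lt_left hLf,
    fun x y => (h1 x y).trans (mul_le_mul_of_nonneg_right (le_max_left _ _) (abs_nonneg _)),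
    fun x y => (h2 x y).trans (mul_le_mul_of_nonneg_right (le_max_right _ _) (abs_nonneg _)),
    by rw [clampFlux_of_mem f ha, clampFlux_of_mem g ha, hfa],
    by rw [clampFlux_of_mem f hb, clampFlux_of_mem g hb, hfb],
    exists_clampFlux_ne hgnlf, exists_clampFlux_ne hgnlg⟩

lemma heav_mul_add {x : ℝ} (hx : x ≠ 0) (c d : ℝ) :
    heav x * c + heav (-x) * d = if 0 < x then c else d := by
  unfold heav
  rcases lt_or_gt_of_ne hx with h | h
  · simp [h, not_lt.2 h.le]
  · simp [h, not_lt.2 h.le]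

/-- The Heaviside form of the weak divergence. -/
lemma integral_heav_eq_weakDiv (η q r φ : ℝ × ℝ → ℝ) (s : ℝ × ℝ → ℝ) :
    ∫ p : ℝ × ℝ, (η p * fderiv ℝ φ p (1, 0) +
        s p * (heav p.2 * q p + heav (-p.2) * r p) * fderiv ℝ φ p (0, 1)) =
      weakDiv η (fun p => if 0 < p.2 then s p * q p else s p * r p) φ := by
  have hne : ∀ᵐ x : ℝ, x ≠ 0 := by simp [ae_iff]
  refine integral_congr_ae ?_
  filter_upwards [ae_snd hne] with p hp
  rw [heav_mul_add hp]
  split_ifs <;> rfl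

theorem isWeakSolution_of_isLim {a b L M : ℝ} {f g u₀ : ℝ → ℝ} {U : ℕ → ℕ → ℤ → ℝ} {h : ℕ → ℝ}
    {u : ℝ → ℝ → ℝ} (H : FluxPair a b L (clampFlux a b f) (clampFlux a b g))
    (S : IsLim a b L M (clampFlux a b f) (clampFlux a b g) U h u) (hu₀ : Continuous u₀)
    (hU : ∀ k j, U k 0 j = u₀ (j * h k)) : IsWeakSolution f g u u₀ := by
  refine ⟨fun φ hφ => ?_, fun K hK => S.initial_tendsto H hu₀ hU hK⟩
  have h1 := S.weak_solution H hφ.isTestC1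
  simp only [clampFlux_of_mem _ (S.mem _ _)] at h1
  refine Eq.trans ?_ h1
  have h2 := integral_heav_eq_weakDiv (fun p => u p.1 p.2) (fun p => f (u p.1 p.2))
    (fun p => g (u p.1 p.2)) φ (fun _ => 1)
  simpa only [one_mul] using h2

theorem entropyAdmissible_of_isLim {a b L M : ℝ} {f g : ℝ → ℝ} {U : ℕ → ℕ → ℤ → ℝ}
    {h : ℕ → ℝ} {u : ℝ → ℝ → ℝ} (H : FluxPair a b L (clampFlux a b f) (clampFlux a b g))
    (S : IsLim a b L M (clampFlux a b f) (clampFlux a b g) U h u) :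
    EntropyAdmissible f g a b u := by
  obtain ⟨ul, ur, T⟩ := S.exists_hasTraces H
  have hp : ∀ t, interfaceState a b (clampFlux a b g) (ul t) (ur t) ∈ Icc a b := fun t =>
    interfaceState_mem H.cont_g (T.mem_left t) (T.mem_right t)
  refine ⟨ae_of_all _ fun q _ => S.mem _ _,
    fun t => interfaceState a b (clampFlux a b g) (ul t) (ur t),
    measurable_interfaceState H.cont_g T.meas_left T.meas_right T.mem_left, hp,
    fun ξ φ hφ hφ0 => ?_⟩
  have hφ' := hφ.isTestC1
  rw [hφ'.integral_interface_eq_setIntegral, ge_iff_le, sub_nonneg,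
    integral_heav_eq_weakDiv (fun p => |u p.1 p.2 - ξ|) (fun p => f (u p.1 p.2) - f ξ)
      (fun p => g (u p.1 p.2) - g ξ) φ fun p => Real.sign (u p.1 p.2 - ξ)]
  have h1 := S.weakDiv_sub_state H hφ' ξ (f ξ) (g ξ)
  simp only [clampFlux_of_mem _ (S.mem _ _)] at h1
  rcases lt_or_ge ξ a with hξa | hξa
  · have hs : ∀ {x : ℝ}, x ∈ Icc a b → 0 < x - ξ := fun hx => sub_pos.2 (hξa.trans_le hx.1)
    simp only [Real.sign_of_pos (hs (hp _)), Real.sign_of_pos (hs (S.mem _ _)),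
      abs_of_pos (hs (S.mem _ _)), one_mul]
    rw [h1, integral_const_mul]
  rcases lt_or_ge b ξ with hξb | hξb
  · have hs : ∀ {x : ℝ}, x ∈ Icc a b → x - ξ < 0 := fun hx => sub_neg.2 (hx.2.trans_lt hξb)
    simp only [Real.sign_of_neg (hs (hp _)), Real.sign_of_neg (hs (S.mem _ _)),
      abs_of_neg (hs (S.mem _ _)), neg_mul, one_mul, ← apply_ite]
    rw [integral_neg, integral_const_mul, ← h1, ← IsTestC1.weakDiv_neg]
  · have hξ : ξ ∈ Icc a b := ⟨hξa, hξb⟩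
    have h2 := S.interface_entropy H T hφ' hφ0 hξ
    simp only [← sign_mul_sub_eq_entFlux, clampFlux_of_mem _ (S.mem _ _),
      clampFlux_of_mem _ hξ] at h2
    exact h2

/-- Existence of an entropy admissible weak solution under genuine nonlinearity
of the flux (`f'` and `g'` are not constant on any nondegenerate subinterval of
`(a, b)`), for smooth compactly supported initial data with values in `[a, b]`. -/
theorem stmt_18 (a b : ℝ) (hab : a < b) (f g : ℝ → ℝ)
    (hf : ContDiff ℝ 1 f) (hg : ContDiff ℝ 1 g)
    (hfa : f a = g a) (hfb : f b = g b)
    (hgnlf : ∀ c d : ℝ, a ≤ c → c < d → d ≤ b →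
      ¬ ∃ k : ℝ, ∀ x ∈ Set.Ioo c d, deriv f x = k)
    (hgnlg : ∀ c d : ℝ, a ≤ c → c < d → d ≤ b →
      ¬ ∃ k : ℝ, ∀ x ∈ Set.Ioo c d, deriv g x = k)
    (u₀ : ℝ → ℝ) (hu₀smooth : ContDiff ℝ (⊤ : ℕ∞) u₀) (hu₀supp : HasCompactSupport u₀)
    (hu₀ab : ∀ x, u₀ x ∈ Set.Icc a b) :
    ∃ u : ℝ → ℝ → ℝ, IsWeakSolution f g u u₀ ∧ EntropyAdmissible f g a b u := by
  obtain ⟨L, H⟩ := exists_fluxPair hab hf hg hfa hfb hgnlf hgnlg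
  obtain ⟨M, U, h, u, S, hU⟩ := exists_isLim H
    (hu₀smooth.of_le (by exact_mod_cast le_top)) hu₀supp hu₀ab
  exact ⟨u, isWeakSolution_of_isLim H S hu₀smooth.continuous hU, entropyAdmissible_of_isLim H S⟩
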